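/- Let α ∈ ℂ be nonzero, let n ≥ 3, let c ∈ ℂ satisfy c² = (2α)⁻¹, and let φ : Mₙ(ℂ) → Mₙ(ℂ) be a map whose range contains c·P for every matrix P that is a nonzero idempotent or an anti-idempotent. Suppose that for all A, B ∈ Mₙ(ℂ), α(AB + BA) is idempotent if and only if α(φ(A)φ(B) + φ(B)φ(A)) is idempotent. Then there exist a field automorphism σ of ℂ, an invertible matrix T ∈ Mₙ(ℂ), and c_α ∈ ℂ with c_α² = σ(α)/α such that either φ([x_{ij}]) = c_α·T [σ(x_{ij})] T⁻¹ for all [x_{ij}] ∈ Mₙ(ℂ), or φ([x_{ij}]) = c_α·T [σ(x_{ij})]ᵗ T⁻¹ for all [x_{ij}] ∈ Mₙ(ℂ), where [σ(x_{ij})] is the matrix obtained by applying σ entrywise and ᵗ denotes transposition. -/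

import Mathlib

open Matrix


abbrev Mat (m : ℕ) := Matrix (Fin m) (Fin m) ℂ

def rel {m : ℕ} (A B : Mat m) : Prop :=
  (A * B + B * A) * (A * B + B * A) = (2:ℂ) • (A * B + B * A)

def EqK {m : ℕ} (K : Set (Mat m)) (A A' : Mat m) : Prop := ∀ B ∈ K, rel A B ↔ rel A' B

def BaseK {m : ℕ} (K : Set (Mat m)) : Prop :=
  ∀ x f : Fin m → ℂ, f ⬝ᵥ x = 1 → ∀ l : ℂ, l • vecMulVec x f ∈ K

def CloK {m : ℕ} (K : Set (Mat m)) : Prop :=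
  ∀ A, (∀ A', EqK K A A' → A' = A) → A ∈ K

def TT (m : ℕ) : Prop := ∀ K : Set (Mat m), BaseK K → CloK K → ∀ A, A ∈ K

def SepM (m : ℕ) : Prop := ∀ A A' : Mat m, (∀ B, rel A B ↔ rel A' B) → A' = A

theorem rel_symm {m : ℕ} {A B : Mat m} : rel A B ↔ rel B A := by
  unfold rel; rw [add_comm (A * B)]

theorem rel_transpose {m : ℕ} {A B : Mat m} : rel Aᵀ Bᵀ ↔ rel A B := by
  unfold rel
  rw [← Matrix.transpose_inj]
  simp only [transpose_mul, transpose_add, transpose_smul, transpose_transpose]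
  rw [add_comm (B * A)]

theorem rel_of_anti {m : ℕ} {A B : Mat m} (h : A * B + B * A = 0) : rel A B := by
  unfold rel; simp [h]

theorem rel_neg {m : ℕ} {A B : Mat m} (h1 : rel A B) (h2 : rel A (-B)) : A * B + B * A = 0 := by
  unfold rel at h1 h2
  have e : A * -B + -B * A = -(A * B + B * A) := by noncomm_ring
  rw [e, neg_mul_neg, h1, smul_neg] at h2
  have : (4:ℂ) • (A * B + B * A) = 0 := by
    have h3 := add_eq_zero_iff_eq_neg.2 h2
    rw [← add_smul] at h3; norm_num at h3; 
    simpa using h3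
  rcases smul_eq_zero.1 this with h | h
  · norm_num at h
  · exact h

theorem idem_orth {m : ℕ} {A P : Mat m} (hP : P * P = P) (h : A * P + P * A = 0) :
    A * P = 0 ∧ P * A = 0 := by
  have h1 : P * A * P + P * A = 0 := by
    have := congrArg (fun Z => P * Z) h
    simpa [mul_add, ← mul_assoc, hP] using this
  have h2 : A * P + P * A * P = 0 := by
    have := congrArg (fun Z => Z * P) h
    simpa [add_mul, mul_assoc, hP] using this
  have h3 : P * A = A * P := by
    have : P * A - A * P = 0 := by
      calc P * A - A * P = (P * A * P + P * A) - (A * P + P * A * P) := by noncomm_ring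
        _ = 0 := by rw [h1, h2, sub_zero]
    exact sub_eq_zero.1 this
  rw [h3, ← two_smul ℂ] at h
  have h4 : A * P = 0 := by simpa using h
  exact ⟨h4, h3.trans h4⟩

theorem rel_lin {m : ℕ} {A X Y : Mat m} (h0 : rel A X) (h1 : rel A (X + Y)) (h2 : rel A (X - Y)) :
    (A * Y + Y * A) * (A * Y + Y * A) = 0 := by
  unfold rel at *
  have e1 : A * (X + Y) + (X + Y) * A = (A * X + X * A) + (A * Y + Y * A) := by noncomm_ring
  have e2 : A * (X - Y) + (X - Y) * A = (A * X + X * A) - (A * Y + Y * A) := by noncomm_ring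
  rw [e1] at h1
  rw [e2] at h2
  generalize A * X + X * A = U at *
  generalize A * Y + Y * A = V at *
  have : (2:ℂ) • (V * V) = 0 := by
    have : (2:ℂ) • (V * V) = (U + V) * (U + V) + (U - V) * (U - V) - (2:ℂ) • (U * U) := by
      rw [two_smul, two_smul]; noncomm_ring
    rw [this, h0, h1, h2]; module
  simpa using this

theorem trace_of_sq {m : ℕ} {A Y : Mat m} (h : (A * Y + Y * A) * (A * Y + Y * A) = 0) :
    trace (A * Y) = 0 := by
  have h1 : IsNilpotent (A * Y + Y * A) := ⟨2, by rw [pow_two, h]⟩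
  have h2 := (Matrix.isNilpotent_trace_of_isNilpotent h1).eq_zero
  rw [trace_add, trace_mul_comm Y A, ← two_mul] at h2
  simpa using h2

theorem rel_corner {m k : ℕ} {A : Mat m} {a b : Mat k} {ι : Matrix (Fin m) (Fin k) ℂ}
    {π : Matrix (Fin k) (Fin m) ℂ} (h : π * ι = 1) (h1 : A * ι = ι * a) (h2 : π * A = a * π) :
    rel A (ι * b * π) ↔ rel a b := by
  have e : A * (ι * b * π) + ι * b * π * A = ι * (a * b + b * a) * π := by
    have : A * (ι * b * π) = (A * ι) * b * π := by simp only [Matrix.mul_assoc]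
    rw [this, h1, Matrix.mul_assoc (ι * b), h2]
    simp only [Matrix.mul_assoc, Matrix.mul_add, Matrix.add_mul]
  unfold rel
  rw [e]
  generalize a * b + b * a = w
  have e2 : ι * w * π * (ι * w * π) = ι * (w * w) * π := by
    calc ι * w * π * (ι * w * π) = ι * w * (π * ι) * w * π := by simp only [Matrix.mul_assoc]
      _ = _ := by rw [h]; simp only [Matrix.mul_assoc, Matrix.one_mul]
  rw [e2]
  have inj : ∀ u : Mat k, π * (ι * u * π) * ι = u := by
    intro u
    calc π * (ι * u * π) * ι = (π * ι) * u * (π * ι) := by simp only [Matrix.mul_assoc]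
      _ = u := by rw [h]; simp
  constructor
  · intro h3
    have := congrArg (fun Z => π * Z * ι) h3
    simp only [inj] at this
    rw [this, Matrix.mul_smul, Matrix.smul_mul, inj]
  · intro h3; rw [h3]; simp

theorem rel_corner' {m k : ℕ} {a b : Mat k} {ι : Matrix (Fin m) (Fin k) ℂ}
    {π : Matrix (Fin k) (Fin m) ℂ} (h : π * ι = 1) :
    rel (ι * a * π) (ι * b * π) ↔ rel a b := by
  apply rel_corner h
  · rw [Matrix.mul_assoc, h, Matrix.mul_one]
  · rw [← Matrix.mul_assoc, ← Matrix.mul_assoc, h, Matrix.one_mul]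

theorem rank_one_idem {m : ℕ} {x f : Fin m → ℂ} (h : f ⬝ᵥ x = 1) :
    vecMulVec x f * vecMulVec x f = vecMulVec x f := by
  rw [vecMulVec_mul_vecMulVec, h, one_smul]

theorem exists_dual {m : ℕ} {x : Fin m → ℂ} (h : x ≠ 0) : ∃ f : Fin m → ℂ, f ⬝ᵥ x = 1 := by
  obtain ⟨i, hi⟩ := Function.ne_iff.1 h
  refine ⟨Pi.single i (x i)⁻¹, ?_⟩
  rw [single_dotProduct, inv_mul_cancel₀ hi]

theorem ext_mulVec {m k : ℕ} {A B : Matrix (Fin m) (Fin k) ℂ} (h : ∀ v, A *ᵥ v = B *ᵥ v) : A = B := by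
  apply Matrix.toLin'.injective
  ext1 
  ext v
  simp [toLin'_apply, h]

theorem kill_compl {m : ℕ} {K : Set (Mat m)} (hB : BaseK K) {A A' Q : Mat m} (hE : EqK K A A')
    (hQ : Q * Q = Q) (h1 : A * Q = 0) (h2 : Q * A = 0) : A' * Q = 0 ∧ Q * A' = 0 := by
  have key : ∀ x f : Fin m → ℂ, f ⬝ᵥ x = 1 → Q *ᵥ x = x → f ᵥ* Q = f →
      A' *ᵥ x = 0 ∧ f ᵥ* A' = 0 := by
    intro x f hfx hx hf
    have hP := rank_one_idem hfx
    have hAx : A * vecMulVec x f = 0 := by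
      rw [← hx, ← mul_vecMulVec, ← Matrix.mul_assoc, h1, Matrix.zero_mul]
    have hxA : vecMulVec x f * A = 0 := by
      rw [← hf, ← vecMulVec_mul, Matrix.mul_assoc, h2, Matrix.mul_zero]
    have r1 : rel A' (vecMulVec x f) := by
      rw [← hE _ (by simpa using hB x f hfx 1)]
      apply rel_of_anti; rw [hAx, hxA, add_zero]
    have r2 : rel A' (-vecMulVec x f) := by
      rw [← hE _ (by simpa using hB x f hfx (-1))]
      apply rel_of_anti; rw [mul_neg, neg_mul, hAx, hxA]; simp
    obtain ⟨h3, h4⟩ := idem_orth hP (rel_neg r1 r2)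
    constructor
    · have := congrArg (fun Z => Z *ᵥ x) h3
      simpa [← mulVec_mulVec, vecMulVec_mulVec, hfx] using this
    · have := congrArg (fun Z => f ᵥ* Z) h4
      simpa [← vecMul_vecMul, vecMul_vecMulVec, hfx] using this
  constructor
  · apply ext_mulVec
    intro v
    rw [← mulVec_mulVec, zero_mulVec]
    by_cases hv : Q *ᵥ v = 0
    · rw [hv, mulVec_zero]
    obtain ⟨g, hg⟩ := exists_dual hv
    refine (key (Q *ᵥ v) (g ᵥ* Q) ?_ ?_ ?_).1
    · rw [← dotProduct_mulVec, mulVec_mulVec, hQ, hg]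
    · rw [mulVec_mulVec, hQ]
    · rw [vecMul_vecMul, hQ]
  · rw [← Matrix.transpose_inj]
    apply ext_mulVec
    intro v
    rw [mulVec_transpose, ← vecMul_vecMul, transpose_zero, zero_mulVec]
    by_cases hv : v ᵥ* Q = 0
    · rw [hv, zero_vecMul]
    obtain ⟨g, hg⟩ := exists_dual hv
    refine (key (Q *ᵥ g) (v ᵥ* Q) ?_ ?_ ?_).2
    · rw [dotProduct_mulVec, vecMul_vecMul, hQ, dotProduct_comm, hg]
    · rw [mulVec_mulVec, hQ]
    · rw [vecMul_vecMul, hQ]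

theorem vmv_conj {m k : ℕ} (ι : Matrix (Fin m) (Fin k) ℂ) (π : Matrix (Fin k) (Fin m) ℂ)
   (x f : Fin k → ℂ) : ι * vecMulVec x f * π = vecMulVec (ι *ᵥ x) (f ᵥ* π) := by
  rw [mul_vecMulVec, vecMulVec_mul]

theorem corn {m k : ℕ} {K : Set (Mat m)} (hB : BaseK K) (hC : CloK K) (hT : TT k)
    {ι : Matrix (Fin m) (Fin k) ℂ}
    {π : Matrix (Fin k) (Fin m) ℂ} (h : π * ι = 1) (a : Mat k) : ι * a * π ∈ K := by
  apply hT {a | ι * a * π ∈ K}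
  · intro x f hf l
    show _ ∈ K
    rw [Matrix.mul_smul, Matrix.smul_mul, vmv_conj]
    apply hB
    rw [← dotProduct_mulVec, mulVec_mulVec, h, one_mulVec, hf]
  · intro a ha
    apply hC
    intro A' hE
    have h1 : ι * a * π * (1 - ι * π) = 0 := by
      rw [Matrix.mul_sub, Matrix.mul_one, Matrix.mul_assoc (ι * a), ← Matrix.mul_assoc π, h]; simp
    have h2 : (1 - ι * π) * (ι * a * π) = 0 := by
      rw [Matrix.sub_mul, Matrix.one_mul, Matrix.mul_assoc ι π, ← Matrix.mul_assoc π,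
       ← Matrix.mul_assoc π, h]; simp [Matrix.mul_assoc]
    have hQ : (1 - ι * π) * (1 - ι * π) = 1 - ι * π := by
      have : ι * π * (ι * π) = ι * π := by
        rw [Matrix.mul_assoc, ← Matrix.mul_assoc π, h, Matrix.one_mul]
      calc _ = 1 - ι * π - ι * π + ι * π * (ι * π) := by noncomm_ring
        _ = _ := by rw [this]; simp
    obtain ⟨h3, h4⟩ := kill_compl hB hE hQ h1 h2
    have h5 : A' = ι * (π * A' * ι) * π := by
      rw [Matrix.mul_sub, Matrix.mul_one, sub_eq_zero] at h3
      rw [Matrix.sub_mul, Matrix.one_mul, sub_eq_zero] at h4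
      calc A' = ι * π * A' := h4
        _ = ι * π * (A' * (ι * π)) := by rw [← h3]
        _ = _ := by simp only [Matrix.mul_assoc]
    rw [h5, ha (π * A' * ι)]
    intro b hb
    have := hE _ hb
    rw [h5, rel_corner' h, rel_corner' h] at this
    exact this

theorem vmv_sandwich {m : ℕ} (x f : Fin m → ℂ) (A : Mat m) :
    vecMulVec x f * A * vecMulVec x f = (f ⬝ᵥ (A *ᵥ x)) • vecMulVec x f := by
  rw [Matrix.mul_assoc, mul_vecMulVec, vecMulVec_mul_vecMulVec]
  ext i j; simp [vecMulVec_apply]; ring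

theorem sepM_of_TT {m : ℕ} (hT : TT m) : SepM m := by
  intro A
  apply hT {A | ∀ A', (∀ B, rel A B ↔ rel A' B) → A' = A}
  · intro x f hf l A' hA'
    have hPP := rank_one_idem hf
    have hE : EqK Set.univ (l • vecMulVec x f) A' := fun B _ => hA' B
    have hB : BaseK (Set.univ : Set (Mat m)) := fun _ _ _ _ => trivial
    set P := vecMulVec x f with hP
    have hP0 : P ≠ 0 := by
      intro h0
      have := congrArg trace h0
      rw [hP, trace_vecMulVec, dotProduct_comm, hf] at this; simp at this
    obtain ⟨h3, h4⟩ := kill_compl hB (Q := 1 - P) hE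
      (by rw [Matrix.mul_sub, Matrix.sub_mul, Matrix.sub_mul, hPP]; simp) (by simp [Matrix.mul_sub, hPP])
       (by simp [Matrix.sub_mul, hPP])
    rw [Matrix.mul_sub, Matrix.mul_one, sub_eq_zero] at h3
    rw [Matrix.sub_mul, Matrix.one_mul, sub_eq_zero] at h4
    have h5 : A' = (f ⬝ᵥ (A' *ᵥ x)) • P := by
      rw [← vmv_sandwich, ← hP, ← h4, ← h3]
    generalize f ⬝ᵥ (A' *ᵥ x) = s at h5
    have calcR : ∀ a b : ℂ, rel (a • P) (b • P) ↔ a * b = 0 ∨ a * b = 1 := by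
      intro a b
      unfold rel
      simp only [Matrix.smul_mul, Matrix.mul_smul, hPP, smul_smul, ← add_smul]
      rw [← sub_eq_zero, ← sub_smul, smul_eq_zero]
      simp only [hP0, or_false]
      constructor
      · intro h
        have : (a * b) * (a * b - 1) = 0 := by linear_combination h / 4
        rcases mul_eq_zero.1 this with h | h
        · left; exact h
        · right; linear_combination h
      · rintro (h | h)
        · linear_combination (4 * a * b - 4) * h
        · linear_combination (4 * a * b) * h
    rw [h5]
    have hr : ∀ b : ℂ, (l * b = 0 ∨ l * b = 1) ↔ (s * b = 0 ∨ s * b = 1) := by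
      intro b
      rw [← calcR, ← calcR, ← h5]
      exact hA' _
    congr 1
    by_cases hl : l = 0
    · subst hl
      have := hr (2)
      have h2 := hr 1
      simp at this h2
      rcases this with h | h
      · exact h
      · rcases h2 with h2 | h2
        · exact h2
        · rw [h2] at h; norm_num at h
    · have h1 := hr l⁻¹
      have h2 := hr (2 * l⁻¹)
      have e : l * (2 * l⁻¹) = 2 := by field_simp
      rw [mul_inv_cancel₀ hl] at h1
      rw [e] at h2
      simp [hl] at h1 h2
      rcases h1 with h1 | h1
      · exact absurd h1 h2.1
      · field_simp at h1; exact h1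
  · intro A hA A' hA'
    exact hA A' (fun B _ => hA' B)

theorem half1 {m k : ℕ} {K : Set (Mat m)} (hB : BaseK K) (hC : CloK K) (hT : TT k)
    {ι : Matrix (Fin m) (Fin k) ℂ} {π : Matrix (Fin k) (Fin m) ℂ} (h : π * ι = 1)
    {A A' : Mat m} (hE : EqK K A A') {a g : Mat k} (hA : A * ι = ι * a) (hg : g * a = 1) :
    A' * ι = ι * (π * A' * ι) := by
  have hg' : a * g = 1 := mul_eq_one_comm.1 hg
  set Q := 1 - ι * π with hQ
  have hQι : Q * ι = 0 := by rw [hQ, Matrix.sub_mul, Matrix.mul_assoc, h]; simp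
  have key : ∀ Y : Matrix (Fin k) (Fin m) ℂ, rel A' (ι * g * π + ι * Y * Q) := by
    intro Y
    have hp : (π + a * Y * Q) * ι = 1 := by
      rw [Matrix.add_mul, h, Matrix.mul_assoc, hQι]; simp
    have hX : ι * g * π + ι * Y * Q = ι * g * (π + a * Y * Q) := by
      rw [Matrix.mul_add]
      congr 1
      calc ι * Y * Q = ι * (g * a) * Y * Q := by rw [hg]; simp
        _ = _ := by simp only [Matrix.mul_assoc]
    have hm : ι * g * π + ι * Y * Q ∈ K := by
      rw [hX]; exact corn hB hC hT hp g
    rw [← hE _ hm, hX]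
    generalize π + a * Y * Q = p at *
    unfold rel
    have e : A * (ι * g * p) + ι * g * p * A = ι * (p + g * p * A) := by
      calc _ = (A * ι) * g * p + ι * g * p * A := by simp only [Matrix.mul_assoc]
        _ = ι * (a * g) * p + ι * g * p * A := by rw [hA]; simp only [Matrix.mul_assoc]
        _ = _ := by rw [hg']; simp only [Matrix.mul_assoc, Matrix.mul_add, Matrix.mul_one, Matrix.one_mul]
    have e2 : (p + g * p * A) * ι = (2:ℂ) • (1 : Mat k) := by
      rw [Matrix.add_mul, hp, Matrix.mul_assoc, hA, Matrix.mul_assoc, ← Matrix.mul_assoc p, hp,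
        Matrix.one_mul, hg, two_smul]
    rw [e, Matrix.mul_assoc, ← Matrix.mul_assoc _ ι, e2, Matrix.smul_mul, Matrix.one_mul,
      Matrix.mul_smul]
  have key2 : ∀ Y : Matrix (Fin k) (Fin m) ℂ, trace (A' * (ι * Y * Q)) = 0 := by
    intro Y
    apply trace_of_sq
    apply rel_lin (X := ι * g * π)
    · simpa using key 0
    · exact key Y
    · have := key (-Y)
      simpa [sub_eq_add_neg] using this
  have h3 : Q * A' * ι = 0 := by
    ext i j
    have := key2 (Matrix.single j i 1)
    rw [← Matrix.mul_assoc, trace_mul_comm, ← Matrix.mul_assoc, ← Matrix.mul_assoc,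
      Matrix.trace_mul_single] at this
    simpa using this
  rw [hQ, Matrix.sub_mul, Matrix.sub_mul, Matrix.one_mul, sub_eq_zero] at h3
  rw [h3]; simp only [Matrix.mul_assoc]

def trK {m : ℕ} (K : Set (Mat m)) : Set (Mat m) := {A | Aᵀ ∈ K}

theorem baseK_tr {m : ℕ} {K : Set (Mat m)} (hB : BaseK K) : BaseK (trK K) := by
  intro x f hf l
  show _ ∈ K
  rw [transpose_smul, transpose_vecMulVec]
  exact hB _ _ (by rw [dotProduct_comm, hf]) _

theorem eqK_tr {m : ℕ} {K : Set (Mat m)} {A A' : Mat m} (hE : EqK K A A') :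
    EqK (trK K) Aᵀ A'ᵀ := by
  intro B hB
  have := hE _ hB
  rwa [← rel_transpose, ← rel_transpose (A := A'), transpose_transpose] at this

theorem cloK_tr {m : ℕ} {K : Set (Mat m)} (hC : CloK K) : CloK (trK K) := by
  intro A hA
  apply hC
  intro A' hE
  rw [← hA A'ᵀ, transpose_transpose]
  have := eqK_tr hE
  rwa [transpose_transpose] at this

theorem half2 {m k : ℕ} {K : Set (Mat m)} (hB : BaseK K) (hC : CloK K) (hT : TT k)
    {ι : Matrix (Fin m) (Fin k) ℂ} {π : Matrix (Fin k) (Fin m) ℂ} (h : π * ι = 1)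
    {A A' : Mat m} (hE : EqK K A A') {a g : Mat k} (hA : π * A = a * π) (hg : a * g = 1) :
    π * A' = (π * A' * ι) * π := by
  have := half1 (baseK_tr hB) (cloK_tr hC) hT (ι := πᵀ) (π := ιᵀ)
    (by rw [← transpose_mul, h, transpose_one]) (eqK_tr hE) (a := aᵀ) (g := gᵀ)
     (by rw [← transpose_mul, hA, transpose_mul]) (by rw [← transpose_mul, hg, transpose_one])
  rw [← transpose_inj]
  rw [transpose_mul, this]
  simp only [transpose_mul, Matrix.mul_assoc]

theorem idem_factor {m : ℕ} {S : Mat m} (hS : S * S = S) :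
    ∃ (k : ℕ) (ι : Matrix (Fin m) (Fin k) ℂ) (π : Matrix (Fin k) (Fin m) ℂ),
      π * ι = 1 ∧ ι * π = S ∧ (S ≠ 1 → k < m) := by
  let s := Matrix.toLin' S
  let V := LinearMap.range s
  let b := Module.finBasis ℂ V
  let k := Module.finrank ℂ V
  let p : (Fin m → ℂ) →ₗ[ℂ] (Fin k → ℂ) := b.equivFun.toLinearMap ∘ₗ s.rangeRestrict
  let i : (Fin k → ℂ) →ₗ[ℂ] (Fin m → ℂ) := V.subtype ∘ₗ b.equivFun.symm.toLinearMap
  have hss : ∀ v, s (s v) = s v := by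
    intro v; simp only [s, toLin'_apply, mulVec_mulVec, hS]
  have h1 : LinearMap.toMatrix' p * LinearMap.toMatrix' i = 1 := by
    rw [← LinearMap.toMatrix'_comp, ← LinearMap.toMatrix'_id]
    congr 1
    refine LinearMap.ext fun v => ?_
    simp only [LinearMap.comp_apply, p, i, LinearMap.id_apply]
    simp only [LinearEquiv.coe_coe, Submodule.subtype_apply]
    have : s.rangeRestrict ((b.equivFun.symm v : V) : Fin m → ℂ) = b.equivFun.symm v := by
      apply Subtype.ext
      obtain ⟨w, hw⟩ := (b.equivFun.symm v).2
      show s _ = _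
      rw [← hw, hss]
    rw [this, LinearEquiv.apply_symm_apply]
  have h2 : LinearMap.toMatrix' i * LinearMap.toMatrix' p = S := by
    rw [← LinearMap.toMatrix'_comp]
    apply Matrix.toLin'.injective
    rw [Matrix.toLin'_toMatrix']
    refine LinearMap.ext fun v => ?_
    simp only [LinearMap.comp_apply, p, i]
    simp [s]
  refine ⟨k, LinearMap.toMatrix' i, LinearMap.toMatrix' p, h1, h2, ?_⟩
  intro hne
  have hle : k ≤ m := by
    have := Submodule.finrank_le V
    simpa using this
  rcases hle.lt_or_eq with h | h
  · exact h
  · exfalso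
    apply hne
    have hV : V = ⊤ := Submodule.eq_top_of_finrank_eq (by simpa using h)
    apply ext_mulVec
    intro v
    have : v ∈ V := by rw [hV]; trivial
    obtain ⟨w, hw⟩ := this
    rw [← hw, one_mulVec]
    exact hss w

theorem compl_idem {m k : ℕ} {ι : Matrix (Fin m) (Fin k) ℂ}
    {π : Matrix (Fin k) (Fin m) ℂ} (h : π * ι = 1) : (1 - ι * π) * (1 - ι * π) = 1 - ι * π := by
  have : ι * π * (ι * π) = ι * π := by
    rw [Matrix.mul_assoc, ← Matrix.mul_assoc π, h, Matrix.one_mul]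
  calc _ = 1 - ι * π - ι * π + ι * π * (ι * π) := by noncomm_ring
    _ = _ := by rw [this]; simp

theorem corner_eq {m k : ℕ} {K : Set (Mat m)} (hB : BaseK K) (hC : CloK K) (hT : TT k)
    {ι : Matrix (Fin m) (Fin k) ℂ} {π : Matrix (Fin k) (Fin m) ℂ} (h : π * ι = 1)
    {A A' : Mat m} (hE : EqK K A A') {a a' : Mat k} (h1 : A * ι = ι * a) (h2 : π * A = a * π)
    (h3 : A' * ι = ι * a') (h4 : π * A' = a' * π) : a' = a := by
  apply sepM_of_TT hT
  intro b
  have := hE _ (corn hB hC hT h b)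
  rwa [rel_corner h h1 h2, rel_corner h h3 h4] at this

theorem split_comm {m k : ℕ} {K : Set (Mat m)} (hB : BaseK K) (hC : CloK K)
    (hT : ∀ j < m, TT j) (hk : k < m) (hk0 : 0 < k)
    {ι : Matrix (Fin m) (Fin k) ℂ} {π : Matrix (Fin k) (Fin m) ℂ} (h : π * ι = 1)
    {A A' : Mat m} (hE : EqK K A A') {a a' : Mat k} (h1 : A * ι = ι * a) (h2 : π * A = a * π)
    (h3 : A' * ι = ι * a') (h4 : π * A' = a' * π) : A' = A := by
  have haa := corner_eq hB hC (hT k hk) h hE h1 h2 h3 h4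
  obtain ⟨l, ι2, π2, g1, g2, g3⟩ := idem_factor (compl_idem h)
  have hl : l < m := by
    apply g3
    intro h0
    have : ι * π = 0 := by rwa [sub_eq_self] at h0
    have h5 : (1 : Mat k) = 0 := by
      calc (1 : Mat k) = π * ι * (π * ι) := by rw [h]; simp
        _ = π * (ι * π) * ι := by simp only [Matrix.mul_assoc]
        _ = 0 := by rw [this]; simp
    have := congrFun (congrFun h5 ⟨0, hk0⟩) ⟨0, hk0⟩
    simp at this
  have e1 : ∀ (B : Mat m) (b : Mat k), B * ι = ι * b → π * B = b * π →
     B * ι2 = ι2 * (π2 * B * ι2) ∧ π2 * B = (π2 * B * ι2) * π2 := by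
    intro B b hb1 hb2
    have hc : B * (ι2 * π2) = ι2 * π2 * B := by
      rw [g2, Matrix.mul_sub, Matrix.sub_mul, ← Matrix.mul_assoc, hb1, Matrix.mul_assoc ι π, hb2]
      simp [Matrix.mul_assoc]
    constructor
    · calc B * ι2 = B * ι2 * (π2 * ι2) := by rw [g1]; simp
        _ = (B * (ι2 * π2)) * ι2 := by simp only [Matrix.mul_assoc]
        _ = _ := by rw [hc]; simp only [Matrix.mul_assoc]
    · calc π2 * B = (π2 * ι2) * π2 * B := by rw [g1]; simp
        _ = π2 * ((ι2 * π2) * B) := by simp only [Matrix.mul_assoc]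
        _ = _ := by rw [← hc]; simp only [Matrix.mul_assoc]
  obtain ⟨p1, p2⟩ := e1 A a h1 h2
  obtain ⟨q1, q2⟩ := e1 A' a' h3 h4
  have hbb := corner_eq hB hC (hT l hl) g1 hE p1 p2 q1 q2
  have e2 : ∀ (B : Mat m), B = (B * ι) * π + (B * ι2) * π2 := by
    intro B
    rw [Matrix.mul_assoc, Matrix.mul_assoc, ← Matrix.mul_add, g2]; simp
  rw [e2 A', e2 A, h3, q1, h1, p1, haa, hbb]

theorem split_inv {m k : ℕ} {K : Set (Mat m)} (hB : BaseK K) (hC : CloK K)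
    (hT : ∀ j < m, TT j) (hk : k < m) (hk0 : 0 < k)
    {ι : Matrix (Fin m) (Fin k) ℂ} {π : Matrix (Fin k) (Fin m) ℂ} (h : π * ι = 1)
    {A A' : Mat m} (hE : EqK K A A') {a g : Mat k} (h1 : A * ι = ι * a) (h2 : π * A = a * π)
    (hg : g * a = 1) : A' = A :=
  split_comm hB hC hT hk hk0 h hE h1 h2 (half1 hB hC (hT k hk) h hE h1 hg)
    (half2 hB hC (hT k hk) h hE h2 (mul_eq_one_comm.1 hg))

theorem split_Z {m k : ℕ} {K : Set (Mat m)} (hB : BaseK K) (hC : CloK K)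
    (hT : ∀ j < m, TT j) (hk : k < m) (hk0 : 0 < k)
    {ι : Matrix (Fin m) (Fin k) ℂ} {π : Matrix (Fin k) (Fin m) ℂ} (h : π * ι = 1)
    {A A' : Mat m} (hE : EqK K A A') {a z g : Mat k} (h1 : A * ι = ι * a) (h2 : π * A = a * π)
    (hz : a * z + z * a = 0) (hg : g * z = 1) : A' = A := by
  have hg' := mul_eq_one_comm.1 hg
  have mem := corn hB hC (hT k hk) h
  have r1 : rel A' (ι * z * π) := by
    rw [← hE _ (mem z), rel_corner h h1 h2]; exact rel_of_anti hz
  have r2 : rel A' (-(ι * z * π)) := by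
    have : -(ι * z * π) = ι * (-z) * π := by simp
    rw [this, ← hE _ (mem (-z)), rel_corner h h1 h2]; apply rel_of_anti
    rw [Matrix.mul_neg, Matrix.neg_mul, ← neg_add, hz, neg_zero]
  have h5 := rel_neg r1 r2
  have h6 : A' * (ι * z * π) = - (ι * z * π * A') := eq_neg_of_add_eq_zero_left h5
  have h3 : A' * ι = ι * (-(z * π * A' * ι * g)) := by
    calc A' * ι = A' * ι * (z * g) := by rw [hg']; simp
      _ = (A' * (ι * z * π)) * ι * g := by
        have : A' * (ι * z * π) * ι * g = A' * ι * z * (π * ι) * g := by simp only [Matrix.mul_assoc]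
        rw [this, h]; simp [Matrix.mul_assoc]
      _ = _ := by rw [h6]; simp only [Matrix.mul_assoc, Matrix.neg_mul, Matrix.mul_neg]
  have h6' : ι * z * π * A' = - (A' * (ι * z * π)) := eq_neg_of_add_eq_zero_right h5
  have h4 : π * A' = (-(g * π * A' * ι * z)) * π := by
    calc π * A' = (g * z) * π * A' := by rw [hg]; simp
      _ = g * π * (ι * z * π * A') := by
        have : g * π * (ι * z * π * A') = g * (π * ι) * z * π * A' := by simp only [Matrix.mul_assoc]
        rw [this, h]; simp [Matrix.mul_assoc]
      _ = _ := by rw [h6']; simp only [Matrix.mul_assoc, Matrix.neg_mul, Matrix.mul_neg]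
  have e : (-(g * π * A' * ι * z)) = (-(z * π * A' * ι * g)) := by
    have f1 : π * A' * ι = -(z * π * A' * ι * g) := by
      rw [Matrix.mul_assoc, h3, ← Matrix.mul_assoc, h, Matrix.one_mul]
    have f2 : π * A' * ι = -(g * π * A' * ι * z) := by
      rw [h4, Matrix.mul_assoc, h, Matrix.mul_one]
    rw [← f1, ← f2]
  rw [e] at h4
  exact split_comm hB hC hT hk hk0 h hE h1 h2 h3 h4


open Polynomial in
theorem fit {m : ℕ} (B : Mat m) : ∃ S G : Mat m, S * S = S ∧ S * B = B * S ∧ G * B * S = S ∧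
    IsNilpotent (B * (1 - S)) := by
  have h0 : B.charpoly ≠ 0 := (Matrix.charpoly_monic B).ne_zero
  obtain ⟨q, hq, hnd⟩ := Polynomial.exists_eq_pow_rootMultiplicity_mul_and_not_dvd B.charpoly h0 0
  set r := B.charpoly.rootMultiplicity 0
  rw [C_0, sub_zero] at hq hnd
  have hcop : IsCoprime ((X : ℂ[X]) ^ (r + 1)) q := by
    apply IsCoprime.pow_left
    exact (Polynomial.irreducible_X.coprime_iff_not_dvd).2 hnd
  obtain ⟨u, v, huv⟩ := hcop
  obtain ⟨ev, hX, hev⟩ : ∃ ev : ℂ[X] →+* Mat m, ev X = B ∧ ev B.charpoly = 0 :=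
    ⟨(aeval B : ℂ[X] →ₐ[ℂ] Mat m).toRingHom, aeval_X B, Matrix.aeval_self_charpoly B⟩
  rw [hq] at hev
  clear_value r
  clear hq h0 hnd
  have hz1 : ∀ p : ℂ[X], ev (p * (X ^ r * q)) = 0 := by
    intro p; rw [map_mul, hev, mul_zero]
  have h1 : (1 : Mat m) - ev (u * X ^ (r + 1)) = ev (v * q) := by
    rw [sub_eq_iff_eq_add, ← map_add, add_comm (v * q), huv, map_one]
  have hidem : ev (u * X ^ (r + 1)) * ev (u * X ^ (r + 1)) = ev (u * X ^ (r + 1)) := by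
    have : ev (u * X ^ (r + 1)) * (1 - ev (u * X ^ (r + 1))) = 0 := by
      rw [h1, ← map_mul, ← hz1 (u * X * v)]
      congr 1; ring
    rw [mul_sub, mul_one, sub_eq_zero] at this
    exact this.symm
  refine ⟨ev (u * X ^ (r + 1)), ev (u * X ^ r), hidem, ?_, ?_, r + 1, ?_⟩
  · rw [← hX, ← map_mul, ← map_mul, mul_comm]
  · have : ev (u * X ^ r) * B = ev (u * X ^ (r + 1)) := by
      rw [← hX, ← map_mul]; congr 1; ring
    rw [this, hidem]
  · rw [h1, ← hX, ← map_mul, ← map_pow, ← hz1 (X * v * (v * q) ^ r)]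
    congr 1; ring

theorem reduce {m : ℕ} (hm : 0 < m) {K : Set (Mat m)} (hB : BaseK K) (hC : CloK K)
    (hT : ∀ j < m, TT j) {A A' : Mat m} (hE : EqK K A A') :
    A' = A ∨ ∃ (d : ℂ) (N : Mat m), A = d • 1 + N ∧ IsNilpotent N := by
  have split : ∀ S G : Mat m, S * S = S → S * A = A * S → G * A * S = S → S ≠ 0 → S ≠ 1 → A' = A := by
    intro S G hS hc hG h0 h1
    obtain ⟨k, ι, π, e1, e2, e3⟩ := idem_factor hS
    have hk0 : 0 < k := by
      rcases Nat.eq_zero_or_pos k with h | h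
      · subst h
        exfalso; apply h0; rw [← e2]; ext i j; simp [Matrix.mul_apply]
      · exact h
    have hSι : S * ι = ι := by rw [← e2, Matrix.mul_assoc, e1, Matrix.mul_one]
    have hπS : π * S = π := by rw [← e2, ← Matrix.mul_assoc, e1, Matrix.one_mul]
    refine split_inv hB hC hT (e3 h1) hk0 e1 hE (a := π * A * ι) (g := π * G * ι) ?_ ?_ ?_
    · calc A * ι = A * S * ι := by rw [Matrix.mul_assoc, hSι]
        _ = S * A * ι := by rw [hc]
        _ = _ := by rw [← e2]; simp only [Matrix.mul_assoc]
    · calc π * A = π * (S * A) := by rw [← Matrix.mul_assoc, hπS]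
        _ = π * (A * S) := by rw [hc]
        _ = _ := by rw [← e2]; simp only [Matrix.mul_assoc]
    · calc π * G * ι * (π * A * ι) = π * (G * (ι * π * A)) * ι := by simp only [Matrix.mul_assoc]
        _ = π * (G * A * S) * ι := by rw [e2, hc]; simp only [Matrix.mul_assoc]
        _ = 1 := by rw [hG, hπS, e1]
  obtain ⟨S, G, hS, hc, hG, hN⟩ := fit A
  by_cases h0 : S = 0
  · right
    refine ⟨0, A, by simp, ?_⟩
    simpa [h0] using hN
  by_cases h1 : S = 1
  · subst h1
    rw [mul_one] at hG
    have hm' : Nonempty (Fin m) := ⟨⟨0, hm⟩⟩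
    obtain ⟨d, hd⟩ := Module.End.exists_eigenvalue (Matrix.toLin' A)
    obtain ⟨v, hv⟩ := hd.exists_hasEigenvector
    obtain ⟨S', G', hS', hc', hG', hN'⟩ := fit (A - d • 1)
    by_cases h0' : S' = 0
    · right
      refine ⟨d, A - d • 1, by simp, ?_⟩
      simpa [h0'] using hN'
    · left
      have hcA : S' * A = A * S' := by
        have : S' * A - A * S' = S' * (A - d • 1) - (A - d • 1) * S' := by
          rw [mul_sub, sub_mul]; simp
        rw [← sub_eq_zero, this, hc', sub_self]
      apply split S' G hS' hcA _ h0' _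
      · rw [hG, one_mul]
      · intro h1'
        rw [h1', mul_one] at hG'
        have h2 : (A - d • 1) *ᵥ v = 0 := by
          have := hv.apply_eq_smul
          rw [toLin'_apply] at this
          rw [sub_mulVec, this, smul_mulVec, one_mulVec, sub_self]
        apply hv.2
        calc v = (G' * (A - d • 1)) *ᵥ v := by rw [hG', one_mulVec]
          _ = 0 := by rw [← mulVec_mulVec, h2, mulVec_zero]
  · left
    exact split S G hS hc hG h0 h1

def shf (m : ℕ) : Mat m := Matrix.of fun i j => if (i : ℕ) = j + 1 then 1 else 0

def blk (m : ℕ) (d : ℂ) : Mat m := d • 1 + shf m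

theorem chain {m : ℕ} {N : Mat m} {l : ℕ} (h1 : N ^ l ≠ 0) (h2 : N ^ (l + 1) = 0) :
    ∃ x f : Fin m → ℂ, ∀ i, f ⬝ᵥ (N ^ i *ᵥ x) = if i = l then 1 else 0 := by
  have hz : ∀ i, l < i → N ^ i = 0 := by
    intro i hi
    obtain ⟨t, rfl⟩ := Nat.exists_eq_add_of_lt hi
    rw [show l + t + 1 = (l + 1) + t by ring, pow_add, h2, zero_mul]
  obtain ⟨x, hx⟩ : ∃ x, N ^ l *ᵥ x ≠ 0 := by
    by_contra hcon
    push Not at hcon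
    exact h1 (ext_mulVec (fun v => by rw [hcon, zero_mulVec]))
  obtain ⟨f0, hf0⟩ := exists_dual hx
  have key : ∀ j ≤ l, ∃ f : Fin m → ℂ, f ⬝ᵥ (N ^ l *ᵥ x) = 1 ∧
      ∀ t, 1 ≤ t → t ≤ j → f ⬝ᵥ (N ^ (l - t) *ᵥ x) = 0 := by
    intro j
    induction j with
    | zero => intro _; exact ⟨f0, hf0, fun t ht ht' => by omega⟩
    | succ j ih =>
      intro hj
      obtain ⟨f, hf, hf'⟩ := ih (by omega)
      refine ⟨f - (f ⬝ᵥ (N ^ (l - (j + 1)) *ᵥ x)) • (f ᵥ* N ^ (j + 1)), ?_, ?_⟩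
      · rw [sub_dotProduct, smul_dotProduct, hf, ← dotProduct_mulVec, mulVec_mulVec, ← pow_add,
          hz (j + 1 + l) (by omega)]
        simp
      · intro t ht ht'
        rw [sub_dotProduct, smul_dotProduct, ← dotProduct_mulVec, mulVec_mulVec, ← pow_add]
        rcases ht'.lt_or_eq with h | h
        · rw [hf' t ht (by omega), hz (j + 1 + (l - t)) (by omega)]; simp
        · subst h
          rw [show j + 1 + (l - (j + 1)) = l by omega, hf]; simp
  obtain ⟨f, hf, hf'⟩ := key l le_rfl
  refine ⟨x, f, fun i => ?_⟩
  split_ifs with h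
  · rw [h, hf]
  · rcases lt_or_gt_of_ne h with h | h
    · have := hf' (l - i) (by omega) (by omega)
      rwa [show l - (l - i) = i by omega] at this
    · rw [hz _ h]; simp

theorem block_corner {m : ℕ} {N : Mat m} {l : ℕ} (h1 : N ^ l ≠ 0) (h2 : N ^ (l + 1) = 0) :
    ∃ (ι : Matrix (Fin m) (Fin (l + 1)) ℂ) (π : Matrix (Fin (l + 1)) (Fin m) ℂ),
      π * ι = 1 ∧ N * ι = ι * shf (l + 1) ∧ π * N = shf (l + 1) * π := by
  obtain ⟨x, f, h⟩ := chain h1 h2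
  refine ⟨Matrix.of fun a i => (N ^ (i : ℕ) *ᵥ x) a, Matrix.of fun i a => (f ᵥ* N ^ (l - (i : ℕ))) a,
    ?_, ?_, ?_⟩
  · ext i j
    have : ((Matrix.of fun (i : Fin (l+1)) a => (f ᵥ* N ^ (l - (i : ℕ))) a) *
      (Matrix.of fun a (i : Fin (l+1)) => (N ^ (i : ℕ) *ᵥ x) a)) i j =
       (f ᵥ* N ^ (l - (i : ℕ))) ⬝ᵥ (N ^ (j : ℕ) *ᵥ x) := by
      simp [Matrix.mul_apply, dotProduct]
    rw [this, ← dotProduct_mulVec, mulVec_mulVec, ← pow_add, h, Matrix.one_apply]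
    have hi := i.2
    have hj := j.2
    simp only [Fin.ext_iff]
    congr 1
    rw [eq_iff_iff]; omega
  · ext a j
    have e1 : (N * (Matrix.of fun a (i : Fin (l+1)) => (N ^ (i : ℕ) *ᵥ x) a)) a j
       = (N ^ ((j : ℕ) + 1) *ᵥ x) a := by
      rw [pow_succ', ← mulVec_mulVec]
      simp [Matrix.mul_apply, mulVec, dotProduct]
    rw [e1, Matrix.mul_apply]
    simp only [shf, of_apply]
    by_cases hj : (j : ℕ) < l
    · rw [Finset.sum_eq_single ⟨j + 1, by omega⟩]
      · simp
      · intro b _ hb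
        have : ¬ ((b : ℕ) = j + 1) := fun h => hb (Fin.ext h)
        simp [this]
      · simp
    · have : (j : ℕ) = l := by have := j.2; omega
      rw [this, h2, zero_mulVec, Finset.sum_eq_zero]
      · rfl
      · intro b _
        have := b.2
        rw [if_neg (by omega), mul_zero]
  · ext i a
    have e1 : ((Matrix.of fun (i : Fin (l+1)) a => (f ᵥ* N ^ (l - (i : ℕ))) a) * N) i a
       = (f ᵥ* N ^ (l - (i : ℕ) + 1)) a := by
      rw [pow_succ, ← vecMul_vecMul]
      simp [Matrix.mul_apply, vecMul, dotProduct]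
    rw [e1, Matrix.mul_apply]
    simp only [shf, of_apply]
    have hi := i.2
    by_cases hj : 0 < (i : ℕ)
    · rw [Finset.sum_eq_single ⟨i - 1, by omega⟩]
      · simp only
        rw [if_pos (by omega), one_mul]
        congr 3
        omega
      · intro b _ hb
        have : ¬ ((i : ℕ) = b + 1) := fun h => hb (Fin.ext (by simp; omega))
        simp [this]
      · simp
    · rw [show l - (i : ℕ) + 1 = l + 1 by omega, h2, vecMul_zero, Finset.sum_eq_zero]
      · rfl
      · intro b _
        rw [if_neg (by omega), zero_mul]

theorem blk_inv (m : ℕ) {d : ℂ} (hd : d ≠ 0) : ∃ g, g * blk m d = 1 := by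
  have : (blk m d).det = d ^ m := by
    rw [Matrix.det_of_isLowerTriangular]
    · simp [blk, shf]
    · intro i j hij
      have hij : j > i := hij
      have : (j : ℕ) > i := hij
      simp [blk, shf, hij.ne]; omega
  refine ⟨(blk m d)⁻¹, Matrix.nonsing_inv_mul _ ?_⟩
  rw [this]; exact (isUnit_iff_ne_zero.2 hd).pow _

def sgn (m : ℕ) : Mat m := Matrix.diagonal fun i => (-1) ^ (i : ℕ)

theorem sgn_sq (m : ℕ) : sgn m * sgn m = 1 := by
  rw [sgn, diagonal_mul_diagonal, ← diagonal_one]; congr 1; ext i; simp [← mul_pow]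

theorem sgn_shf (m : ℕ) : shf m * sgn m + sgn m * shf m = 0 := by
  ext i j
  simp [sgn, shf]
  split_ifs with h
  · rw [h, pow_succ]; simp
  · simp

theorem baseK_conj {m : ℕ} {K : Set (Mat m)} (hB : BaseK K) {ι π : Mat m} (h : π * ι = 1) :
    BaseK {B | ι * B * π ∈ K} := by
  intro x f hf l
  show _ ∈ K
  rw [Matrix.mul_smul, Matrix.smul_mul, vmv_conj]
  apply hB
  rw [← dotProduct_mulVec, mulVec_mulVec, h, one_mulVec, hf]

theorem conjm_inv {m : ℕ} {ι π : Mat m} (h : π * ι = 1) (A : Mat m) : ι * (π * A * ι) * π = A := by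
  have h' := mul_eq_one_comm.1 h
  calc ι * (π * A * ι) * π = (ι * π) * A * (ι * π) := by simp only [Matrix.mul_assoc]
    _ = A := by rw [h']; simp

theorem eqK_conj {m : ℕ} {K : Set (Mat m)} {ι π : Mat m} (h : π * ι = 1)
   {A A' : Mat m} (hE : EqK K A A') : EqK {B | ι * B * π ∈ K} (π * A * ι) (π * A' * ι) := by
  intro B hB
  have := hE _ hB
  have e1 := conjm_inv h A
  have e2 := conjm_inv h A'
  rw [← e1, ← e2, rel_corner' h, rel_corner' h] at this
  exact this

theorem cloK_conj {m : ℕ} {K : Set (Mat m)} (hC : CloK K) {ι π : Mat m} (h : π * ι = 1) :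
    CloK {B | ι * B * π ∈ K} := by
  have h' := mul_eq_one_comm.1 h
  intro A hA
  apply hC
  intro A' hE
  have h1 := eqK_conj h hE
  have h2 : π * (ι * A * π) * ι = A := conjm_inv h' A
  rw [h2] at h1
  have := hA _ h1
  rw [← this, conjm_inv h]

theorem det_blk {m : ℕ} (hm : 0 < m) (hT : ∀ j < m, TT j) (d : ℂ)
    (hblk : ∀ K : Set (Mat m), BaseK K → CloK K → ∀ A', EqK K (blk m d) A' → A' = blk m d)
    {K : Set (Mat m)} (hB : BaseK K) (hC : CloK K) {N A' : Mat m} (hN : IsNilpotent N)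
    (hE : EqK K (d • 1 + N) A') : A' = d • 1 + N := by
  have hex : ∃ l, N ^ (l + 1) = 0 := by
    obtain ⟨r, hr⟩ := hN
    exact ⟨r, by rw [pow_succ, hr, zero_mul]⟩
  classical
  have hl := Nat.find_spec hex
  have hl' : N ^ (Nat.find hex) ≠ 0 := by
    intro h0
    rcases Nat.eq_zero_or_pos (Nat.find hex) with h | h
    · rw [h, pow_zero] at h0
      have := congrFun (congrFun h0 ⟨0, hm⟩) ⟨0, hm⟩
      simp at this
    · have := Nat.find_min hex (m := Nat.find hex - 1) (by omega)
      apply this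
      rwa [Nat.sub_add_cancel h]
  generalize Nat.find hex = l at hl hl'
  obtain ⟨ι, π, e1, e2, e3⟩ := block_corner hl' hl
  have f1 : (d • 1 + N) * ι = ι * blk (l + 1) d := by
    rw [blk, Matrix.add_mul, Matrix.mul_add, e2]; simp
  have f2 : π * (d • 1 + N) = blk (l + 1) d * π := by
    rw [blk, Matrix.add_mul, Matrix.mul_add, e3]; simp
  have hle : l + 1 ≤ m := by
    have h3 := Matrix.rank_mul_le_left π ι
    rw [e1, Matrix.rank_one] at h3
    have h4 := Matrix.rank_le_width π
    simpa using h3.trans h4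
  rcases hle.lt_or_eq with h | h
  · by_cases hd : d = 0
    · subst hd
      refine split_Z hB hC hT h (Nat.succ_pos _) e1 hE f1 f2 (z := sgn _) (g := sgn _) ?_ (sgn_sq _)
      rw [blk, zero_smul, zero_add]
      exact sgn_shf _
    · obtain ⟨g, hg⟩ := blk_inv (l + 1) hd
      exact split_inv hB hC hT h (Nat.succ_pos _) e1 hE f1 f2 hg
  · subst h
    have h3 := hblk _ (baseK_conj hB e1) (cloK_conj hC e1) (π * A' * ι) (by
      have := eqK_conj e1 hE
      rwa [f2, Matrix.mul_assoc, e1, Matrix.mul_one] at this)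
    rw [← conjm_inv e1 A', h3, ← f1, Matrix.mul_assoc, mul_eq_one_comm.1 e1, Matrix.mul_one]


theorem mem_eig {m : ℕ} (hm : 2 ≤ m) (hT : ∀ j < m, TT j) {K : Set (Mat m)} (hB : BaseK K)
    (hC : CloK K) {A : Mat m} {x f : Fin m → ℂ} {t : ℂ} (ht : t ≠ 0) (hfx : f ⬝ᵥ x = 1)
    (h1 : A *ᵥ x = t • x) (h2 : f ᵥ* A = t • f) : A ∈ K := by
  apply hC
  intro A' hE
  refine split_inv hB hC hT (k := 1) (by omega) one_pos (ι := Matrix.of fun a _ => x a)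
    (π := Matrix.of fun _ a => f a) ?_ hE (a := t • 1) (g := t⁻¹ • 1) ?_ ?_ ?_
  · ext i j
    have : i = j := Subsingleton.elim _ _
    subst this
    simpa [Matrix.mul_apply, dotProduct] using hfx
  · ext a i
    have := congrFun h1 a
    have hi : i = 0 := Subsingleton.elim _ _
    subst hi
    simpa [Matrix.mul_apply, mulVec, dotProduct, mul_comm] using this
  · ext i a
    have := congrFun h2 a
    have hi : i = 0 := Subsingleton.elim _ _
    subst hi
    simpa [Matrix.mul_apply, vecMul, dotProduct] using this
  · simp [smul_smul, ht]

theorem mem_sq {m : ℕ} (hm : 2 ≤ m) (hT : ∀ j < m, TT j) {K : Set (Mat m)} (hB : BaseK K)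
    (hC : CloK K) {A : Mat m} {t : ℂ} (ht : t ≠ 0) (hA : A * A = (t * t) • 1) : A ∈ K := by
  by_cases h0 : A + t • 1 = 0
  · have hA' : A = (-t) • 1 := by rw [neg_smul]; exact eq_neg_of_add_eq_zero_left h0
    refine mem_eig hm hT hB hC (t := -t) (x := Pi.single ⟨0, by omega⟩ 1)
      (f := Pi.single ⟨0, by omega⟩ 1) (neg_ne_zero.2 ht) (by simp) ?_ ?_
    · rw [hA', smul_mulVec, one_mulVec]
    · rw [hA', vecMul_smul, vecMul_one]
  · obtain ⟨v, hv⟩ : ∃ v, (A + t • 1) *ᵥ v ≠ 0 := by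
      by_contra hcon
      push Not at hcon
      exact h0 (ext_mulVec (fun v => by rw [hcon, zero_mulVec]))
    obtain ⟨g, hg⟩ := exists_dual hv
    have e1 : A * (A + t • 1) = t • (A + t • 1) := by
      rw [mul_add, hA, smul_add, smul_smul]; simp [add_comm]
    have e2 : (A + t • 1) * A = t • (A + t • 1) := by
      rw [add_mul, hA, smul_add, smul_smul]; simp [add_comm]
    have e3 : (A + t • 1) * (A + t • 1) = (2 * t) • (A + t • 1) := by
      rw [mul_add, e2]; simp only [mul_smul, mul_one, Matrix.mul_smul, Matrix.mul_one]
      rw [two_smul]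
    refine mem_eig hm hT hB hC (t := t) (x := (A + t • 1) *ᵥ v)
      (f := (2 * t)⁻¹ • (g ᵥ* (A + t • 1))) ht ?_ ?_ ?_
    · rw [smul_dotProduct, ← dotProduct_mulVec, mulVec_mulVec, e3, smul_mulVec, dotProduct_smul, hg]
      simp
      field_simp
    · rw [mulVec_mulVec, e1, smul_mulVec]
    · rw [smul_vecMul, vecMul_vecMul, e2, vecMul_smul, smul_comm]

theorem zero_memK {m : ℕ} (hm : 0 < m) {K : Set (Mat m)} (hB : BaseK K) : (0 : Mat m) ∈ K := by
  have := hB (Pi.single ⟨0, hm⟩ 1) (Pi.single ⟨0, hm⟩ 1) (by simp) 0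
  simpa using this

theorem mem_nil {m : ℕ} (hm : 3 ≤ m) (hT : ∀ j < m, TT j) {K : Set (Mat m)} (hB : BaseK K)
    (hC : CloK K) {x f : Fin m → ℂ} (hfx : f ⬝ᵥ x = 0) : vecMulVec x f ∈ K := by
  by_cases hx : x = 0
  · rw [hx, zero_vecMulVec]; exact zero_memK (by omega) hB
  by_cases hf : f = 0
  · rw [hf, vecMulVec_zero]; exact zero_memK (by omega) hB
  obtain ⟨h0, hh0⟩ := exists_dual hx
  obtain ⟨y, hy⟩ := exists_dual hf
  rw [dotProduct_comm] at hy
  set h := h0 - (h0 ⬝ᵥ y) • f with hh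
  have hhx : h ⬝ᵥ x = 1 := by rw [hh, sub_dotProduct, smul_dotProduct, hfx, hh0]; simp
  have hhy : h ⬝ᵥ y = 0 := by rw [hh, sub_dotProduct, smul_dotProduct, hy]; simp
  have key : (Matrix.of ![h, f]) * (Matrix.of ![x, y])ᵀ = (1 : Mat 2) := by
    ext i j
    fin_cases i <;> fin_cases j <;> simp [Matrix.mul_apply] <;> 
      simpa [dotProduct] using (by assumption)
  have := corn hB hC (hT 2 (by omega)) key (Matrix.single 0 1 1)
  convert this using 1
  ext a b
  simp [Matrix.mul_apply, vecMulVec_apply, Fin.sum_univ_two, Matrix.single_apply]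

theorem nil_M {m : ℕ} (A : Mat m) {x f : Fin m → ℂ} (hfx : f ⬝ᵥ x = 0) :
    (A * vecMulVec x f + vecMulVec x f * A) * (A * vecMulVec x f + vecMulVec x f * A) =
     (f ⬝ᵥ (A *ᵥ x)) • (A * vecMulVec x f + vecMulVec x f * A) +
     (f ⬝ᵥ (A *ᵥ (A *ᵥ x))) • vecMulVec x f := by
  have e1 : vecMulVec x f * vecMulVec x f = 0 := by
    rw [vecMulVec_mul_vecMulVec, hfx]; simp
  have e2 := vmv_sandwich x f A
  have e3 := vmv_sandwich x f (A * A)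
  rw [← mulVec_mulVec] at e3
  generalize vecMulVec x f = X at *
  have : (A * X + X * A) * (A * X + X * A) = A * (X * A * X) + A * (X * X) * A + X * (A * A) * X
    + (X * A * X) * A := by noncomm_ring
  rw [this, e1, e2, e3]
  simp only [Matrix.mul_smul, Matrix.smul_mul, smul_add, mul_zero, zero_mul, add_zero]
  abel

theorem nil_test {m : ℕ} (hm : 3 ≤ m) (hT : ∀ j < m, TT j) {K : Set (Mat m)} (hB : BaseK K)
    (hC : CloK K) {A A' : Mat m} (hE : EqK K A A') {x f : Fin m → ℂ} (hfx : f ⬝ᵥ x = 0)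
    (h1 : f ⬝ᵥ (A *ᵥ x) = 2) (h2 : f ⬝ᵥ (A *ᵥ (A *ᵥ x)) = 0) : f ⬝ᵥ (A' *ᵥ x) = 2 := by
  have r1 : rel A (vecMulVec x f) := by
    unfold rel; rw [nil_M A hfx, h1, h2, zero_smul, add_zero]
  rw [hE _ (mem_nil hm hT hB hC hfx)] at r1
  have trM : ∀ (C : Mat m) (y : Fin m → ℂ), trace (C * vecMulVec y f + vecMulVec y f * C) =
      2 * (f ⬝ᵥ (C *ᵥ y)) := by
    intro C y
    rw [trace_add, trace_mul_comm _ C, mul_vecMulVec, trace_vecMulVec, dotProduct_comm]; ring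
  have disj : ∀ (C : Mat m) (y : Fin m → ℂ), f ⬝ᵥ y = 0 → rel C (vecMulVec y f) →
      f ⬝ᵥ (C *ᵥ y) = 0 ∨ f ⬝ᵥ (C *ᵥ y) = 2 := by
    intro C y hy hr
    unfold rel at hr
    rw [nil_M C hy] at hr
    have := congrArg trace hr
    rw [trace_add, trace_smul, trace_smul, trace_smul, trM, trace_vecMulVec, dotProduct_comm y, hy] at this
    simp only [smul_eq_mul] at this
    have h : (f ⬝ᵥ (C *ᵥ y)) * (f ⬝ᵥ (C *ᵥ y) - 2) = 0 := by linear_combination this / 2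
    rcases mul_eq_zero.1 h with h | h
    · left; exact h
    · right; linear_combination h
  rcases disj _ _ hfx r1 with h | h
  · exfalso
    unfold rel at r1
    have hM := nil_M A' hfx
    rw [r1, h, zero_smul, zero_add] at hM
    have e1 : vecMulVec x f * vecMulVec x f = 0 := by
      rw [vecMulVec_mul_vecMulVec, hfx]; simp
    generalize f ⬝ᵥ (A' *ᵥ (A' *ᵥ x)) = b at hM
    have h0 : A' * vecMulVec x f + vecMulVec x f * A' = 0 := by
      generalize A' * vecMulVec x f + vecMulVec x f * A' = M at *
      have h3 : M = (b / 2) • vecMulVec x f := by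
        rw [div_eq_inv_mul, mul_smul, ← hM, smul_smul]; norm_num
      have h4 : M * M = 0 := by
        rw [h3, smul_mul_smul_comm, e1, smul_zero]
      rw [r1] at h4
      simpa using h4
    have hfx2 : f ⬝ᵥ ((2⁻¹:ℂ) • x) = 0 := by rw [dotProduct_smul, hfx, smul_zero]
    have r2 : rel A' (vecMulVec ((2⁻¹:ℂ) • x) f) := by
      apply rel_of_anti
      rw [smul_vecMulVec, Matrix.mul_smul, Matrix.smul_mul, ← smul_add, h0, smul_zero]
    rw [← hE _ (mem_nil hm hT hB hC hfx2)] at r2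
    have := disj _ _ hfx2 r2
    rw [mulVec_smul, dotProduct_smul, h1] at this
    norm_num at this
  · exact h

theorem shf_apply {m : ℕ} (i j : Fin m) : shf m i j = if (i : ℕ) = j + 1 then 1 else 0 := rfl

theorem anti_test {m : ℕ} {K : Set (Mat m)} {A A' Z : Mat m} (hE : EqK K A A') (h1 : Z ∈ K)
    (h2 : -Z ∈ K) (h : A * Z + Z * A = 0) : A' * Z + Z * A' = 0 := by
  apply rel_neg
  · rw [← hE _ h1]; exact rel_of_anti h
  · rw [← hE _ h2]; apply rel_of_anti; rw [mul_neg, neg_mul, ← neg_add, h, neg_zero]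

theorem nilblk3 {m : ℕ} (hm : 3 ≤ m) (hT : ∀ j < m, TT j) {K : Set (Mat m)} (hB : BaseK K)
    (hC : CloK K) {B : Mat m} (hE : EqK K (shf m) B) : B = shf m := by
  have par : ∀ i j : Fin m, ((i : ℕ) + j) % 2 = 0 → B i j = 0 := by
    intro i j hij
    have := anti_test hE (Z := sgn m) (mem_sq (by omega) hT hB hC one_ne_zero (by rw [sgn_sq]; simp))
      (mem_sq (by omega) hT hB hC one_ne_zero (by rw [neg_mul_neg, sgn_sq]; simp)) (sgn_shf m)
    have := congrFun (congrFun this i) j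
    simp [sgn] at this
    have e : (-1 : ℂ) ^ (i : ℕ) = (-1) ^ (j : ℕ) := by
      rcases Nat.even_or_odd (i : ℕ) with h | h
      · have h' : Even (j : ℕ) := by rw [Nat.even_iff] at *; omega
        rw [h.neg_one_pow, h'.neg_one_pow]
      · have h' : Odd (j : ℕ) := by rw [Nat.odd_iff] at *; omega
        rw [h.neg_one_pow, h'.neg_one_pow]
    rw [e, mul_comm, ← two_mul] at this
    simpa using this
  have sub : ∀ i k : Fin m, (k : ℕ) = i + 1 → B k i = 1 := by
    intro i k hk
    have := nil_test hm hT hB hC hE (x := Pi.single i 1) (f := Pi.single k 2) (by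
      rw [single_dotProduct, Pi.single_eq_of_ne (by intro h; rw [h] at hk; omega), mul_zero])
      (by rw [mulVec_single_one, single_dotProduct]; simp [shf, hk]) (by
        rw [mulVec_single_one, single_dotProduct]
        simp only [mulVec, dotProduct, shf_apply, col_apply, mul_eq_zero]
        right
        apply Finset.sum_eq_zero
        intro l _
        split_ifs <;> first | omega | simp)
    rw [mulVec_single_one, single_dotProduct] at this
    simpa using this
  have cols : ∀ i j : Fin m, (i : ℕ) + 1 < m → B j i = shf m j i := by
    intro i j hi
    rw [shf_apply]
    split_ifs with h
    · exact sub i j h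
    · by_cases hp : (j : ℕ) = i ∨ (j : ℕ) = i + 2
      · apply par; omega
      · have hk := sub i ⟨i + 1, hi⟩ rfl
        have := nil_test hm hT hB hC hE (x := Pi.single i 1)
          (f := Pi.single ⟨i + 1, hi⟩ 2 + Pi.single j 1) (by
            rw [add_dotProduct, single_dotProduct, single_dotProduct, Pi.single_eq_of_ne (by
              simp [Fin.ext_iff]), Pi.single_eq_of_ne (by
              simp [Fin.ext_iff]; omega)]; simp)
          (by rw [mulVec_single_one, add_dotProduct, single_dotProduct, single_dotProduct]
              simp [shf_apply, h]) (by
            rw [mulVec_single_one, add_dotProduct, single_dotProduct, single_dotProduct]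
            simp only [mulVec, dotProduct, shf_apply, col_apply]
            rw [Finset.sum_eq_zero, Finset.sum_eq_zero]
            · simp
            · intro l _
              split_ifs <;> first | omega | simp
            · intro l _
              split_ifs <;> first | omega | simp)
        rw [mulVec_single_one, add_dotProduct, single_dotProduct, single_dotProduct] at this
        simp only [col_apply, hk] at this
        linear_combination this
  ext i j
  by_cases hj : (j : ℕ) + 1 < m
  · exact cols j i hj
  have hj2 := j.2
  have hi2 := i.2
  rw [shf_apply, if_neg (by omega)]
  by_cases hi : (i : ℕ) = j
  · apply par; omega
  by_cases hi0 : (i : ℕ) = 0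
  · have hij : i ≠ j := fun h => hi (by rw [h])
    have hfx : (Pi.single i 1 : Fin m → ℂ) ⬝ᵥ Pi.single j 1 = 0 := by
      rw [single_dotProduct, Pi.single_eq_of_ne hij, mul_zero]
    have hfx' : (Pi.single i 1 : Fin m → ℂ) ⬝ᵥ Pi.single j (-1) = 0 := by
      rw [single_dotProduct, Pi.single_eq_of_ne hij, mul_zero]
    have := anti_test hE (Z := vecMulVec (Pi.single j 1) (Pi.single i 1))
      (mem_nil hm hT hB hC hfx) (by
        have := mem_nil hm hT hB hC hfx'
        rwa [Pi.single_neg, neg_vecMulVec] at this) (by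
        rw [mul_vecMulVec, vecMulVec_mul, mulVec_single_one, single_one_vecMul]
        have e1 : (shf m).col j = 0 := by
          ext k; simp [shf_apply]; have := k.2; omega
        have e2 : (shf m).row i = 0 := by
          ext k; simp [shf_apply, hi0]
        rw [e1, e2]; simp)
    rw [mul_vecMulVec, vecMulVec_mul, mulVec_single_one, single_one_vecMul] at this
    have := congrFun (congrFun this j) j
    simpa [vecMulVec_apply, Pi.single_eq_of_ne hij.symm] using this
  · have hk := sub ⟨i - 1, by omega⟩ i (by simp; omega)
    have := nil_test hm hT hB hC hE (f := Pi.single i 1)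
          (x := Pi.single ⟨i - 1, by omega⟩ 2 + Pi.single j 1) (by
            rw [dotProduct_add, single_dotProduct, single_dotProduct, Pi.single_eq_of_ne (by
              simp [Fin.ext_iff]; omega), Pi.single_eq_of_ne (by
              simp [Fin.ext_iff]; omega)]; simp)
          (by rw [mulVec_add, mulVec_single_one, dotProduct_add, single_dotProduct, single_dotProduct]
              simp [shf_apply]
              rw [if_pos (by omega), if_neg (by omega)]; simp) (by
            rw [single_dotProduct, one_mul]
            simp only [mulVec, dotProduct]
            apply Finset.sum_eq_zero
            intro k _
            rw [shf_apply]
            split_ifs with h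
            · rw [one_mul]
              apply Finset.sum_eq_zero
              intro l _
              rw [shf_apply]
              split_ifs with h'
              · rw [one_mul, Pi.add_apply, Pi.single_eq_of_ne (by
                  simp [Fin.ext_iff]; omega), Pi.single_eq_of_ne (by
                  simp [Fin.ext_iff]; omega)]; simp
              · simp
            · simp)
    rw [mulVec_add, mulVec_single_one, dotProduct_add, single_dotProduct, single_dotProduct] at this
    simp [mulVec_single, hk] at this
    exact this


theorem vmv_smul {m k : ℕ} (x : Fin m → ℂ) (c : ℂ) (y : Fin k → ℂ) :
    vecMulVec x (c • y) = c • vecMulVec x y := by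
  ext i j; simp [vecMulVec_apply]; ring

theorem nilblk2 (hT : ∀ j < 2, TT j) {K : Set (Mat 2)} (hB : BaseK K)
    (hC : CloK K) {B : Mat 2} (hE : EqK K (shf 2) B) : B = shf 2 := by
  have hs : shf 2 = !![0, 0; 1, 0] := by
    ext i j; fin_cases i <;> fin_cases j <;> simp [shf]
  have h0 := anti_test hE (Z := sgn 2) (mem_sq (by omega) hT hB hC one_ne_zero (by rw [sgn_sq]; simp))
      (mem_sq (by omega) hT hB hC one_ne_zero (by rw [neg_mul_neg, sgn_sq]; simp)) (sgn_shf 2)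
  have hb0 : B 0 0 = 0 := by
    have := congrFun (congrFun h0 0) 0
    simp [sgn, ← two_mul] at this
    exact this
  have hb1 : B 1 1 = 0 := by
    have := congrFun (congrFun h0 1) 1
    simp [sgn] at this
    exact this
  obtain ⟨p, hp⟩ : ∃ p, p = B 0 1 := ⟨_, rfl⟩
  obtain ⟨q, hq⟩ : ∃ q, q = B 1 0 := ⟨_, rfl⟩
  have hBe : B = !![0, p; q, 0] := by
    rw [Matrix.eta_fin_two B, hb0, hb1, hp, hq]
  have calcR : ∀ p q v s : ℂ, rel (!![0, p; q, 0] : Mat 2) !![0, 2 * s; v * s, 0] ↔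
      (p * v + 2 * q) * s = 0 ∨ (p * v + 2 * q) * s = 2 := by
    intro p q v s
    unfold rel
    have : (!![0, p; q, 0] : Mat 2) * !![0, 2 * s; v * s, 0] + !![0, 2 * s; v * s, 0] * !![0, p; q, 0]
       = ((p * v + 2 * q) * s) • 1 := by
      ext i j; fin_cases i <;> fin_cases j <;> simp [Matrix.mul_apply, Fin.sum_univ_two] <;> ring
    rw [this]
    generalize (p * v + 2 * q) * s = t
    constructor
    · intro h
      have := congrFun (congrFun h 0) 0
      simp at this
      exact this.symm
    · rintro (h | h) <;> rw [h] <;> simp 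
  have mem : ∀ v s : ℂ, v ≠ 0 → s ≠ 0 → (!![0, 2 * s; v * s, 0] : Mat 2) ∈ K := by
    intro v s hv hs
    obtain ⟨t, ht⟩ := IsAlgClosed.exists_pow_nat_eq (2 * s * (v * s)) (n := 2) (by norm_num)
    have ht0 : t ≠ 0 := by
      rintro rfl
      have : 2 * s * (v * s) ≠ 0 := mul_ne_zero (mul_ne_zero two_ne_zero hs) (mul_ne_zero hv hs)
      apply this; rw [← ht]; simp
    apply mem_sq (by omega) hT hB hC ht0
    rw [show t * t = 2 * s * (v * s) by rw [← pow_two, ht]]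
    ext i j; fin_cases i <;> fin_cases j <;> simp [Matrix.mul_apply, Fin.sum_univ_two]; ring
  have key : ∀ v s : ℂ, v ≠ 0 → s ≠ 0 → ((s = 1) ↔ (p * v + 2 * q) * s = 0 ∨ (p * v + 2 * q) * s = 2) := by
    intro v s hv hs'
    have := hE _ (mem v s hv hs')
    rw [hs, hBe, calcR, calcR] at this
    rw [← this]
    simp [hs']
  have k1 := (key 1 1 one_ne_zero one_ne_zero).1 rfl
  have k2 := (key 2 1 two_ne_zero one_ne_zero).1 rfl
  have k3 := (key 3 1 three_ne_zero one_ne_zero).1 rfl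
  have k4 := key 1 2 one_ne_zero two_ne_zero
  have hp0 : p = 0 := by
    rcases k1 with k1 | k1 <;> rcases k2 with k2 | k2 <;> rcases k3 with k3 | k3 <;>
    first
    | linear_combination k2 - k1
    | linear_combination k3 - k2
    | linear_combination (k3 - k1) / 2
    | (exfalso; have : (2:ℂ) = 0 := by linear_combination k1 + k3 - 2 * k2
       norm_num at this)
    | (exfalso; have : (2:ℂ) = 0 := by linear_combination -(k1 + k3 - 2 * k2)
       norm_num at this)
  subst hp0
  have hq1 : q = 1 := by
    rcases k1 with k1 | k1
    · have : q = 0 := by linear_combination k1 / 2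
      subst this
      simp at k4
    · linear_combination k1 / 2
  rw [hBe, hs, hq1]

theorem shf_pow {m : ℕ} (r : ℕ) (i j : Fin m) (h : (i : ℕ) < j + r) : (shf m ^ r) i j = 0 := by
  induction r generalizing i with
  | zero =>
    rw [pow_zero, Matrix.one_apply_ne]; intro h'; rw [h'] at h; omega
  | succ r ih =>
    rw [pow_succ', Matrix.mul_apply]
    apply Finset.sum_eq_zero
    intro k _
    rw [shf_apply]
    split_ifs with h'
    · rw [ih k (by omega), mul_zero]
    · rw [zero_mul]

theorem shf_nil (m : ℕ) : shf m ^ m = 0 := by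
  ext i j; exact shf_pow m i j (by have := i.2; omega)

theorem sylv {m : ℕ} {d : ℂ} (hd : d ≠ 0) {D : Mat m} (h : blk m d * D + D * blk m d = 0) : D = 0 := by
  have h1 : shf m * D = D * (- blk m (2 * d)) := by
    have e : blk m (2 * d) = d • 1 + blk m d := by
      rw [blk, blk, ← add_assoc, ← add_smul, two_mul]
    have e2 : shf m = blk m d - d • 1 := by rw [blk]; simp
    rw [e, e2, sub_mul, mul_neg, mul_add, eq_neg_of_add_eq_zero_left h]
    simp [sub_eq_add_neg, add_comm]
  have h2 : ∀ r, shf m ^ r * D = D * (- blk m (2 * d)) ^ r := by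
    intro r
    induction r with
    | zero => simp
    | succ r ih => rw [pow_succ, mul_assoc, h1, ← mul_assoc, ih, mul_assoc, ← pow_succ]
  have h3 := h2 m
  rw [shf_nil, zero_mul] at h3
  obtain ⟨g, hg⟩ := blk_inv m (d := 2 * d) (by simpa using hd)
  have h4 : (- blk m (2 * d)) * (-g) = 1 := by rw [neg_mul_neg]; exact mul_eq_one_comm.1 hg
  have h5 : ∀ r, (- blk m (2 * d)) ^ r * (-g) ^ r = 1 := by
    intro r
    induction r with
    | zero => simp
    | succ r ih => rw [pow_succ, pow_succ', mul_assoc, ← mul_assoc _ (-g), h4, one_mul, ih]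
  calc D = D * ((- blk m (2 * d)) ^ m * (-g) ^ m) := by rw [h5, mul_one]
    _ = 0 := by rw [← mul_assoc, ← h3, zero_mul]

def incl (m k : ℕ) : Matrix (Fin m) (Fin (m - k)) ℂ :=
  Matrix.of fun a i => if (a : ℕ) = i + k then 1 else 0

theorem mul_incl {m k : ℕ} {p : Type*} (A : Matrix p (Fin m) ℂ) (a : p) (i : Fin (m - k)) :
    (A * incl m k) a i = A a ⟨i + k, by omega⟩ := by
  rw [Matrix.mul_apply, Finset.sum_eq_single ⟨i + k, by omega⟩]
  · simp [incl]
  · intro b _ hb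
    have : ¬ (b : ℕ) = i + k := fun h => hb (Fin.ext h)
    simp [incl, this]
  · simp

theorem inclT_mul {m k : ℕ} {p : Type*} (A : Matrix (Fin m) p ℂ) (a : p) (i : Fin (m - k)) :
    ((incl m k)ᵀ * A) i a = A ⟨i + k, by omega⟩ a := by
  rw [← Matrix.transpose_apply ((incl m k)ᵀ * A), transpose_mul, transpose_transpose, mul_incl]
  rfl

theorem incl_inv (m k : ℕ) : (incl m k)ᵀ * incl m k = 1 := by
  ext i j
  rw [inclT_mul]
  simp [incl, Matrix.one_apply, Fin.ext_iff]

theorem incl_mul_zero {m k : ℕ} {p : Type*} (A : Matrix (Fin (m - k)) p ℂ) (a : Fin m) (b : p) (h : (a : ℕ) < k) :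
    (incl m k * A) a b = 0 := by
  rw [Matrix.mul_apply]
  apply Finset.sum_eq_zero
  intro i _
  have : ¬ (a : ℕ) = i + k := by omega
  simp [incl, this]

theorem blk_apply {m : ℕ} (d : ℂ) (i j : Fin m) : blk m d i j = if i = j then d else if (i : ℕ) = j + 1 then 1 else 0 := by
  rw [blk, Matrix.add_apply, shf_apply, Matrix.smul_apply, Matrix.one_apply]
  split_ifs with h h'
  · subst h; omega
  · simp
  · simp
  · simp

theorem blk_incl (m k : ℕ) (d : ℂ) : blk m d * incl m k = incl m k * blk (m - k) d := by
  ext a i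
  rw [mul_incl]
  by_cases h : (a : ℕ) < k
  · rw [incl_mul_zero _ _ _ h, blk_apply, if_neg, if_neg]
    · simp; omega
    · intro h'; rw [h'] at h; simp at h
  · have h2 := a.2
    have := inclT_mul (k := k) (incl m k * blk (m - k) d) i ⟨a - k, by omega⟩
    rw [← Matrix.mul_assoc, incl_inv, Matrix.one_mul] at this
    have e : (⟨(a : ℕ) - k + k, by omega⟩ : Fin m) = a := Fin.ext (by simp; omega)
    simp only [e] at this
    rw [← this, blk_apply, blk_apply]
    simp only [Fin.ext_iff]
    congr 1
    · rw [eq_iff_iff]; omega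
    · congr 1; rw [eq_iff_iff]; omega

theorem EqK.symm {m : ℕ} {K : Set (Mat m)} {A A' : Mat m} (h : EqK K A A') : EqK K A' A :=
  fun B hB => (h B hB).symm

theorem det_of_low {m : ℕ} {A : Mat m} {d : ℂ} (h1 : ∀ i j : Fin m, i < j → A i j = 0)
    (h2 : ∀ i, A i i = d) : A.det = d ^ m := by
  rw [Matrix.det_of_isLowerTriangular]
  · simp [h2]
  · intro i j hij; exact h1 i j hij

theorem cols_eq {m : ℕ} (hm : 2 ≤ m) (hT : ∀ j < m, TT j)
    (hnil : ∀ K : Set (Mat m), BaseK K → CloK K → ∀ A', EqK K (blk m 0) A' → A' = blk m 0)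
    {d : ℂ} (hd : d ≠ 0) {K : Set (Mat m)} (hB : BaseK K) (hC : CloK K) {A' : Mat m}
    (hE : EqK K (blk m d) A') : ∀ i j : Fin m, 0 < (j : ℕ) → A' i j = blk m d i j := by
  rcases reduce (by omega) hB hC hT hE.symm with h | ⟨d', N', hA', hN'⟩
  · intro i j _; rw [h]
  by_cases hd' : d' = 0
  · subst hd'
    have := det_blk (by omega) hT 0 hnil hB hC hN' (A' := blk m d) (by rw [← hA']; exact hE.symm)
    intro i j _; rw [this, ← hA']
  have hlow : ∀ i j : Fin m, i < j → A' i j = 0 := by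
    intro i j hij
    have hj := j.2
    have hij' : (i : ℕ) < j := hij
    obtain ⟨g, hg⟩ := blk_inv (m - j) hd
    have := half1 hB hC (hT (m - j) (by omega)) (incl_inv m j) hE (blk_incl m j d) hg
    have := congrFun (congrFun this i) ⟨0, by omega⟩
    rw [mul_incl, incl_mul_zero _ _ _ hij'] at this
    simpa using this
  have hdiag : ∀ i, A' i i = d' := by
    intro i
    by_contra hne
    have hs : A' i i - d' ≠ 0 := sub_ne_zero.2 hne
    have h1 : (A' - (A' i i) • 1).det = 0 := by
      rw [Matrix.det_of_isLowerTriangular]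
      · apply Finset.prod_eq_zero (Finset.mem_univ i); simp
      · intro a b hab
        have hab : a < b := hab
        simp [hlow a b hab, hab.ne]
    have h2 : IsUnit (N' + (-(A' i i - d')) • (1 : Mat m)) := by
      have hu : IsUnit ((-(A' i i - d')) • (1 : Mat m)) := by
        rw [isUnit_iff_isUnit_det, det_smul, det_one, mul_one]
        exact (isUnit_iff_ne_zero.2 (neg_ne_zero.2 hs)).pow _
      apply IsNilpotent.isUnit_add_right_of_commute hN' hu
      simp [Commute, SemiconjBy]
    rw [isUnit_iff_isUnit_det] at h2
    apply h2.ne_zero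
    rw [← h1]
    congr 1
    have hN2 : N' = A' - d' • 1 := eq_sub_of_add_eq' hA'.symm
    rw [hN2, neg_smul, sub_smul]; abel
  have hlast : d' = d := by
    set e : Fin m := ⟨m - 1, by omega⟩ with he
    have hP : (Pi.single e 1 : Fin m → ℂ) ⬝ᵥ Pi.single e 1 = 1 := by simp
    have hmem := hB _ _ hP d⁻¹
    have gen : ∀ (C : Mat m) (t : ℂ), (∀ i, i < e → C i e = 0) → C e e = t → 
       C * (d⁻¹ • vecMulVec (Pi.single e 1) (Pi.single e 1)) + (d⁻¹ • vecMulVec (Pi.single e 1) (Pi.single e 1)) * C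
        = vecMulVec (Pi.single e 1) (d⁻¹ • (t • Pi.single e 1 + C.row e)) := by
      intro C t h1 h2
      have h3 : C.col e = t • Pi.single e 1 := by
        ext i
        by_cases h : i = e
        · subst h; simp [h2]
        · rw [col_apply, h1]
          · simp [h]
          · have hi := i.2
            have : (i : ℕ) ≠ m - 1 := fun h' => h (Fin.ext h')
            rw [Fin.lt_def]; simp [he]; omega
      rw [Matrix.mul_smul, Matrix.smul_mul, mul_vecMulVec, vecMulVec_mul, mulVec_single_one,
        single_one_vecMul, h3]
      ext i j
      simp [vecMulVec_apply]
      ring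
    have r : rel A' (d⁻¹ • vecMulVec (Pi.single e 1) (Pi.single e 1)) := by
      rw [← hE _ hmem]
      unfold rel
      rw [gen (blk m d) d, vecMulVec_mul_vecMulVec, vmv_smul]
      · congr 1
        rw [smul_dotProduct, add_dotProduct, smul_dotProduct, hP, dotProduct_single]
        simp [blk_apply]
        field_simp; norm_num
      · intro i hi
        rw [blk_apply, if_neg hi.ne, if_neg]
        have : (i : ℕ) < e := hi
        omega
      · simp [blk_apply]
    unfold rel at r
    rw [gen A' d' (fun i hi => hlow i e hi) (hdiag e), vecMulVec_mul_vecMulVec] at r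
    have := congrFun (congrFun r e) e
    simp [vecMulVec_apply, hdiag e] at this
    field_simp at this
    linear_combination this / 2
  rw [hlast] at hdiag
  obtain ⟨g, hg⟩ := blk_inv (m - 1) hd
  have hg' := mul_eq_one_comm.1 hg
  have hT1 := hT (m - 1) (by omega)
  have hι := incl_inv m 1
  have hA1 := blk_incl m 1 d
  have hA2 := half1 hB hC hT1 hι hE hA1 hg
  set ι := incl m 1
  set π := ιᵀ with hπ
  set a' := π * A' * ι with ha'
  set a := blk (m - 1) d with ha
  have hmem := corn hB hC hT1 hι g
  have gen : ∀ (C : Mat m) (b : Mat (m - 1)), C * ι = ι * b → 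
      C * (ι * g * π) + (ι * g * π) * C = ι * (b * g * π + g * π * C) ∧
      (b * g * π + g * π * C) * ι = b * g + g * b := by
    intro C b hCb
    constructor
    · calc _ = (C * ι) * g * π + ι * g * π * C := by simp only [Matrix.mul_assoc]
        _ = _ := by rw [hCb]; simp only [Matrix.mul_assoc, Matrix.mul_add]
    · calc _ = b * g * (π * ι) + g * π * (C * ι) := by simp only [Matrix.mul_assoc, Matrix.add_mul]
        _ = b * g * (π * ι) + g * (π * ι) * b := by rw [hCb]; simp only [Matrix.mul_assoc]
        _ = _ := by rw [hι]; simp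
  have r : rel A' (ι * g * π) := by
    rw [← hE _ hmem]
    unfold rel
    obtain ⟨e1, e2⟩ := gen _ _ hA1
    rw [e1, Matrix.mul_assoc, ← Matrix.mul_assoc _ ι, e2, hg, hg', ← two_smul ℂ, Matrix.smul_mul,
      Matrix.one_mul, Matrix.mul_smul]
  unfold rel at r
  obtain ⟨e1, e2⟩ := gen _ _ hA2
  rw [e1] at r
  have r2 : (a' * g + g * a') * (a' * g + g * a') = (2:ℂ) • (a' * g + g * a') := by
    have := congrArg (fun Z => π * Z * ι) r
    rw [← e2]
    generalize a' * g * π + g * π * A' = τ at *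
    calc τ * ι * (τ * ι) = (π * ι) * τ * ι * (τ * ι) := by rw [hι, Matrix.one_mul]
      _ = π * (ι * τ * (ι * τ)) * ι := by simp only [Matrix.mul_assoc]
      _ = π * ((2:ℂ) • (ι * τ)) * ι := this
      _ = (2:ℂ) • ((π * ι) * τ * ι) := by
        rw [Matrix.mul_smul, Matrix.smul_mul]; simp only [Matrix.mul_assoc]
      _ = _ := by rw [hι, Matrix.one_mul]
  have hlow' : ∀ i j : Fin (m - 1), i < j → a' i j = 0 := by
    intro i j hij
    rw [ha', mul_incl, hπ, inclT_mul]
    apply hlow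
    rw [Fin.lt_def] at *
    simpa using hij
  have hdiag' : ∀ i, a' i i = d := by
    intro i
    rw [ha', mul_incl, hπ, inclT_mul, hdiag]
  have hglow : g.IsLowerTriangular := by
    have h1 : a.IsLowerTriangular := by
      intro i j hij
      have hij : i < j := hij
      have : (i : ℕ) < j := hij
      rw [ha, blk_apply, if_neg hij.ne, if_neg (by omega)]
    have h3 : g = a⁻¹ := by
      rw [eq_comm]; exact Matrix.inv_eq_left_inv hg
    rw [h3]
    haveI : Invertible a := invertibleOfLeftInverse a g hg
    exact Matrix.blockTriangular_inv_of_blockTriangular h1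
  have hU : IsUnit (a' * g + g * a') := by
    have h1 : ∀ i j : Fin (m - 1), i < j → g i j = 0 := fun i j hij => hglow hij
    have hgd : ∀ i, g i i = d⁻¹ := by
      intro i
      have h2 := congrFun (congrFun hg i) i
      rw [Matrix.mul_apply, Finset.sum_eq_single i] at h2
      · rw [ha, blk_apply, if_pos rfl, Matrix.one_apply_eq] at h2
        exact eq_inv_of_mul_eq_one_left h2
      · intro b _ hb
        rcases lt_or_gt_of_ne hb with h | h
        · rw [ha, blk_apply, if_neg hb, if_neg, mul_zero]
          have : (b : ℕ) < i := h
          omega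
        · rw [h1 i b h, zero_mul]
      · simp
    have lowmul : ∀ X Y : Mat (m - 1), (∀ i j, i < j → X i j = 0) → (∀ i j, i < j → Y i j = 0) →
       (∀ i j, i < j → (X * Y) i j = 0) ∧ (∀ i, (X * Y) i i = X i i * Y i i) := by
      intro X Y hX hY
      constructor
      · intro i j hij
        rw [Matrix.mul_apply]
        apply Finset.sum_eq_zero
        intro k _
        by_cases h : i < k
        · rw [hX i k h, zero_mul]
        · rw [hY k j (lt_of_le_of_lt (not_lt.1 h) hij), mul_zero]
      · intro i
        rw [Matrix.mul_apply, Finset.sum_eq_single i]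
        · intro k _ hk
          rcases lt_or_gt_of_ne hk with h | h
          · rw [hY k i h, mul_zero]
          · rw [hX i k h, zero_mul]
        · simp
    obtain ⟨l1, l2⟩ := lowmul a' g hlow' h1
    obtain ⟨l3, l4⟩ := lowmul g a' h1 hlow'
    rw [isUnit_iff_isUnit_det, det_of_low (d := 2)]
    · exact (isUnit_iff_ne_zero.2 two_ne_zero).pow _
    · intro i j hij; rw [Matrix.add_apply, l1 i j hij, l3 i j hij, add_zero]
    · intro i; rw [Matrix.add_apply, l2, l4, hdiag', hgd]; field_simp; norm_num
  have r3 : a' * g + g * a' = (2:ℂ) • 1 := by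
    have : (a' * g + g * a') * (a' * g + g * a') = (a' * g + g * a') * ((2:ℂ) • 1) := by
      rw [r2]; simp
    exact hU.mul_left_cancel this
  have r4 : a * a' + a' * a = (2:ℂ) • (a * a) := by
    have := congrArg (fun Z => a * Z * a) r3
    simp only [mul_add, add_mul, Matrix.mul_smul, Matrix.smul_mul, Matrix.mul_one] at this
    have f1 : a * (a' * g) * a = a * a' := by
      rw [mul_assoc, mul_assoc, hg, mul_one]
    have f2 : a * (g * a') * a = a' * a := by
      rw [← mul_assoc, hg', one_mul]
    rwa [f1, f2] at this
  have hD : a' - a = 0 := by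
    apply sylv hd
    rw [← ha, mul_sub, sub_mul]
    have : a * a' - a * a + (a' * a - a * a) = (a * a' + a' * a) - (2:ℂ) • (a * a) := by
      rw [two_smul]; abel
    rw [this, r4, sub_self]
  intro i j hj
  have h3 : A' * ι = blk m d * ι := by rw [hA2, hA1, sub_eq_zero.1 hD]
  have := congrFun (congrFun h3 i) ⟨j - 1, by omega⟩
  rw [mul_incl, mul_incl] at this
  have e : (⟨(j : ℕ) - 1 + 1, by omega⟩ : Fin m) = j := Fin.ext (by simp; omega)
  simpa only [e] using this


def revM (m : ℕ) : Mat m := Matrix.of fun i j => if j = Fin.rev i then 1 else 0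

theorem revM_mul {m : ℕ} (A : Mat m) (i j : Fin m) : (revM m * A) i j = A (Fin.rev i) j := by
  simp [revM, Matrix.mul_apply]

theorem mul_revM {m : ℕ} (A : Mat m) (i j : Fin m) : (A * revM m) i j = A i (Fin.rev j) := by
  rw [Matrix.mul_apply, Finset.sum_eq_single (Fin.rev j)]
  · simp [revM]
  · intro b _ hb
    have : ¬ j = Fin.rev b := by
      rintro rfl; simp at hb
    simp [revM, this]
  · simp

theorem revM_sq (m : ℕ) : revM m * revM m = 1 := by
  ext i j
  rw [revM_mul]
  simp [revM, Matrix.one_apply, eq_comm]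

theorem rev_blk (m : ℕ) (d : ℂ) : revM m * (blk m d)ᵀ * revM m = blk m d := by
  ext i j
  rw [mul_revM, revM_mul, transpose_apply, blk_apply, blk_apply]
  congr 1
  · rw [eq_iff_iff, Fin.rev_inj, eq_comm]
  · congr 1
    rw [eq_iff_iff, Fin.val_rev, Fin.val_rev]; omega

theorem blkd {m : ℕ} (hm : 2 ≤ m) (hT : ∀ j < m, TT j)
    (hnil : ∀ K : Set (Mat m), BaseK K → CloK K → ∀ A', EqK K (blk m 0) A' → A' = blk m 0)
    {d : ℂ} (hd : d ≠ 0) {K : Set (Mat m)} (hB : BaseK K) (hC : CloK K) {A' : Mat m}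
    (hE : EqK K (blk m d) A') : A' = blk m d := by
  have hcols := cols_eq hm hT hnil hd hB hC hE
  have hrows : ∀ i j : Fin m, (i : ℕ) + 1 < m → A' i j = blk m d i j := by
    have h1 := eqK_conj (revM_sq m) (eqK_tr hE)
    rw [rev_blk] at h1
    have := cols_eq hm hT hnil hd (baseK_conj (baseK_tr hB) (revM_sq m))
      (cloK_conj (cloK_tr hC) (revM_sq m)) h1
    intro i j hi
    have h2 := this (Fin.rev j) (Fin.rev i) (by rw [Fin.val_rev]; omega)
    rw [← rev_blk, mul_revM, revM_mul, mul_revM, revM_mul] at h2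
    simpa using h2
  by_cases h2 : m = 2
  · subst h2
    obtain ⟨p, hp⟩ : ∃ p, p = A' 1 0 := ⟨_, rfl⟩
    have hA : blk 2 d = !![d, 0; 1, d] := by
      ext i j; fin_cases i <;> fin_cases j <;> simp [blk_apply]
    have hA' : A' = !![d, 0; p, d] := by
      rw [Matrix.eta_fin_two A', hrows 0 0 (by simp), hrows 0 1 (by simp), hcols 1 1 (by simp), hp]
      simp [blk_apply]
    obtain ⟨u, hu⟩ : ∃ u, u = (2 * d)⁻¹ := ⟨_, rfl⟩
    have hud : u * d = 1 / 2 := by rw [hu]; field_simp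
    have hmem : (!![-u, 1; 0, u] : Mat 2) ∈ K := by
      apply mem_sq hm hT hB hC (t := u)
      · intro h; rw [h] at hud; norm_num at hud
      · ext i j; fin_cases i <;> fin_cases j <;> simp [Matrix.mul_apply, Fin.sum_univ_two]
    have e : ∀ p, (!![d, 0; p, d] : Mat 2) * !![-u, 1; 0, u] + !![-u, 1; 0, u] * !![d, 0; p, d] =
        !![-1 + p, 2 * d; 0, 1 + p] := by
      intro p
      ext i j; fin_cases i <;> fin_cases j <;> simp <;> linear_combination (norm := ring_nf) (0 : ℂ)
      · linear_combination -2 * hud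
      · linear_combination 2 * hud
    have r : rel A' !![-u, 1; 0, u] := by
      rw [← hE _ hmem, hA]
      unfold rel
      rw [e]
      ext i j; fin_cases i <;> fin_cases j <;> simp [Matrix.mul_apply, Fin.sum_univ_two] <;> ring
    unfold rel at r
    rw [hA', e] at r
    have := congrFun (congrFun r 0) 1
    simp [Matrix.mul_apply, Fin.sum_univ_two] at this
    have hp1 : p = 1 := by
      have : (4 * d) * (p - 1) = 0 := by linear_combination this
      rcases mul_eq_zero.1 this with h | h
      · simp [hd] at h
      · linear_combination h
    rw [hA', hA, hp1]
  · have hm3 : 3 ≤ m := by omega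
    set l : Fin m := ⟨m - 1, by omega⟩ with hl
    set z : Fin m := ⟨0, by omega⟩ with hz
    set o : Fin m := ⟨1, by omega⟩ with ho
    set w : Fin m := ⟨2, by omega⟩ with hw
    obtain ⟨s, hs⟩ : ∃ s, s = A' l z := ⟨_, rfl⟩
    have hx0 : blk m d *ᵥ Pi.single z 1 = d • Pi.single z 1 + Pi.single o 1 := by
      rw [mulVec_single_one]; ext i
      rw [col_apply, blk_apply]
      simp only [Pi.add_apply, Pi.smul_apply, Pi.single_apply, hz, ho, Fin.ext_iff]
      split_ifs <;> first | omega | simp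
    have hx1 : blk m d *ᵥ Pi.single o 1 = d • Pi.single o 1 + Pi.single w 1 := by
      rw [mulVec_single_one]; ext i
      rw [col_apply, blk_apply]
      simp only [Pi.add_apply, Pi.smul_apply, Pi.single_apply, ho, hw, Fin.ext_iff]
      split_ifs <;> first | omega | simp
    have hx' : A' *ᵥ Pi.single z 1 = d • Pi.single z 1 + Pi.single o 1 + s • Pi.single l 1 := by
      rw [mulVec_single_one]; ext i
      rw [col_apply]
      by_cases hi : (i : ℕ) + 1 < m
      · rw [hrows i z hi, blk_apply]
        simp only [Pi.add_apply, Pi.smul_apply, Pi.single_apply, hl, hz, ho, Fin.ext_iff]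
        split_ifs <;> first | omega | simp
      · have : i = l := Fin.ext (by simp [hl]; have := i.2; omega)
        rw [this, ← hs]
        simp only [Pi.add_apply, Pi.smul_apply, Pi.single_apply, hl, hz, ho, Fin.ext_iff]
        split_ifs <;> first | omega | simp
    obtain ⟨f, f0, f1, f2, f3⟩ : ∃ f : Fin m → ℂ, f z = 0 ∧ f o = 2 ∧ f w = -4 * d ∧ f l ≠ 0 := by
      refine ⟨fun i => if (i : ℕ) = 0 then 0 else if (i : ℕ) = 1 then 2 else if (i : ℕ) = 2 then -4 * d else 1, ?_, ?_, ?_, ?_⟩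
      · simp [hz]
      · simp [ho]
      · simp [hw]
      · simp only [hl]
        split_ifs <;> first | omega | simp [hd]
    have := nil_test hm3 hT hB hC hE (x := Pi.single z 1) (f := f) (by simp [f0])
      (by rw [hx0]; simp [dotProduct_add, f0, f1])
      (by rw [hx0, mulVec_add, mulVec_smul, hx0, hx1]; simp [dotProduct_add, f0, f1, f2]; ring)
    rw [hx'] at this
    simp [dotProduct_add, f0, f1, f3] at this
    ext i j
    by_cases hi : (i : ℕ) + 1 < m
    · exact hrows i j hi
    by_cases hj : 0 < (j : ℕ)
    · exact hcols i j hj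
    have hi' : i = l := Fin.ext (by simp [hl]; have := i.2; omega)
    have hj' : j = z := Fin.ext (by simp [hz]; omega)
    rw [hi', hj', ← hs, this, blk_apply, if_neg, if_neg]
    · simp [hl, hz]; omega
    · simp [hl, hz]; omega

theorem TT_all (m : ℕ) : TT m := by
  induction m using Nat.strong_induction_on with
  | _ m hT =>
    intro K hB hC A
    rcases Nat.lt_or_ge m 2 with hm | hm
    · rcases Nat.lt_or_ge m 1 with hm0 | hm0
      · have : m = 0 := by omega
        subst this
        apply hC
        intro A' _
        exact Subsingleton.elim _ _
      · have : m = 1 := by omega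
        subst this
        have := hB (fun _ => 1) (fun _ => 1) (by simp [dotProduct]) (A 0 0)
        convert this using 1
        ext i j
        rw [Subsingleton.elim i 0, Subsingleton.elim j 0]
        simp [vecMulVec_apply]
    · have hnil : ∀ K : Set (Mat m), BaseK K → CloK K → ∀ A', EqK K (blk m 0) A' → A' = blk m 0 := by
        intro K hB hC A' hE
        have e : blk m 0 = shf m := by simp [blk]
        rw [e] at hE ⊢
        by_cases h2 : m = 2
        · subst h2; exact nilblk2 hT hB hC hE
        · exact nilblk3 (by omega) hT hB hC hE
      have hall : ∀ (d : ℂ) (K : Set (Mat m)), BaseK K → CloK K → ∀ A', EqK K (blk m d) A' → A' = blk m d := by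
        intro d K hB hC A' hE
        by_cases hd : d = 0
        · subst hd; exact hnil K hB hC A' hE
        · exact blkd hm hT hnil hd hB hC hE
      apply hC
      intro A' hE
      rcases reduce (by omega) hB hC hT hE with h | ⟨d, N, hA, hN⟩
      · exact h
      · rw [hA] at hE ⊢
        exact det_blk (by omega) hT d (hall d) hB hC hN hE


theorem rel_one_left {m : ℕ} {Y : Mat m} : rel 1 Y ↔ Y * Y = Y := by
  unfold rel
  have e : (1 * Y + Y * 1) * (1 * Y + Y * 1) = (4:ℂ) • (Y * Y) := by
    rw [Matrix.one_mul, Matrix.mul_one, ← two_smul ℂ, smul_mul_smul_comm]; norm_num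
  have e2 : (2:ℂ) • (1 * Y + Y * 1) = (4:ℂ) • Y := by
    rw [Matrix.one_mul, Matrix.mul_one, ← two_smul ℂ, smul_smul]; norm_num
  rw [e, e2]
  exact smul_right_inj (by norm_num)

theorem rel_neg_neg {m : ℕ} {A B : Mat m} : rel (-A) (-B) ↔ rel A B := by
  unfold rel; rw [neg_mul_neg, neg_mul_neg]

theorem rel_negone_left {m : ℕ} {Y : Mat m} : rel (-1) Y ↔ Y * Y = -Y := by
  rw [← rel_neg_neg, neg_neg, rel_one_left, neg_mul_neg]

theorem rel_self {m : ℕ} {Y : Mat m} : rel Y Y ↔ Y * Y * (Y * Y) = Y * Y := by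
  unfold rel
  have e : (Y * Y + Y * Y) * (Y * Y + Y * Y) = (4:ℂ) • (Y * Y * (Y * Y)) := by
    rw [← two_smul ℂ, smul_mul_smul_comm]; norm_num
  have e2 : (2:ℂ) • (Y * Y + Y * Y) = (4:ℂ) • (Y * Y) := by
    rw [← two_smul ℂ, smul_smul]; norm_num
  rw [e, e2]
  exact smul_right_inj (by norm_num)

theorem selfI {m : ℕ} {A : Mat m} (h0 : rel A A) (h : ∀ X, rel X A → rel X X) : A = 1 ∨ A = -1 := by
  have hA := rel_self.1 h0
  have hX : ∀ X : Mat m, A * X + X * A = 0 → X * X = 0 := by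
    intro X hx
    have key : ∀ t : ℂ, rel (t • X) (t • X) := by
      intro t
      apply h
      rw [rel_symm]
      apply rel_of_anti
      rw [Matrix.mul_smul, Matrix.smul_mul, ← smul_add, hx, smul_zero]
    have h1 := rel_self.1 (key 1)
    have h2 := rel_self.1 (key 2)
    rw [one_smul] at h1
    have e : (2:ℂ) • X * (2:ℂ) • X = (4:ℂ) • (X * X) := by
      rw [smul_mul_smul_comm]; norm_num
    rw [e, smul_mul_smul_comm, h1] at h2
    have h3 : (12:ℂ) • (X * X) = 0 := by
      have := sub_eq_zero.2 h2
      rw [← sub_smul] at this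
      norm_num at this ⊢
      exact this
    exact (smul_eq_zero.1 h3).resolve_left (by norm_num)
  have hA2 : A * A = 1 := by
    set F := 1 - A * A with hF
    have hFF : F * F = F := by
      have : F * F = 1 - A * A - A * A + A * A * (A * A) := by rw [hF]; noncomm_ring
      rw [this, hA, hF]; abel
    have hFA : F * A = A * F := by rw [hF]; noncomm_ring
    have hAF : A * A * F = 0 := by
      have : A * A * F = A * A - A * A * (A * A) := by rw [hF]; noncomm_ring
      rw [this, hA, sub_self]
    suffices F = 0 by
      have := sub_eq_zero.1 this; exact this.symm
    by_cases hz : A * F = 0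
    · rw [← hFF]
      apply hX
      rw [hFA, hz, add_zero]
    · exfalso
      have : ∃ u, (A * F) *ᵥ u ≠ 0 := by
        by_contra! hc
        apply hz
        apply ext_mulVec
        intro v; rw [hc, Matrix.zero_mulVec]
      obtain ⟨u, hu⟩ := this
      obtain ⟨h0, hh0⟩ := exists_dual hu
      set v := F *ᵥ u with hv
      set g := h0 ᵥ* F with hg
      have e0 : (A * F) *ᵥ u = A *ᵥ v := by rw [hv, mulVec_mulVec]
      rw [e0] at hh0 hu
      have e1 : A *ᵥ (A *ᵥ v) = 0 := by
        rw [hv, mulVec_mulVec, mulVec_mulVec, hAF, Matrix.zero_mulVec]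
      have e2 : g ᵥ* (A * A) = 0 := by
        have : F * (A * A) = A * A * F := by rw [hF]; noncomm_ring
        rw [hg, vecMul_vecMul, this, hAF, Matrix.vecMul_zero]
      have e3 : g ⬝ᵥ (A *ᵥ v) = 1 := by
        rw [hg, ← dotProduct_mulVec, mulVec_mulVec, hFA, ← mulVec_mulVec, hv, mulVec_mulVec u F F, hFF, ← hv, hh0]
      have e4 : (g ᵥ* A) ⬝ᵥ (A *ᵥ v) = 0 := by
        rw [← dotProduct_mulVec, e1, dotProduct_zero]
      have e5 : (g ᵥ* A) ⬝ᵥ v = 1 := by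
        rw [← dotProduct_mulVec, e3]
      have hsq := hX (vecMulVec (A *ᵥ v) g - vecMulVec v (g ᵥ* A)) (by
        simp only [Matrix.mul_sub, Matrix.sub_mul, mul_vecMulVec, vecMulVec_mul, e1, vecMul_vecMul, e2]
        simp)
      have h6 := congrArg (fun Z => Z *ᵥ v) hsq
      simp only [← mulVec_mulVec, Matrix.sub_mulVec, vecMulVec_mulVec, e3, e5, Matrix.zero_mulVec, mulVec_sub, mulVec_smul, e4] at h6
      simp at h6
      apply hu; rw [h6, mulVec_zero]
  by_contra! hc
  have : ∃ x0 : Fin m → ℂ, A *ᵥ x0 + x0 ≠ 0 := by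
    by_contra! h1
    apply hc.2
    apply ext_mulVec
    intro v; rw [eq_neg_of_add_eq_zero_left (h1 v), Matrix.neg_mulVec, Matrix.one_mulVec]
  obtain ⟨x0, hx0⟩ := this
  have : ∃ y0 : Fin m → ℂ, A *ᵥ y0 - y0 ≠ 0 := by
    by_contra! h1
    apply hc.1
    apply ext_mulVec
    intro v; rw [sub_eq_zero.1 (h1 v), Matrix.one_mulVec]
  obtain ⟨y0, hy0⟩ := this
  set x := A *ᵥ x0 + x0
  set y := A *ᵥ y0 - y0
  have hx : A *ᵥ x = x := by
    simp only [x, mulVec_add, mulVec_mulVec, hA2, Matrix.one_mulVec]; abel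
  have hy : A *ᵥ y = -y := by
    simp only [y, mulVec_sub, mulVec_mulVec, hA2, Matrix.one_mulVec]; abel
  obtain ⟨f0, hf0⟩ := exists_dual hx0
  obtain ⟨g0, hg0⟩ := exists_dual hy0
  set f := f0 + f0 ᵥ* A
  set g := g0 - g0 ᵥ* A
  have hf : f ᵥ* A = f := by
    simp only [f, add_vecMul, vecMul_vecMul, hA2, Matrix.vecMul_one]; abel
  have hg : g ᵥ* A = -g := by
    simp only [g, sub_vecMul, vecMul_vecMul, hA2, Matrix.vecMul_one]; abel
  have hfx : f ⬝ᵥ x = 2 := by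
    simp only [f, add_dotProduct, ← dotProduct_mulVec, hx, hf0]; norm_num
  have hgy : g ⬝ᵥ y = 2 := by
    simp only [g, sub_dotProduct, ← dotProduct_mulVec, hy, dotProduct_neg, hg0]; norm_num
  have hgx : g ⬝ᵥ x = 0 := by
    simp only [g, sub_dotProduct, ← dotProduct_mulVec, hx, sub_self]
  have hfy : f ⬝ᵥ y = 0 := by
    simp only [f, add_dotProduct, ← dotProduct_mulVec, hy, dotProduct_neg, add_neg_cancel]
  have hsq := hX (vecMulVec x g + vecMulVec y f) (by
    simp only [Matrix.mul_add, Matrix.add_mul, mul_vecMulVec, vecMulVec_mul, hx, hy, hf, hg, vecMulVec_neg, neg_vecMulVec]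
    abel)
  have h6 := congrArg (fun Z => Z *ᵥ x) hsq
  simp only [← mulVec_mulVec, Matrix.add_mulVec, vecMulVec_mulVec, Matrix.zero_mulVec, mulVec_add, mulVec_smul, hgx, hfx] at h6
  simp [hgy, hfy] at h6
  rcases h6 with h6 | h6
  · exact absurd (congrArg MulOpposite.unop h6) (two_ne_zero (α := ℂ))
  · exact hx0 h6

structure Nm {n : ℕ} (ψ : Mat n → Mat n) : Prop where
  hr : ∀ A B, rel A B ↔ rel (ψ A) (ψ B)
  hi : ∀ P, P * P = P → ∃ A, ψ A = P
  ha : ∀ P, P * P = P → ∃ A, ψ A = -P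
  one : ψ 1 = 1
  negone : ψ (-1) = -1

theorem rel_zero {m : ℕ} (A : Mat m) : rel A 0 := by
  apply rel_of_anti; simp

theorem mk_Nm {n : ℕ} {ψ : Mat n → Mat n} (hr : ∀ A B, rel A B ↔ rel (ψ A) (ψ B))
    (hi : ∀ P, P * P = P → P ≠ 0 → ∃ A, ψ A = P)
    (ha : ∀ P, P * P = P → P ≠ 0 → ∃ A, ψ A = -P) (hn : 0 < n) : Nm ψ ∨ Nm (fun A => - ψ A) := by
  have : Nonempty (Fin n) := ⟨⟨0, hn⟩⟩
  have h10 : (1 : Mat n) ≠ 0 := one_ne_zero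
  obtain ⟨U, hU⟩ := hi 1 (by simp) h10
  obtain ⟨V, hV⟩ := ha 1 (by simp) h10
  have z0 : ψ 0 = 0 := by
    have h1 := (hr U 0).1 (rel_zero _)
    have h2 := (hr V 0).1 (rel_zero _)
    rw [hU, rel_one_left] at h1
    rw [hV, rel_negone_left, h1] at h2
    have h3 : (2:ℂ) • ψ 0 = 0 := by
      rw [two_smul]; nth_rw 2 [h2]; simp
    exact (smul_eq_zero.1 h3).resolve_left (by norm_num)
  have hUU : U = 1 ∨ U = -1 := by
    apply selfI
    · rw [hr, hU]; exact rel_self.2 (by simp)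
    · intro X hX
      rw [hr] at hX ⊢
      rw [hU, rel_symm, rel_one_left] at hX
      rw [rel_self, hX, hX]
  have hVV : V = 1 ∨ V = -1 := by
    apply selfI
    · rw [hr, hV]; exact rel_self.2 (by simp)
    · intro X hX
      rw [hr] at hX ⊢
      rw [hV, rel_symm, rel_negone_left] at hX
      rw [rel_self, hX, neg_mul_neg, hX]
  have hne : U ≠ V := by
    intro e
    rw [e, hV] at hU
    have h3 : (2:ℂ) • (1 : Mat n) = 0 := by
      rw [two_smul]; nth_rw 1 [← hU]; simp
    exact h10 ((smul_eq_zero.1 h3).resolve_left (by norm_num))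
  have hi' : ∀ P, P * P = P → ∃ A, ψ A = P := by
    intro P hP
    by_cases h : P = 0
    · exact ⟨0, by rw [h, z0]⟩
    · exact hi P hP h
  have ha' : ∀ P, P * P = P → ∃ A, ψ A = -P := by
    intro P hP
    by_cases h : P = 0
    · exact ⟨0, by rw [h, z0, neg_zero]⟩
    · exact ha P hP h
  rcases hUU with hu | hu
  · rcases hVV with hv | hv
    · exact absurd (hu.trans hv.symm) hne
    · left
      exact ⟨hr, hi', ha', hu ▸ hU, hv ▸ hV⟩
  · rcases hVV with hv | hv
    · right
      refine ⟨fun A B => by rw [rel_neg_neg]; exact hr A B, fun P hP => ?_, fun P hP => ?_, ?_, ?_⟩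
      · obtain ⟨A, hA⟩ := ha' P hP
        exact ⟨A, by rw [hA, neg_neg]⟩
      · obtain ⟨A, hA⟩ := hi' P hP
        exact ⟨A, by rw [hA]⟩
      · show -ψ 1 = 1
        rw [← hv, hV, neg_neg, hv]
      · show -ψ (-1) = -1
        rw [← hu, hU, hu]
    · exact absurd (hu.trans hv.symm) hne



def Orth {m : ℕ} (P Q : Mat m) : Prop := P * Q = 0 ∧ Q * P = 0

theorem Orth.symm {m : ℕ} {P Q : Mat m} (h : Orth P Q) : Orth Q P := ⟨h.2, h.1⟩

theorem orth_aux {m : ℕ} {P Q : Mat m} (hP : P * P = P)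
    (h2 : P * (Q * (P * Q)) + P * (Q * (P * Q)) + P * (Q * P) + P * (Q * (P * (Q * P))) =
      -((2:ℂ) • (P * Q + P * (Q * P)))) :
    (3:ℂ) • (P * Q * P * (P * Q * P)) = (-5:ℂ) • (P * Q * P) ∧ P * Q = P * Q * P := by
  have hPP : ∀ X : Mat m, P * (P * X) = P * X := fun X => by rw [← Matrix.mul_assoc, hP]
  obtain ⟨a, ha⟩ : ∃ a, a = P * Q * P := ⟨_, rfl⟩
  obtain ⟨b, hb⟩ : ∃ b, b = P * Q - a := ⟨_, rfl⟩
  have e1 : P * (Q * (P * Q)) = a * a + a * b := by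
    rw [hb, ha]; simp only [Matrix.mul_sub, Matrix.mul_assoc, hPP]; abel
  have e2 : P * (Q * (P * (Q * P))) = a * a := by rw [ha]; simp only [Matrix.mul_assoc, hPP]
  have e3 : P * Q = a + b := by rw [hb]; abel
  have e4 : P * (Q * P) = a := by rw [ha, Matrix.mul_assoc]
  have hbP : b * P = 0 := by rw [hb, ha]; simp only [Matrix.sub_mul, Matrix.mul_assoc, hP, sub_self]
  have haP : a * P = a := by rw [ha]; simp only [Matrix.mul_assoc, hP]
  rw [e1, e2, e3, e4] at h2
  have h3 : (3:ℂ) • (a * a) = (-5:ℂ) • a := by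
    have := congrArg (fun X => X * P) h2
    simp only [Matrix.add_mul, Matrix.mul_assoc, haP, hbP, Matrix.neg_mul, Matrix.smul_mul,
      Matrix.mul_zero] at this
    linear_combination (norm := module) this
  have h4 : a * b = - b := by
    linear_combination (norm := module) (1/2:ℂ) • h2 - (1/2:ℂ) • h3
  have h5 : b = 0 := by
    have := congrArg (fun X => X * b) h3
    simp only [Matrix.smul_mul, Matrix.mul_assoc, h4, Matrix.mul_neg, neg_neg] at this
    linear_combination (norm := module) (-1/2:ℂ) • this
  rw [← ha]
  exact ⟨h3, by rw [e3, h5, add_zero]⟩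

theorem orth_iff {m : ℕ} {P Q : Mat m} (hP : P * P = P) (hQ : Q * Q = Q) :
    rel P (-Q) ↔ Orth P Q := by
  constructor
  · intro h
    unfold rel at h
    have e : P * -Q + -Q * P = -(P * Q + Q * P) := by noncomm_ring
    rw [e, neg_mul_neg, smul_neg] at h
    have hPP : ∀ X : Mat m, P * (P * X) = P * X := fun X => by rw [← Matrix.mul_assoc, hP]
    have hQQ : ∀ X : Mat m, Q * (Q * X) = Q * X := fun X => by rw [← Matrix.mul_assoc, hQ]
    have key : ∀ P Q : Mat m, P * P = P → Q * Q = Q →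
        (P * Q + Q * P) * (P * Q + Q * P) = -((2:ℂ) • (P * Q + Q * P)) → 
      P * (Q * (P * Q)) + P * (Q * (P * Q)) + P * (Q * P) + P * (Q * (P * (Q * P))) =
      -((2:ℂ) • (P * Q + P * (Q * P))) := by
      intro P Q hP hQ h
      have hPP : ∀ X : Mat m, P * (P * X) = P * X := fun X => by rw [← Matrix.mul_assoc, hP]
      have hQQ : ∀ X : Mat m, Q * (Q * X) = Q * X := fun X => by rw [← Matrix.mul_assoc, hQ]
      have := congrArg (fun X => P * X) h
      simp only [Matrix.mul_add, Matrix.add_mul, Matrix.mul_assoc, hPP, hQQ, Matrix.mul_neg,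
        Matrix.mul_smul] at this
      linear_combination (norm := module) this
    have hT := congrArg Matrix.transpose h
    simp only [transpose_mul, transpose_add, transpose_neg, transpose_smul] at hT
    obtain ⟨h1, h2⟩ := orth_aux hP (key P Q hP hQ h)
    have hPT : Pᵀ * Pᵀ = Pᵀ := by rw [← transpose_mul, hP]
    have hQT : Qᵀ * Qᵀ = Qᵀ := by rw [← transpose_mul, hQ]
    obtain ⟨-, h3⟩ := orth_aux hPT (key Pᵀ Qᵀ hPT hQT (by rw [add_comm (Pᵀ * Qᵀ)]; exact hT))
    rw [← transpose_mul, ← transpose_mul, transpose_inj, ← Matrix.mul_assoc] at h3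
    have h4 : P * Q * (P * Q) = P * Q := by
      rw [Matrix.mul_assoc, ← Matrix.mul_assoc Q, h3, ← h2, Matrix.mul_assoc, hQ, hPP]
    rw [← h2, h4] at h1
    have h5 : P * Q = 0 := by linear_combination (norm := module) (1/8 : ℂ) • h1
    exact ⟨h5, by rw [h3, ← h2, h5]⟩
  · rintro ⟨h1, h2⟩
    apply rel_of_anti
    simp [h1, h2]

def R1 {m : ℕ} (P : Mat m) : Prop := ∃ x f : Fin m → ℂ, f ⬝ᵥ x = 1 ∧ P = vecMulVec x f

theorem R1.idem {m : ℕ} {P : Mat m} (h : R1 P) : P * P = P := by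
  obtain ⟨x, f, h1, rfl⟩ := h; exact rank_one_idem h1

theorem R1.tr {m : ℕ} {P : Mat m} (h : R1 P) : trace P = 1 := by
  obtain ⟨x, f, h1, rfl⟩ := h; rw [trace_vecMulVec, dotProduct_comm, h1]

theorem R1.ne {m : ℕ} {P : Mat m} (h : R1 P) : P ≠ 0 := by
  intro h0; have := h.tr; rw [h0] at this; simp at this

theorem R1.sand {m : ℕ} {P : Mat m} (h : R1 P) (A : Mat m) : P * A * P = trace (P * A) • P := by
  obtain ⟨x, f, h1, rfl⟩ := h
  rw [vmv_sandwich, vecMulVec_mul, trace_vecMulVec, dotProduct_comm x, dotProduct_mulVec]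

def le' {m : ℕ} (P R : Mat m) : Prop := P * R = P ∧ R * P = P

theorem le'.antisymm {m : ℕ} {P R : Mat m} (h1 : le' P R) (h2 : le' R P) : P = R := by
  rw [← h1.1, h2.2]

theorem le'_compl {m : ℕ} {P R : Mat m} : le' P R ↔ Orth P (1 - R) := by
  unfold le' Orth
  simp only [Matrix.mul_sub, Matrix.sub_mul, Matrix.one_mul, Matrix.mul_one, sub_eq_zero]
  simp only [eq_comm]

theorem idem_compl {m : ℕ} {P : Mat m} (h : P * P = P) : (1 - P) * (1 - P) = 1 - P := by
  simp [Matrix.mul_sub, Matrix.sub_mul, h]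

theorem le'_iff {m : ℕ} {P R : Mat m} (hR : R * R = R) : 
    le' P R ↔ ∀ Q, Q * Q = Q → Orth R Q → Orth P Q := by
  constructor
  · rintro h Q - h2
    exact ⟨by rw [← h.1, Matrix.mul_assoc, h2.1, Matrix.mul_zero], 
      by rw [← h.2, ← Matrix.mul_assoc, h2.2, Matrix.zero_mul]⟩
  · intro h
    rw [le'_compl]
    exact h _ (idem_compl hR) (by simp [Orth, Matrix.mul_sub, Matrix.sub_mul, hR])

theorem R1_atom {m : ℕ} {P : Mat m} (h : R1 P) {R : Mat m} (hR : R * R = R) (hle : le' R P) :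
    R = 0 ∨ R = P := by
  have e : R = trace (P * R) • P := by
    rw [← h.sand, hle.2, hle.1]
  have e2 := e
  rw [hle.2] at e
  have hs : trace R • trace R • P = trace R • P := by
    have := hR
    rw [e, smul_mul_smul_comm, h.idem, mul_smul] at this
    exact this
  have : trace R * trace R = trace R := by
    have := congrArg trace hs
    simpa [h.tr] using this
  have h3 : trace R * (trace R - 1) = 0 := by rw [mul_sub, this]; ring
  rcases mul_eq_zero.1 h3 with h4 | h4
  · left; rw [e, h4, zero_smul]
  · right; rw [e, sub_eq_zero.1 h4, one_smul]

theorem atom_R1 {m : ℕ} {P : Mat m} (hP : P * P = P) (h0 : P ≠ 0)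
    (h : ∀ R : Mat m, R * R = R → le' R P → R = 0 ∨ R = P) : R1 P := by
  have : ∃ u, P *ᵥ u ≠ 0 := by
    by_contra! hc
    apply h0
    apply ext_mulVec
    intro v; rw [hc, Matrix.zero_mulVec]
  obtain ⟨u, hu⟩ := this
  obtain ⟨f, hf⟩ := exists_dual hu
  have hfx : (f ᵥ* P) ⬝ᵥ (P *ᵥ u) = 1 := by
    rw [← dotProduct_mulVec, mulVec_mulVec, hP, hf]
  have hr : R1 (vecMulVec (P *ᵥ u) (f ᵥ* P)) := ⟨_, _, hfx, rfl⟩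
  rcases h _ hr.idem ⟨by rw [vecMulVec_mul, vecMul_vecMul, hP], by rw [mul_vecMulVec, mulVec_mulVec, hP]⟩ with h | h
  · exact absurd h hr.ne
  · rw [← h]; exact hr


theorem Nm.inj {n : ℕ} {ψ : Mat n → Mat n} (H : Nm ψ) {A A' : Mat n} (h : ψ A = ψ A') : A = A' := by
  symm
  apply sepM_of_TT (TT_all n)
  intro B
  rw [H.hr, H.hr A', h]

theorem Nm.prime {n : ℕ} {ψ : Mat n → Mat n} (H : Nm ψ) : Nm (fun A => - ψ (-A)) := by
  refine ⟨fun A B => ?_, fun P hP => ?_, fun P hP => ?_, ?_, ?_⟩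
  · rw [rel_neg_neg, ← H.hr, rel_neg_neg]
  · obtain ⟨A, hA⟩ := H.ha P hP
    exact ⟨-A, by rw [neg_neg, hA, neg_neg]⟩
  · obtain ⟨A, hA⟩ := H.hi P hP
    exact ⟨-A, by rw [neg_neg, hA]⟩
  · show - ψ (-1) = 1
    rw [H.negone, neg_neg]
  · show - ψ (- -1) = -1
    rw [neg_neg, H.one]

theorem Nm.idem {n : ℕ} {ψ : Mat n → Mat n} (H : Nm ψ) {P : Mat n} : P * P = P ↔ ψ P * ψ P = ψ P := by
  rw [← rel_one_left, H.hr, H.one, rel_one_left]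

theorem Nm.aidem {n : ℕ} {ψ : Mat n → Mat n} (H : Nm ψ) {P : Mat n} : P * P = -P ↔ ψ P * ψ P = -ψ P := by
  rw [← rel_negone_left, H.hr, H.negone, rel_negone_left]

theorem Nm.zero {n : ℕ} {ψ : Mat n → Mat n} (H : Nm ψ) : ψ 0 = 0 := by
  have h1 := H.idem.1 (show (0 : Mat n) * 0 = 0 by simp)
  have h2 := H.aidem.1 (show (0 : Mat n) * 0 = -0 by simp)
  rw [h1] at h2
  have h3 : (2:ℂ) • ψ 0 = 0 := by
    rw [two_smul]; nth_rw 2 [h2]; simp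
  exact (smul_eq_zero.1 h3).resolve_left (by norm_num)

theorem Nm.pre {n : ℕ} {ψ : Mat n → Mat n} (H : Nm ψ) {P : Mat n} (hP : P * P = P) :
    ∃ A, A * A = A ∧ ψ A = P := by
  obtain ⟨A, hA⟩ := H.hi P hP
  exact ⟨A, H.idem.2 (by rw [hA, hP]), hA⟩

theorem Nm.pidem {n : ℕ} {ψ : Mat n → Mat n} (H : Nm ψ) {P : Mat n} (h : P * P = P) :
    -ψ (-P) * -ψ (-P) = -ψ (-P) := H.prime.idem.1 h

theorem Nm.orth {n : ℕ} {ψ : Mat n → Mat n} (H : Nm ψ) {P Q : Mat n} (hP : P * P = P)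
    (hQ : Q * Q = Q) : Orth P Q ↔ Orth (ψ P) (-ψ (-Q)) := by
  rw [← orth_iff hP hQ, ← orth_iff (H.idem.1 hP) (H.pidem hQ), H.hr, neg_neg]

theorem Nm.le {n : ℕ} {ψ : Mat n → Mat n} (H : Nm ψ) {P R : Mat n} (hP : P * P = P)
    (hR : R * R = R) : le' P R ↔ le' (ψ P) (ψ R) := by
  rw [le'_iff hR, le'_iff (H.idem.1 hR)]
  constructor
  · intro h Q' hQ' h1
    obtain ⟨Q, hQ, rfl⟩ := H.prime.pre hQ'
    rw [← H.orth hP hQ]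
    rw [← H.orth hR hQ] at h1
    exact h Q hQ h1
  · intro h Q hQ h1
    rw [H.orth hP hQ]
    rw [H.orth hR hQ] at h1
    exact h _ (H.pidem hQ) h1

theorem Nm.compl {n : ℕ} {ψ : Mat n → Mat n} (H : Nm ψ) {P : Mat n} (hP : P * P = P) :
    -ψ (-(1 - P)) = 1 - ψ P := by
  have hP' := H.idem.1 hP
  apply le'.antisymm
  · rw [le'_compl, sub_sub_cancel]
    apply Orth.symm
    rw [← H.orth hP (idem_compl hP)]
    simp [Orth, Matrix.mul_sub, Matrix.sub_mul, hP]
  · obtain ⟨Q, hQ, hQ'⟩ := H.prime.pre (idem_compl hP')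
    rw [← hQ']
    rw [← H.prime.le hQ (idem_compl hP), le'_compl, sub_sub_cancel]
    apply Orth.symm
    rw [H.orth hP hQ]
    rw [hQ']
    simp [Orth, Matrix.mul_sub, Matrix.sub_mul, hP']

theorem Nm.R1 {n : ℕ} {ψ : Mat n → Mat n} (H : Nm ψ) {P : Mat n} : R1 P ↔ R1 (ψ P) := by
  constructor
  · intro h
    have hP := h.idem
    apply atom_R1 (H.idem.1 hP)
    · intro h0
      exact h.ne (H.inj (by rw [h0, H.zero]))
    · intro R hR hle
      obtain ⟨R0, hR0, rfl⟩ := H.pre hR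
      rw [← H.le hR0 hP] at hle
      rcases R1_atom h hR0 hle with h | h
      · left; rw [h, H.zero]
      · right; rw [h]
  · intro h
    have hP := H.idem.2 h.idem
    apply atom_R1 hP
    · intro h0
      apply h.ne
      rw [h0, H.zero]
    · intro R hR hle
      rw [H.le hR hP] at hle
      rcases R1_atom h (H.idem.1 hR) hle with h | h
      · left; exact H.inj (by rw [h, H.zero])
      · right; exact H.inj h

theorem exists_ker2 {n : ℕ} (hn : 3 ≤ n) (f g : Fin n → ℂ) : ∃ w : Fin n → ℂ, w ≠ 0 ∧ f ⬝ᵥ w = 0 ∧ g ⬝ᵥ w = 0 := by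
  let L : (Fin n → ℂ) →ₗ[ℂ] (Fin 2 → ℂ) := Matrix.mulVecLin (Matrix.of ![f, g])
  have : LinearMap.ker L ≠ ⊥ := LinearMap.ker_ne_bot_of_finrank_lt (by simp; omega)
  obtain ⟨w, hw, hw0⟩ := Submodule.exists_mem_ne_zero_of_ne_bot this
  refine ⟨w, hw0, ?_, ?_⟩
  · have := congrFun (LinearMap.mem_ker.1 hw) 0
    simpa [L, mulVec] using this
  · have := congrFun (LinearMap.mem_ker.1 hw) 1
    simpa [L, mulVec] using this

theorem R1_rel_tr {m : ℕ} {P Q : Mat m} (hP : R1 P) (hQ : R1 Q) (h : rel P Q) :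
    trace (P * Q) = 0 ∨ trace (P * Q) = 1 := by
  unfold rel at h
  have h1 := congrArg (fun X => trace (P * X)) h
  have hp := hP.idem
  have hq := hQ.idem
  have hPP : ∀ X : Mat m, P * (P * X) = P * X := fun X => by rw [← Matrix.mul_assoc, hp]
  have hQQ : ∀ X : Mat m, Q * (Q * X) = Q * X := fun X => by rw [← Matrix.mul_assoc, hq]
  have s1 : P * (Q * P) = trace (P * Q) • P := by rw [← hP.sand, Matrix.mul_assoc]
  have s2 : Q * (P * Q) = trace (P * Q) • Q := by rw [trace_mul_comm, ← hQ.sand, Matrix.mul_assoc]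
  simp only [Matrix.mul_add, Matrix.add_mul, Matrix.mul_assoc, hPP, hQQ, hp, s1, s2, Matrix.mul_smul, trace_add, trace_smul, hP.tr, smul_eq_mul, mul_one] at h1
  have h2 : trace (P * Q) * (trace (P * Q) - 1) = 0 := by linear_combination (1/3) * h1
  rcases mul_eq_zero.1 h2 with h | h
  · left; exact h
  · right; exact sub_eq_zero.1 h


theorem sepL_aux {n : ℕ} {x f y g : Fin n → ℂ} (hfx : f ⬝ᵥ x = 1) (hgy : g ⬝ᵥ y = 1)
    (h : ∀ R : Mat n, R * R = R → Orth R (vecMulVec x f) → rel R (vecMulVec y g))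
    (hy : y = (f ⬝ᵥ y) • x) : vecMulVec y g = vecMulVec x f := by
  have hR := h (1 - vecMulVec x f) (idem_compl (rank_one_idem hfx))
    (by simp [Orth, Matrix.mul_sub, Matrix.sub_mul, rank_one_idem hfx])
  have e1 : (1 - vecMulVec x f) * vecMulVec y g = 0 := by
    rw [mul_vecMulVec, Matrix.sub_mulVec, Matrix.one_mulVec, vecMulVec_mulVec]
    have : y - MulOpposite.op (f ⬝ᵥ y) • x = 0 := by
      nth_rw 1 [hy]; ext i; simp [mul_comm]
    rw [this]; simp
  unfold rel at hR
  rw [e1, zero_add, Matrix.mul_assoc, ← Matrix.mul_assoc _ (vecMulVec y g), e1] at hR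
  simp only [Matrix.zero_mul, Matrix.mul_zero] at hR
  have h2 := (smul_eq_zero.1 hR.symm).resolve_left (by norm_num)
  rw [Matrix.mul_sub, Matrix.mul_one, vecMulVec_mul_vecMulVec, sub_eq_zero] at h2
  rw [h2, hy, vmv_smul, smul_vecMulVec, smul_smul]
  have : g ⬝ᵥ x * f ⬝ᵥ y = 1 := by
    rw [hy, dotProduct_smul, smul_eq_mul] at hgy
    rw [mul_comm]; exact hgy
  rw [this, one_smul]

theorem sepL {n : ℕ} (hn : 3 ≤ n) {Q1 Q2 : Mat n} (h1 : R1 Q1) (h2 : R1 Q2)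
    (h : ∀ R : Mat n, R * R = R → Orth R Q2 → rel R Q1) : Q1 = Q2 := by
  obtain ⟨y, g, hgy, rfl⟩ := h1
  obtain ⟨x, f, hfx, rfl⟩ := h2
  set y1 := y - (f ⬝ᵥ y) • x with hy1
  set g1 := g - (g ⬝ᵥ x) • f with hg1
  by_cases hy : y1 = 0
  · exact sepL_aux hfx hgy h (sub_eq_zero.1 hy)
  by_cases hg : g1 = 0
  · have := sepL_aux (x := f) (f := x) (y := g) (g := y) (by rw [dotProduct_comm, hfx])
      (by rw [dotProduct_comm, hgy]) (by
        intro R hR ho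
        have := h Rᵀ (by rw [← transpose_mul, hR]) ⟨by
          have := congrArg transpose ho.2
          simpa [transpose_mul, transpose_vecMulVec] using this, by
          have := congrArg transpose ho.1
          simpa [transpose_mul, transpose_vecMulVec] using this⟩
        rw [← rel_transpose, transpose_vecMulVec]
        exact this) (by rw [dotProduct_comm]; exact sub_eq_zero.1 hg)
    have := congrArg transpose this
    rwa [transpose_vecMulVec, transpose_vecMulVec] at this
  exfalso
  have fy1 : f ⬝ᵥ y1 = 0 := by simp [hy1, dotProduct_sub, hfx]
  have g1x : g1 ⬝ᵥ x = 0 := by simp [hg1, sub_dotProduct, hfx]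
  have key : ∀ v k : Fin n → ℂ, k ⬝ᵥ v = 1 → f ⬝ᵥ v = 0 → k ⬝ᵥ x = 0 → g1 ⬝ᵥ v * k ⬝ᵥ y1 ≠ 2 := by
    intro v k hkv hfv hkx hc
    have hr := h (vecMulVec v k) (rank_one_idem hkv) ⟨by
      rw [vecMulVec_mul_vecMulVec, hkx, zero_smul, vecMulVec_zero], by 
      rw [vecMulVec_mul_vecMulVec, hfv, zero_smul, vecMulVec_zero]⟩
    have ht := R1_rel_tr ⟨v, k, hkv, rfl⟩ ⟨y, g, hgy, rfl⟩ hr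
    have e : trace (vecMulVec v k * vecMulVec y g) = 2 := by
      rw [vecMulVec_mul_vecMulVec, trace_vecMulVec, ← hc, hg1, hy1]
      simp only [sub_dotProduct, dotProduct_sub, dotProduct_smul, smul_dotProduct, hkx, hfv, smul_eq_mul]
      rw [dotProduct_comm v g]; ring
    rw [e] at ht
    norm_num at ht
  obtain ⟨k0, hk0⟩ := exists_dual hy
  by_cases hd : g1 ⬝ᵥ y1 = 0
  · obtain ⟨u, hu⟩ := exists_dual hg
    rw [dotProduct_comm] at hu
    have hk : ∃ k1 : Fin n → ℂ, k1 ⬝ᵥ y1 = 1 ∧ k1 ⬝ᵥ x = 0 := ⟨k0 - (k0 ⬝ᵥ x) • f, by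
      simp [sub_dotProduct, hk0, fy1], by simp [sub_dotProduct, hfx]⟩
    obtain ⟨k1, hk1, hk1x⟩ := hk
    have hv : ∃ v : Fin n → ℂ, g1 ⬝ᵥ v = 2 ∧ f ⬝ᵥ v = 0 := ⟨(2:ℂ) • (u - (f ⬝ᵥ u) • x), by
      simp [dotProduct_sub, hu, g1x], by simp [dotProduct_sub, hfx]⟩
    obtain ⟨v, hv, hfv⟩ := hv
    refine key v (k1 + ((1 - k1 ⬝ᵥ v) / 2) • g1) ?_ hfv ?_ ?_
    · simp [add_dotProduct, hv]
    · simp [add_dotProduct, hk1x, g1x]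
    · simp [add_dotProduct, hk1, hd, hv]
  · set d := g1 ⬝ᵥ y1 with hdd
    obtain ⟨w, hw, hfw, hgw⟩ := exists_ker2 hn f g1
    obtain ⟨q, hq⟩ := exists_dual hw
    have hk : ∃ k : Fin n → ℂ, k ⬝ᵥ y1 = 0 ∧ k ⬝ᵥ x = 0 ∧ k ⬝ᵥ w = 1 :=
      ⟨q - (q ⬝ᵥ x) • f - (q ⬝ᵥ y1 / d) • g1, by
      simp only [sub_dotProduct, smul_dotProduct, fy1, ← hdd, smul_eq_mul]; field_simp; ring, 
      by simp [sub_dotProduct, hfx, g1x], by simp [sub_dotProduct, hfw, hgw, hq]⟩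
    obtain ⟨k, hky, hkx, hkw⟩ := hk
    refine key ((2 / d) • y1 + w) (d⁻¹ • g1 + (1 - 2 / d) • k) ?_ ?_ ?_ ?_
    · simp only [add_dotProduct, dotProduct_add, smul_dotProduct, dotProduct_smul, ← hdd, hgw, hky, hkw, smul_eq_mul]
      field_simp; ring
    · simp [dotProduct_add, fy1, hfw]
    · simp [add_dotProduct, g1x, hkx]
    · simp only [add_dotProduct, dotProduct_add, smul_dotProduct, dotProduct_smul, ← hdd, hgw, hky, smul_eq_mul]
      field_simp; ring

theorem Nm.negR1 {n : ℕ} (hn : 3 ≤ n) {ψ : Mat n → Mat n} (H : Nm ψ) {Q : Mat n} (hQ : _root_.R1 Q) :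
    ψ (-Q) = -ψ Q := by
  have h1 : ψ Q = - ψ (-Q) := by
    apply sepL hn (H.R1.1 hQ) (H.prime.R1.1 hQ)
    intro R hR ho
    obtain ⟨R0, hR0, rfl⟩ := H.pre hR
    rw [← H.orth hR0 hQ.idem] at ho
    rw [← H.hr]
    exact rel_of_anti (by rw [ho.1, ho.2, add_zero])
  rw [h1, neg_neg]

def Good {n : ℕ} (ψ : Mat n → Mat n) (S : Mat n) : Prop := S * S = S ∧ ψ (-S) = - ψ S

theorem Nm.anti {n : ℕ} {ψ : Mat n → Mat n} (H : Nm ψ) {S A : Mat n} (hS : Good ψ S) :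
    Orth A S ↔ Orth (ψ A) (ψ S) := by
  constructor
  · intro h
    apply idem_orth (H.idem.1 hS.1)
    apply rel_neg
    · rw [← H.hr]; exact rel_of_anti (by rw [h.1, h.2, add_zero])
    · rw [← hS.2, ← H.hr]; exact rel_of_anti (by rw [Matrix.mul_neg, Matrix.neg_mul, h.1, h.2]; simp)
  · intro h
    apply idem_orth hS.1
    apply rel_neg
    · rw [H.hr]; exact rel_of_anti (by rw [h.1, h.2, add_zero])
    · rw [H.hr, hS.2]; exact rel_of_anti (by rw [Matrix.mul_neg, Matrix.neg_mul, h.1, h.2]; simp)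

theorem Nm.good1 {n : ℕ} (hn : 3 ≤ n) {ψ : Mat n → Mat n} (H : Nm ψ) {Q : Mat n} (hQ : _root_.R1 Q) :
    Good ψ Q := ⟨hQ.idem, H.negR1 hn hQ⟩

theorem Nm.goodc {n : ℕ} {ψ : Mat n → Mat n} (H : Nm ψ) {S : Mat n} (hS : Good ψ S) :
    Good ψ (1 - S) ∧ ψ (1 - S) = 1 - ψ S := by
  have h1 := H.compl hS.1
  have h2 := H.prime.compl hS.1
  simp only [neg_neg] at h2
  rw [hS.2, neg_neg] at h2
  refine ⟨⟨idem_compl hS.1, ?_⟩, h2⟩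
  rw [h2, ← h1, neg_neg]

theorem idem_add2 {n : ℕ} {P Q : Mat n} (hP : P * P = P) (hQ : Q * Q = Q) (ho : Orth P Q) :
    (P + Q) * (P + Q) = P + Q := by
  simp [Matrix.mul_add, Matrix.add_mul, hP, hQ, ho.1, ho.2]

theorem Nm.addR {n : ℕ} (hn : 3 ≤ n) {ψ : Mat n → Mat n} (H : Nm ψ) {P Q : Mat n} (hP : _root_.R1 P)
    (hQ : _root_.R1 Q) (ho : Orth P Q) : ψ (P + Q) = ψ P + ψ Q := by
  have ho' := (H.anti (H.good1 hn hQ)).1 ho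
  have hS := idem_add2 hP.idem hQ.idem ho
  have hS' := idem_add2 (H.idem.1 hP.idem) (H.idem.1 hQ.idem) ho'
  apply le'.antisymm
  · obtain ⟨S0, hS0, hS0'⟩ := H.pre hS'
    rw [← hS0', ← H.le hS hS0]
    have h1 : le' P S0 := by
      rw [H.le hP.idem hS0, hS0']
      constructor <;> simp [Matrix.mul_add, Matrix.add_mul, ho'.1, ho'.2, H.idem.1 hP.idem]
    have h2 : le' Q S0 := by
      rw [H.le hQ.idem hS0, hS0']
      constructor <;> simp [Matrix.mul_add, Matrix.add_mul, ho'.1, ho'.2, H.idem.1 hQ.idem]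
    constructor
    · rw [Matrix.add_mul, h1.1, h2.1]
    · rw [Matrix.mul_add, h1.2, h2.2]
  · have h1 : le' (ψ P) (ψ (P + Q)) := by
      rw [← H.le hP.idem hS]
      constructor <;> simp [Matrix.mul_add, Matrix.add_mul, ho.1, ho.2, hP.idem]
    have h2 : le' (ψ Q) (ψ (P + Q)) := by
      rw [← H.le hQ.idem hS]
      constructor <;> simp [Matrix.mul_add, Matrix.add_mul, ho.1, ho.2, hQ.idem]
    constructor
    · rw [Matrix.add_mul, h1.1, h2.1]
    · rw [Matrix.mul_add, h1.2, h2.2]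

theorem Nm.goodadd {n : ℕ} (hn : 3 ≤ n) {ψ : Mat n → Mat n} (H : Nm ψ) {P Q : Mat n} (hP : _root_.R1 P)
    (hQ : _root_.R1 Q) (ho : Orth P Q) : Good ψ (P + Q) := by
  refine ⟨idem_add2 hP.idem hQ.idem ho, ?_⟩
  have h1 := H.addR hn hP hQ ho
  have h2 := H.prime.addR hn hP hQ ho
  rw [H.negR1 hn hP, H.negR1 hn hQ, neg_neg, neg_neg, ← h1] at h2
  rw [← h2, neg_neg]

theorem Nm.corner {n : ℕ} {ψ : Mat n → Mat n} (H : Nm ψ) {S A : Mat n} (hS : Good ψ S) :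
    le' A S ↔ le' (ψ A) (ψ S) := by
  rw [le'_compl, le'_compl, ← (H.goodc hS).2, ← H.anti (H.goodc hS).1]

theorem R1_rel {m : ℕ} {P Q : Mat m} (hP : R1 P) (hQ : R1 Q) (h : rel P Q) :
    Orth P Q ∨ (P * Q = Q ∧ Q * P = P) ∨ (P * Q = P ∧ Q * P = Q) := by
  have ht := R1_rel_tr hP hQ h
  have hp := hP.idem
  have hq := hQ.idem
  have hPP : ∀ X : Mat m, P * (P * X) = P * X := fun X => by rw [← Matrix.mul_assoc, hp]
  have hQQ : ∀ X : Mat m, Q * (Q * X) = Q * X := fun X => by rw [← Matrix.mul_assoc, hq]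
  have s1 : P * (Q * P) = trace (P * Q) • P := by rw [← hP.sand, Matrix.mul_assoc]
  have s2 : Q * (P * Q) = trace (P * Q) • Q := by rw [trace_mul_comm, ← hQ.sand, Matrix.mul_assoc]
  unfold rel at h
  simp only [Matrix.mul_add, Matrix.add_mul, Matrix.mul_assoc, hPP, hQQ, s1, s2, Matrix.mul_smul] at h
  rcases ht with ht | ht
  · left
    rw [ht] at h
    apply idem_orth hq
    linear_combination (norm := module) (-1/2:ℂ) • h
  · right
    rw [ht] at h
    have h2 : P + Q = P * Q + Q * P := by
      linear_combination (norm := module) h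
    obtain ⟨x, f, hfx, rfl⟩ := hP
    obtain ⟨y, g, hgy, rfl⟩ := hQ
    have ht2 : f ⬝ᵥ y * g ⬝ᵥ x = 1 := by
      rw [vecMulVec_mul_vecMulVec, trace_vecMulVec, dotProduct_smul, smul_eq_mul, dotProduct_comm x] at ht
      exact ht
    have h3 : vecMulVec (x - (g ⬝ᵥ x) • y) (f - (f ⬝ᵥ y) • g) = 0 := by
      simp only [vecMulVec_mul_vecMulVec, vmv_smul] at h2
      simp only [sub_vecMulVec, vecMulVec_sub, smul_vecMulVec, vmv_smul, smul_smul]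
      rw [mul_comm, ht2, one_smul]
      linear_combination (norm := module) h2
    have h4 : x - (g ⬝ᵥ x) • y = 0 ∨ f - (f ⬝ᵥ y) • g = 0 := by
      by_contra! hc
      obtain ⟨i, hi⟩ := Function.ne_iff.1 hc.1
      obtain ⟨j, hj⟩ := Function.ne_iff.1 hc.2
      have := congrFun (congrFun h3 i) j
      rw [vecMulVec_apply] at this
      exact (mul_ne_zero hi hj) this
    rcases h4 with h4 | h4
    · left
      have hx := sub_eq_zero.1 h4
      have hv : ∀ k : Fin m → ℂ, vecMulVec x k = (g ⬝ᵥ x) • vecMulVec y k := by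
        intro k; rw [← smul_vecMulVec, ← hx]
      simp only [vecMulVec_mul_vecMulVec, vmv_smul]
      exact ⟨by rw [hv g, smul_smul, ht2, one_smul], (hv f).symm⟩
    · right
      have hx := sub_eq_zero.1 h4
      have hv : ∀ k : Fin m → ℂ, vecMulVec k f = (f ⬝ᵥ y) • vecMulVec k g := by
        intro k; rw [← vmv_smul, ← hx]
      simp only [vecMulVec_mul_vecMulVec, vmv_smul]
      exact ⟨(hv x).symm, by rw [hv y, smul_smul, mul_comm, ht2, one_smul]⟩


def Link {m : ℕ} (P Q : Mat m) : Prop := P * Q + Q * P = P + Q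

theorem Link.symm {m : ℕ} {P Q : Mat m} (h : Link P Q) : Link Q P := by
  unfold Link at *; rw [add_comm, h, add_comm]

theorem link_iff {m : ℕ} {P Q : Mat m} (hP : R1 P) (hQ : R1 Q) : Link P Q ↔ rel P Q ∧ ¬ Orth P Q := by
  constructor
  · intro h
    constructor
    · unfold rel Link at *
      rw [h]
      simp only [Matrix.mul_add, Matrix.add_mul, hP.idem, hQ.idem]
      linear_combination (norm := module) h
    · intro ho
      unfold Link at h
      rw [ho.1, ho.2, add_zero] at h
      have := congrArg trace h
      rw [trace_zero, trace_add, hP.tr, hQ.tr] at this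
      norm_num at this
  · rintro ⟨h1, h2⟩
    unfold Link
    rcases R1_rel hP hQ h1 with h | h | h
    · exact absurd h h2
    · rw [h.1, h.2, add_comm]
    · rw [h.1, h.2]

theorem Nm.link {n : ℕ} (hn : 3 ≤ n) {ψ : Mat n → Mat n} (H : Nm ψ) {P Q : Mat n} (hP : _root_.R1 P)
    (hQ : _root_.R1 Q) : Link P Q ↔ Link (ψ P) (ψ Q) := by
  rw [link_iff hP hQ, link_iff (H.R1.1 hP) (H.R1.1 hQ), H.hr, H.anti (H.good1 hn hQ)]

theorem link_self {m : ℕ} {P : Mat m} (hP : R1 P) : Link P P := by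
  unfold Link; rw [hP.idem]

theorem link_tr {m : ℕ} {P Q : Mat m} (hP : R1 P) (hQ : R1 Q) (h : Link P Q) : trace (P * Q) = 1 := by
  have := congrArg trace h
  rw [trace_add, trace_add, hP.tr, hQ.tr, trace_mul_comm Q] at this
  linear_combination (1/2) * this

theorem rel_link {m : ℕ} {P Q : Mat m} (hP : R1 P) (hQ : R1 Q) (h : Link P Q) (l k : ℂ) :
    rel (l • P) (k • Q) ↔ l * k = 0 ∨ l * k = 1 := by
  unfold rel
  have e : l • P * k • Q + k • Q * l • P = (l * k) • (P + Q) := by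
    rw [← h, smul_mul_smul_comm, smul_mul_smul_comm, mul_comm k]; module
  have e2 : (P + Q) * (P + Q) = (2:ℂ) • (P + Q) := by
    unfold Link at h
    simp only [Matrix.mul_add, Matrix.add_mul, hP.idem, hQ.idem]
    linear_combination (norm := module) h
  rw [e, smul_mul_smul_comm, e2]
  constructor
  · intro h1
    have := congrArg trace h1
    simp only [trace_smul, trace_add, hP.tr, hQ.tr, smul_eq_mul] at this
    have h3 : (l * k) * (l * k - 1) = 0 := by linear_combination (1/4) * this
    rcases mul_eq_zero.1 h3 with h | h
    · left; exact h
    · right; exact sub_eq_zero.1 h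
  · rintro (h | h) <;> rw [h] <;> simp

theorem link_range {m : ℕ} {x f g : Fin m → ℂ} (h1 : f ⬝ᵥ x = 1) (h2 : g ⬝ᵥ x = 1) :
    Link (vecMulVec x f) (vecMulVec x g) := by
  unfold Link; rw [vecMulVec_mul_vecMulVec, vecMulVec_mul_vecMulVec, h1, h2, one_smul, one_smul, add_comm]

theorem link_ker {m : ℕ} {x y f : Fin m → ℂ} (h1 : f ⬝ᵥ x = 1) (h2 : f ⬝ᵥ y = 1) :
    Link (vecMulVec x f) (vecMulVec y f) := by
  unfold Link; rw [vecMulVec_mul_vecMulVec, vecMulVec_mul_vecMulVec, h1, h2, one_smul]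

theorem link_conn {m : ℕ} (r : Mat m → Mat m → Prop) (hs : ∀ P Q, r P Q → r Q P)
    (ht : ∀ P Q R, r P Q → r Q R → r P R) (hl : ∀ P Q, R1 P → R1 Q → Link P Q → r P Q)
    {P Q : Mat m} (hP : R1 P) (hQ : R1 Q) : r P Q := by
  have key : ∀ x f y g : Fin m → ℂ, f ⬝ᵥ x = 1 → g ⬝ᵥ y = 1 → g ⬝ᵥ x ≠ 0 → 
      r (vecMulVec x f) (vecMulVec y g) := by
    intro x f y g h1 h2 h3
    have e : vecMulVec y g = vecMulVec ((g ⬝ᵥ x) • y) ((g ⬝ᵥ x)⁻¹ • g) := by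
      rw [vmv_smul, smul_vecMulVec, smul_smul, inv_mul_cancel₀ h3, one_smul]
    have e1 : ((g ⬝ᵥ x)⁻¹ • g) ⬝ᵥ x = 1 := by
      rw [smul_dotProduct, smul_eq_mul, inv_mul_cancel₀ h3]
    have e2 : ((g ⬝ᵥ x)⁻¹ • g) ⬝ᵥ ((g ⬝ᵥ x) • y) = 1 := by
      rw [smul_dotProduct, dotProduct_smul, smul_eq_mul, smul_eq_mul, h2, mul_one, inv_mul_cancel₀ h3]
    rw [e]
    refine ht _ (vecMulVec x ((g ⬝ᵥ x)⁻¹ • g)) _ ?_ ?_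
    · exact hl _ _ ⟨_, _, h1, rfl⟩ ⟨_, _, e1, rfl⟩ (link_range h1 e1)
    · exact hl _ _ ⟨_, _, e1, rfl⟩ ⟨_, _, e2, rfl⟩ (link_ker e1 e2)
  obtain ⟨x, f, hfx, rfl⟩ := hP
  obtain ⟨y, g, hgy, rfl⟩ := hQ
  by_cases h1 : g ⬝ᵥ x = 0
  · by_cases h2 : f ⬝ᵥ y = 0
    · have h3 : f ⬝ᵥ (x + y) = 1 := by rw [dotProduct_add, hfx, h2, add_zero]
      refine ht _ (vecMulVec (x + y) f) _ ?_ ?_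
      · exact hl _ _ ⟨_, _, hfx, rfl⟩ ⟨_, _, h3, rfl⟩ (link_ker hfx h3)
      · exact key _ _ _ _ h3 hgy (by rw [dotProduct_add, hgy, h1]; simp)
    · exact hs _ _ (key _ _ _ _ hgy hfx h2)
  · exact key _ _ _ _ hfx hgy h1

theorem Nm.sc {n : ℕ} (hn : 3 ≤ n) {ψ : Mat n → Mat n} (H : Nm ψ) {P : Mat n} (hP : _root_.R1 P) (l : ℂ) :
    ψ (l • P) = trace (ψ (l • P)) • ψ P := by
  have h := (H.corner (A := l • P) (H.good1 hn hP)).1 (by simp [le', hP.idem])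
  have := (H.R1.1 hP).sand (ψ (l • P))
  rw [h.2, h.1] at this
  exact this

theorem Nm.mu_aux {n : ℕ} (hn : 3 ≤ n) {ψ : Mat n → Mat n} (H : Nm ψ) {P Q : Mat n} (hP : _root_.R1 P)
    (hQ : _root_.R1 Q) (hl : Link P Q) (l k : ℂ) : (l * k = 0 ∨ l * k = 1) ↔ 
      (trace (ψ (l • P)) * trace (ψ (k • Q)) = 0 ∨ trace (ψ (l • P)) * trace (ψ (k • Q)) = 1) := by
  rw [← rel_link hP hQ hl, H.hr, H.sc hn hP l, H.sc hn hQ k, 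
    rel_link (H.R1.1 hP) (H.R1.1 hQ) ((H.link hn hP hQ).1 hl)]
  rw [trace_smul, trace_smul, (H.R1.1 hP).tr, (H.R1.1 hQ).tr, smul_eq_mul, smul_eq_mul, mul_one, mul_one]

theorem Nm.mu_ne {n : ℕ} (hn : 3 ≤ n) {ψ : Mat n → Mat n} (H : Nm ψ) {P : Mat n} (hP : _root_.R1 P)
    {l : ℂ} (hl : l ≠ 0) : trace (ψ (l • P)) ≠ 0 := by
  intro h
  have := H.sc hn hP l
  rw [h, zero_smul, ← H.zero] at this
  exact (smul_ne_zero hl hP.ne) (H.inj this)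

theorem Nm.mu_indep {n : ℕ} (hn : 3 ≤ n) {ψ : Mat n → Mat n} (H : Nm ψ) {P Q : Mat n} (hP : _root_.R1 P)
    (hQ : _root_.R1 Q) : ∀ l : ℂ, trace (ψ (l • P)) = trace (ψ (l • Q)) := by
  refine link_conn (fun P Q => ∀ l : ℂ, trace (ψ (l • P)) = trace (ψ (l • Q))) 
    (fun P Q h l => (h l).symm) (fun P Q R h1 h2 l => (h1 l).trans (h2 l)) ?_ hP hQ
  intro P Q hP hQ hl l
  by_cases h0 : l = 0
  · rw [h0, zero_smul, zero_smul]
  have h0' := inv_ne_zero h0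
  have h1 := ((H.mu_aux hn hP hP (link_self hP) l l⁻¹).1 (by right; rw [mul_inv_cancel₀ h0])).resolve_left 
    (mul_ne_zero (H.mu_ne hn hP h0) (H.mu_ne hn hP h0'))
  have h2 := ((H.mu_aux hn hQ hP hl.symm l l⁻¹).1 (by right; rw [mul_inv_cancel₀ h0])).resolve_left 
    (mul_ne_zero (H.mu_ne hn hQ h0) (H.mu_ne hn hP h0'))
  exact mul_right_cancel₀ (H.mu_ne hn hP h0') (h1.trans h2.symm)

structure Cm {n : ℕ} (ψ : Mat n → Mat n) (μ : ℂ → ℂ) : Prop where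
  H : Nm ψ
  hn : 3 ≤ n
  mu : ∀ P, R1 P → ∀ l : ℂ, ψ (l • P) = μ l • ψ P

theorem R1_std {n : ℕ} (hn : 0 < n) : ∃ P : Mat n, R1 P :=
  ⟨_, Pi.single ⟨0, hn⟩ 1, Pi.single ⟨0, hn⟩ 1, by simp, rfl⟩

theorem Nm.cm {n : ℕ} (hn : 3 ≤ n) {ψ : Mat n → Mat n} (H : Nm ψ) : ∃ μ, Cm ψ μ := by
  obtain ⟨P0, hP0⟩ := R1_std (n := n) (by omega)
  refine ⟨fun l => trace (ψ (l • P0)), H, hn, ?_⟩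
  intro P hP l
  rw [H.sc hn hP, H.mu_indep hn hP hP0]

theorem Cm.trmu {n : ℕ} {ψ : Mat n → Mat n} {μ : ℂ → ℂ} (C : Cm ψ μ) {P : Mat n} (hP : R1 P) (l : ℂ) :
    trace (ψ (l • P)) = μ l := by
  rw [C.mu P hP, trace_smul, (C.H.R1.1 hP).tr, smul_eq_mul, mul_one]

theorem Cm.mul {n : ℕ} {ψ : Mat n → Mat n} {μ : ℂ → ℂ} (C : Cm ψ μ) (l k : ℂ) : 
    (l * k = 0 ∨ l * k = 1) ↔ (μ l * μ k = 0 ∨ μ l * μ k = 1) := by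
  obtain ⟨P, hP⟩ := R1_std (n := n) (by have := C.hn; omega)
  rw [← C.trmu hP, ← C.trmu hP]
  exact C.H.mu_aux C.hn hP hP (link_self hP) l k

theorem Cm.ne {n : ℕ} {ψ : Mat n → Mat n} {μ : ℂ → ℂ} (C : Cm ψ μ) {l : ℂ} (h : l ≠ 0) : μ l ≠ 0 := by
  obtain ⟨P, hP⟩ := R1_std (n := n) (by have := C.hn; omega)
  rw [← C.trmu hP]
  exact C.H.mu_ne C.hn hP h

theorem Cm.zero {n : ℕ} {ψ : Mat n → Mat n} {μ : ℂ → ℂ} (C : Cm ψ μ) : μ 0 = 0 := by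
  obtain ⟨P, hP⟩ := R1_std (n := n) (by have := C.hn; omega)
  rw [← C.trmu hP, zero_smul, C.H.zero, trace_zero]

theorem Cm.one {n : ℕ} {ψ : Mat n → Mat n} {μ : ℂ → ℂ} (C : Cm ψ μ) : μ 1 = 1 := by
  obtain ⟨P, hP⟩ := R1_std (n := n) (by have := C.hn; omega)
  rw [← C.trmu hP, one_smul, (C.H.R1.1 hP).tr]

theorem Cm.negone {n : ℕ} {ψ : Mat n → Mat n} {μ : ℂ → ℂ} (C : Cm ψ μ) : μ (-1) = -1 := by
  obtain ⟨P, hP⟩ := R1_std (n := n) (by have := C.hn; omega)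
  rw [← C.trmu hP, neg_smul, one_smul, C.H.negR1 C.hn hP, trace_neg, (C.H.R1.1 hP).tr]

theorem Cm.inv {n : ℕ} {ψ : Mat n → Mat n} {μ : ℂ → ℂ} (C : Cm ψ μ) (l : ℂ) : μ l⁻¹ = (μ l)⁻¹ := by
  by_cases h : l = 0
  · rw [h, _root_.inv_zero, C.zero, _root_.inv_zero]
  have h1 := ((C.mul l l⁻¹).1 (by right; rw [mul_inv_cancel₀ h])).resolve_left 
    (mul_ne_zero (C.ne h) (C.ne (inv_ne_zero h)))
  exact (inv_eq_of_mul_eq_one_right h1).symm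

theorem Cm.eq_one {n : ℕ} {ψ : Mat n → Mat n} {μ : ℂ → ℂ} (C : Cm ψ μ) {l : ℂ} (h : μ l = 1) : l = 1 := by
  have := (C.mul l 1).2 (by right; rw [h, C.one, one_mul])
  rw [mul_one] at this
  rcases this with h1 | h1
  · rw [h1, C.zero] at h; norm_num at h
  · exact h1

theorem Cm.eq_negone {n : ℕ} {ψ : Mat n → Mat n} {μ : ℂ → ℂ} (C : Cm ψ μ) {l : ℂ} (h : μ l = -1) : l = -1 := by
  have := (C.mul l (-1)).2 (by right; rw [h, C.negone]; norm_num)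
  rw [mul_neg_one] at this
  rcases this with h1 | h1
  · rw [neg_eq_zero.1 h1, C.zero] at h; norm_num at h
  · rw [← h1, neg_neg]

theorem offdiag {n : ℕ} {A P Q : Mat n} (hP : R1 P) (hQ : R1 Q) (ho : Orth P Q) {c : ℂ} (hc : c ≠ 0)
    (h : ∀ R, R1 R → Link P R → le' R (P + Q) → rel A (c • R)) : P * A * Q = 0 ∧ Q * A * P = 0 := by
  have hPl : le' P (P + Q) := by
    constructor <;> simp [Matrix.mul_add, Matrix.add_mul, ho.1, ho.2, hP.idem]
  have h0 := h P hP (link_self hP) hPl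
  obtain ⟨x, f, hfx, rfl⟩ := hP
  obtain ⟨y, g, hgy, rfl⟩ := hQ
  have hg0 : g ≠ 0 := by rintro rfl; simp at hgy
  have hy0 : y ≠ 0 := by rintro rfl; simp at hgy
  have hf0 : f ≠ 0 := by rintro rfl; simp at hfx
  have hx0 : x ≠ 0 := by rintro rfl; simp at hfx
  have vz : ∀ (s : ℂ) (u v : Fin n → ℂ), u ≠ 0 → v ≠ 0 → s • vecMulVec u v = 0 → s = 0 := by
    intro s u v hu hv hh
    obtain ⟨i, hi⟩ := Function.ne_iff.1 hu
    obtain ⟨j, hj⟩ := Function.ne_iff.1 hv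
    have := congrFun (congrFun hh i) j
    rw [Matrix.smul_apply, vecMulVec_apply] at this
    exact (smul_eq_zero.1 this).resolve_right (mul_ne_zero hi hj)
  have hfy : f ⬝ᵥ y = 0 := by
    have := ho.1
    rw [vecMulVec_mul_vecMulVec, vmv_smul] at this
    exact vz _ _ _ hx0 hg0 this
  have hgx : g ⬝ᵥ x = 0 := by
    have := ho.2
    rw [vecMulVec_mul_vecMulVec, vmv_smul] at this
    exact vz _ _ _ hy0 hf0 this
  have key1 : f ⬝ᵥ (A *ᵥ y) = 0 := by
    have hr : ∀ t : ℂ, rel A (c • vecMulVec (x + t • y) f) := by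
      intro t
      have h1 : f ⬝ᵥ (x + t • y) = 1 := by simp [dotProduct_add, hfx, hfy]
      apply h _ ⟨_, _, h1, rfl⟩ (link_ker hfx h1)
      constructor
      · simp [Matrix.mul_add, vecMulVec_mul_vecMulVec, hfx, hfy]
      · simp only [Matrix.add_mul, vecMulVec_mul_vecMulVec, dotProduct_add, dotProduct_smul, hfx, hfy, hgx, hgy, vmv_smul]
        simp [add_vecMulVec, smul_vecMulVec]
    have := trace_of_sq (rel_lin (A := A) (X := c • vecMulVec x f) (Y := c • vecMulVec y f) h0
      (by simpa [add_vecMulVec] using hr 1) (by simpa [add_vecMulVec, sub_eq_add_neg] using hr (-1)))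
    rw [Matrix.mul_smul, trace_smul, mul_vecMulVec, trace_vecMulVec, dotProduct_comm] at this
    exact (smul_eq_zero.1 this).resolve_left hc
  have key2 : g ⬝ᵥ (A *ᵥ x) = 0 := by
    have hr : ∀ t : ℂ, rel A (c • vecMulVec x (f + t • g)) := by
      intro t
      have h1 : (f + t • g) ⬝ᵥ x = 1 := by simp [add_dotProduct, hfx, hgx]
      apply h _ ⟨_, _, h1, rfl⟩ (link_range hfx h1)
      constructor
      · simp only [Matrix.mul_add, vecMulVec_mul_vecMulVec, add_dotProduct, smul_dotProduct, hfx, hfy, hgx, hgy, vmv_smul]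
        simp [vecMulVec_add, vmv_smul]
      · simp [Matrix.add_mul, vecMulVec_mul_vecMulVec, hfx, hgx]
    have := trace_of_sq (rel_lin (A := A) (X := c • vecMulVec x f) (Y := c • vecMulVec x g) h0
      (by simpa [vecMulVec_add] using hr 1) (by simpa [vecMulVec_add, sub_eq_add_neg] using hr (-1)))
    rw [Matrix.mul_smul, trace_smul, mul_vecMulVec, trace_vecMulVec, dotProduct_comm] at this
    exact (smul_eq_zero.1 this).resolve_left hc
  constructor
  · rw [Matrix.mul_assoc, mul_vecMulVec, vecMulVec_mul_vecMulVec, key1, zero_smul, vecMulVec_zero]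
  · rw [Matrix.mul_assoc, mul_vecMulVec, vecMulVec_mul_vecMulVec, key2, zero_smul, vecMulVec_zero]

theorem rel_diag_link {n : ℕ} {P Q R : Mat n} (hP : R1 P) (hR : R1 R)
    (hl : Link P R) (hle : le' R (P + Q)) {l v : ℂ} (hl0 : l ≠ 0) :
    rel (l • P + v • Q) (l⁻¹ • R) := by
  have h1 : Q * R + R * Q = R - P := by
    have a := hle.1
    have b := hle.2
    rw [Matrix.mul_add] at a
    rw [Matrix.add_mul] at b
    unfold Link at hl
    linear_combination (norm := module) a + b - hl
  have e : (l • P + v • Q) * l⁻¹ • R + l⁻¹ • R * (l • P + v • Q) = (1 + v / l) • R + (1 - v / l) • P := by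
    have : (l • P + v • Q) * l⁻¹ • R + l⁻¹ • R * (l • P + v • Q) = (l * l⁻¹) • (P * R + R * P) + (v * l⁻¹) • (Q * R + R * Q) := by
      simp only [Matrix.add_mul, Matrix.mul_add, smul_mul_smul_comm, mul_comm l⁻¹]; module
    rw [this, h1, hl, mul_inv_cancel₀ hl0, ← div_eq_mul_inv]; module
  unfold rel
  rw [e]
  generalize v / l = r
  have e2 : ((1 + r) • R + (1 - r) • P) * ((1 + r) • R + (1 - r) • P) = 
     ((1 + r) * (1 + r)) • R + ((1 - r) * (1 - r)) • P + ((1 + r) * (1 - r)) • (P * R + R * P) := by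
    simp only [Matrix.add_mul, Matrix.mul_add, smul_mul_smul_comm, hP.idem, hR.idem]; module
  rw [e2, hl]; module

theorem Cm.diag_half {n : ℕ} {ψ : Mat n → Mat n} {μ : ℂ → ℂ} (C : Cm ψ μ) {P Q : Mat n} (hP : R1 P) 
    (hQ : R1 Q) (ho : Orth P Q) {l v : ℂ} (hl : l ≠ 0) : 
    ψ P * ψ (l • P + v • Q) * ψ Q = 0 ∧ ψ Q * ψ (l • P + v • Q) * ψ P = 0 ∧ 
      ψ P * ψ (l • P + v • Q) * ψ P = μ l • ψ P := by
  have hP' := C.H.R1.1 hP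
  have hQ' := C.H.R1.1 hQ
  have ho' := (C.H.anti (C.H.good1 C.hn hQ)).1 ho
  have hS := C.H.goodadd C.hn hP hQ ho
  have key : ∀ R, R1 R → Link (ψ P) R → le' R (ψ P + ψ Q) → rel (ψ (l • P + v • Q)) (μ l⁻¹ • R) := by
    intro R hR hlR hle
    obtain ⟨R0, hR0, rfl⟩ := C.H.pre hR.idem
    have hR0' := C.H.R1.2 hR
    rw [← C.mu R0 hR0', ← C.H.hr]
    apply rel_diag_link hP hR0' ((C.H.link C.hn hP hR0').2 hlR) _ hl
    rw [C.H.corner hS, C.H.addR C.hn hP hQ ho]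
    exact hle
  have hc := C.ne (inv_ne_zero hl)
  obtain ⟨h1, h2⟩ := offdiag hP' hQ' ho' hc key
  refine ⟨h1, h2, ?_⟩
  set A := ψ (l • P + v • Q) with hA
  have hle : le' A (ψ P + ψ Q) := by
    rw [← C.H.addR C.hn hP hQ ho, hA, ← C.H.corner hS]
    constructor <;> simp [Matrix.add_mul, Matrix.mul_add, hP.idem, hQ.idem, ho.1, ho.2]
  have hAP : A * ψ P = ψ P * A * ψ P := by
    nth_rw 1 [← hle.2]
    rw [Matrix.add_mul, Matrix.add_mul, h2, add_zero]
  have hPA : ψ P * A = ψ P * A * ψ P := by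
    nth_rw 1 [← hle.1]
    rw [Matrix.mul_add, Matrix.mul_add, ← Matrix.mul_assoc, ← Matrix.mul_assoc, h1, add_zero]
  have hs := hP'.sand A
  set a := trace (ψ P * A) with ha
  rw [hs] at hAP hPA ⊢
  have hr := key (ψ P) hP' (link_self hP') (by
    constructor <;> simp [Matrix.mul_add, Matrix.add_mul, ho'.1, ho'.2, hP'.idem])
  have ha0 : a ≠ 0 := by
    intro h0
    rw [h0, zero_smul] at hAP hPA
    have : Orth (l • P + v • Q) P := (C.H.anti (C.H.good1 C.hn hP)).2 ⟨hAP, hPA⟩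
    have := this.1
    simp only [Matrix.add_mul, Matrix.smul_mul, hP.idem, ho.2, smul_zero, add_zero] at this
    exact (smul_ne_zero hl hP.ne) this
  have h3 : a * μ l⁻¹ = 1 := by
    unfold rel at hr
    rw [Matrix.mul_smul, Matrix.smul_mul, hAP, hPA] at hr
    have := congrArg trace hr
    simp only [smul_smul, ← add_smul, smul_mul_smul_comm, hP'.idem, trace_smul, hP'.tr, smul_eq_mul] at this
    have h4 : (μ l⁻¹ * a) * (a * μ l⁻¹ - 1) = 0 := by linear_combination (1/4) * this
    exact sub_eq_zero.1 ((mul_eq_zero.1 h4).resolve_left (mul_ne_zero hc ha0))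
  rw [C.inv] at h3
  rw [eq_of_mul_inv_eq_one h3]

theorem Cm.diag {n : ℕ} {ψ : Mat n → Mat n} {μ : ℂ → ℂ} (C : Cm ψ μ) {P Q : Mat n} (hP : R1 P) 
    (hQ : R1 Q) (ho : Orth P Q) (l v : ℂ) : ψ (l • P + v • Q) = μ l • ψ P + μ v • ψ Q := by
  by_cases hl : l = 0
  · rw [hl, zero_smul, zero_add, C.zero, zero_smul, zero_add, C.mu Q hQ]
  by_cases hv : v = 0
  · rw [hv, zero_smul, add_zero, C.zero, zero_smul, add_zero, C.mu P hP]
  obtain ⟨h1, h2, h3⟩ := C.diag_half hP hQ ho (v := v) hl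
  obtain ⟨-, -, h4⟩ := C.diag_half hQ hP ho.symm (v := l) hv
  rw [add_comm (v • Q)] at h4
  have hle : le' (ψ (l • P + v • Q)) (ψ P + ψ Q) := by
    rw [← C.H.addR C.hn hP hQ ho, ← C.H.corner (C.H.goodadd C.hn hP hQ ho)]
    constructor <;> simp [Matrix.add_mul, Matrix.mul_add, hP.idem, hQ.idem, ho.1, ho.2]
  rw [← h3, ← h4]
  generalize ψ (l • P + v • Q) = A at *
  nth_rw 1 [← hle.1]
  nth_rw 1 [← hle.2]
  simp only [Matrix.add_mul, Matrix.mul_add, h1, h2]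
  abel


structure Fr {n : ℕ} (P1 P2 P Q : Mat n) : Prop where
  h1 : R1 P1
  h2 : R1 P2
  hp : R1 P
  hq : R1 Q
  o1 : Orth P1 P2
  o2 : Orth P Q
  s : P1 + P2 = P + Q

theorem Fr.symm {n : ℕ} {P1 P2 P Q : Mat n} (F : Fr P1 P2 P Q) : Fr P2 P1 Q P :=
  ⟨F.h2, F.h1, F.hq, F.hp, F.o1.symm, F.o2.symm, by rw [add_comm, F.s, add_comm]⟩

theorem Fr.swap {n : ℕ} {P1 P2 P Q : Mat n} (F : Fr P1 P2 P Q) : Fr P1 P2 Q P :=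
  ⟨F.h1, F.h2, F.hq, F.hp, F.o1, F.o2.symm, by rw [F.s, add_comm]⟩

theorem Fr.aux {n : ℕ} {P1 P2 P Q : Mat n} (F : Fr P1 P2 P Q) : 
    (P1 * (P1 + P2) = P1 ∧ (P1 + P2) * P1 = P1) ∧ (P * (P1 + P2) = P ∧ (P1 + P2) * P = P) ∧ 
    (P1 + P2) * (P1 + P2) = P1 + P2 := by
  refine ⟨⟨?_, ?_⟩, ⟨?_, ?_⟩, idem_add2 F.h1.idem F.h2.idem F.o1⟩
  · rw [Matrix.mul_add, F.h1.idem, F.o1.1, add_zero]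
  · rw [Matrix.add_mul, F.h1.idem, F.o1.2, add_zero]
  · rw [F.s, Matrix.mul_add, F.hp.idem, F.o2.1, add_zero]
  · rw [F.s, Matrix.add_mul, F.hp.idem, F.o2.2, add_zero]

theorem Fr.tr1 {n : ℕ} {P1 P2 P Q : Mat n} (F : Fr P1 P2 P Q) : trace (P1 * Q) = 1 - trace (P1 * P) := by
  have h := F.aux.1.1
  rw [F.s, Matrix.mul_add] at h
  have := congrArg trace h
  rw [trace_add, F.h1.tr] at this
  linear_combination this

theorem Fr.tr2 {n : ℕ} {P1 P2 P Q : Mat n} (F : Fr P1 P2 P Q) : trace (P2 * P) = 1 - trace (P1 * P) := by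
  have h := F.aux.2.1.2
  rw [Matrix.add_mul] at h
  have := congrArg trace h
  rw [trace_add, F.hp.tr] at this
  linear_combination this

theorem Fr.jord {n : ℕ} {P1 P2 P Q : Mat n} (F : Fr P1 P2 P Q) :
    P1 * P + P * P1 = P1 + P + (trace (P1 * P) - 1) • (P1 + P2) := by
  obtain ⟨⟨a1, a2⟩, ⟨b1, b2⟩, c⟩ := F.aux
  have hq : trace (P2 * Q) = trace (P1 * P) := by
    linear_combination F.symm.tr2 - F.tr1
  obtain ⟨D, hD⟩ : ∃ D, D = P1 + P - (P1 * P + P * P1) := ⟨_, rfl⟩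
  have hD2 : D = P2 + Q - (P2 * Q + Q * P2) := by
    have e1 : D = (P1 - P) * (P1 - P) := by
      rw [hD]; simp only [Matrix.mul_sub, Matrix.sub_mul, F.h1.idem, F.hp.idem]; abel
    have e2 : P1 - P = Q - P2 := by linear_combination (norm := module) F.s
    rw [e1, e2]; simp only [Matrix.mul_sub, Matrix.sub_mul, F.h2.idem, F.hq.idem]; abel
  have hS : D = D * P1 + D * P2 := by
    rw [← Matrix.mul_add, hD]
    simp only [Matrix.sub_mul, Matrix.add_mul P1, Matrix.add_mul (P1 * P), Matrix.mul_assoc, a1, b1]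
  have d1 : D * P1 = (1 - trace (P1 * P)) • P1 := by
    have := F.h1.sand P
    rw [hD]; simp only [Matrix.sub_mul, Matrix.add_mul, this, F.h1.idem, Matrix.mul_assoc P P1 P1]; module
  have d2 : D * P2 = (1 - trace (P1 * P)) • P2 := by
    have := F.h2.sand Q
    rw [hD2]; simp only [Matrix.sub_mul, Matrix.add_mul, this, F.h2.idem, Matrix.mul_assoc Q P2 P2, hq]; module
  rw [d1, d2] at hS
  rw [hS] at hD
  linear_combination (norm := module) hD

theorem Fr.rel {n : ℕ} {P1 P2 P Q : Mat n} (F : Fr P1 P2 P Q) (a b β : ℂ) :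
    rel (a • P1 + b • P2) (β • P + (-β) • Q) ↔ 
      (((a + b) * β) ^ 2 + ((a - b) * β * (2 * trace (P1 * P) - 1)) ^ 2 = 2 * ((a - b) * β * (2 * trace (P1 * P) - 1)) ∧
      ((a + b) * β) * ((a - b) * β * (2 * trace (P1 * P) - 1)) = (a + b) * β) := by
  obtain ⟨⟨a1, a2⟩, ⟨b1, b2⟩, c⟩ := F.aux
  have hJ := F.jord
  have htr : trace (P1 + P2) = 2 := by rw [trace_add, F.h1.tr, F.h2.tr]; norm_num
  have hpt := F.hp.tr
  have hpi := F.hp.idem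
  have e1 : a • P1 + b • P2 = (a - b) • P1 + b • (P1 + P2) := by module
  have e2 : β • P + (-β) • Q = β • ((2:ℂ) • P - (P1 + P2)) := by
    rw [F.s]; module
  rw [e1, e2]
  generalize trace (P1 * P) = p at *
  generalize P1 + P2 = S at *
  have hK : ((2:ℂ) • P - S) * ((2:ℂ) • P - S) = S := by
    simp only [Matrix.mul_sub, Matrix.sub_mul, smul_mul_smul_comm, Matrix.mul_smul, Matrix.smul_mul, hpi, b1, b2, c]; module
  have hKS : ((2:ℂ) • P - S) * S = ((2:ℂ) • P - S) := by
    simp only [Matrix.sub_mul, Matrix.smul_mul, b1, c]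
  have hSK : S * ((2:ℂ) • P - S) = ((2:ℂ) • P - S) := by
    simp only [Matrix.mul_sub, Matrix.mul_smul, b2, c]
  have hJ2 : P1 * ((2:ℂ) • P - S) + ((2:ℂ) • P - S) * P1 = ((2:ℂ) • P - S) + (2 * p - 1) • S := by
    simp only [Matrix.mul_sub, Matrix.sub_mul, Matrix.mul_smul, Matrix.smul_mul, a1, a2]
    linear_combination (norm := module) (2:ℂ) • hJ
  have htK : trace ((2:ℂ) • P - S) = 0 := by
    rw [trace_sub, trace_smul, htr, hpt]; simp
  generalize (2:ℂ) • P - S = K at *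
  have hM : ((a - b) • P1 + b • S) * β • K + β • K * ((a - b) • P1 + b • S) = 
      ((a + b) * β) • K + ((a - b) * β * (2 * p - 1)) • S := by
    simp only [Matrix.add_mul, Matrix.mul_add, smul_mul_smul_comm, hSK, hKS]
    linear_combination (norm := module) ((a - b) * β) • hJ2
  unfold _root_.rel
  rw [hM]
  generalize (a + b) * β = u
  generalize (a - b) * β * (2 * p - 1) = w
  have hM2 : (u • K + w • S) * (u • K + w • S) = (u ^ 2 + w ^ 2) • S + (2 * (u * w)) • K := by
    simp only [Matrix.add_mul, Matrix.mul_add, smul_mul_smul_comm, hSK, hKS, c, hK]; module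
  rw [hM2]
  constructor
  · intro h
    have t1 := congrArg trace h
    have t2 := congrArg (fun X => trace (X * K)) h
    simp only [Matrix.add_mul, Matrix.smul_mul, trace_add, trace_smul, hSK, hK, htr, htK, smul_eq_mul] at t1 t2
    constructor
    · linear_combination (1/2) * t1
    · linear_combination (1/4) * t2
  · rintro ⟨h1, h2⟩
    rw [h1, h2]; module

theorem frame_complete {n : ℕ} {P1 P : Mat n} (h1 : R1 P1) (hp : R1 P) (h : trace (P1 * P) ≠ 1) :
    ∃ P2 Q, Fr P1 P2 P Q := by
  obtain ⟨x, f, hfx, rfl⟩ := h1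
  obtain ⟨y, g, hgy, rfl⟩ := hp
  obtain ⟨a, ha⟩ : ∃ a, a = f ⬝ᵥ y := ⟨_, rfl⟩
  obtain ⟨b, hb⟩ : ∃ b, b = g ⬝ᵥ x := ⟨_, rfl⟩
  have hd : 1 - a * b ≠ 0 := by
    rw [vecMulVec_mul_vecMulVec, trace_vecMulVec, dotProduct_smul, dotProduct_comm x, ← ha, ← hb, smul_eq_mul] at h
    exact sub_ne_zero.2 (Ne.symm h)
  refine ⟨vecMulVec (y - a • x) ((1 - a * b)⁻¹ • (g - b • f)), 
    vecMulVec (x - b • y) ((1 - a * b)⁻¹ • (f - a • g)), ⟨_, _, hfx, rfl⟩, ⟨_, _, ?_, rfl⟩, ⟨_, _, hgy, rfl⟩, 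
    ⟨_, _, ?_, rfl⟩, ⟨?_, ?_⟩, ⟨?_, ?_⟩, ?_⟩
  · simp only [smul_dotProduct, sub_dotProduct, dotProduct_sub, dotProduct_smul, smul_eq_mul, hfx, hgy, ← ha, ← hb]
    field_simp; ring
  · simp only [smul_dotProduct, sub_dotProduct, dotProduct_sub, dotProduct_smul, smul_eq_mul, hfx, hgy, ← ha, ← hb]
    field_simp; ring
  · rw [vecMulVec_mul_vecMulVec]
    simp [dotProduct_sub, hfx, ← ha]
  · rw [vecMulVec_mul_vecMulVec]
    simp [sub_dotProduct, hfx, ← hb]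
  · rw [vecMulVec_mul_vecMulVec]
    simp [dotProduct_sub, hgy, ← hb]
  · rw [vecMulVec_mul_vecMulVec]
    simp [sub_dotProduct, hgy, ← ha]
  · ext i j
    simp only [Matrix.add_apply, vecMulVec_apply, Pi.sub_apply, Pi.smul_apply, smul_eq_mul]
    field_simp; ring

theorem tr_pair {n : ℕ} (hn : 3 ≤ n) (p : ℂ) : ∃ P Q : Mat n, R1 P ∧ R1 Q ∧ trace (P * Q) = p := by
  obtain ⟨i, j, hij⟩ : ∃ i j : Fin n, i ≠ j := ⟨⟨0, by omega⟩, ⟨1, by omega⟩, by simp⟩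
  have e1 : (Pi.single i 1 : Fin n → ℂ) ⬝ᵥ Pi.single i 1 = 1 := by simp
  have e2 : (Pi.single i p + Pi.single j (1 - p) : Fin n → ℂ) ⬝ᵥ (Pi.single i 1 + Pi.single j 1) = 1 := by
    simp [hij, hij.symm]
  refine ⟨_, _, ⟨_, _, e1, rfl⟩, ⟨_, _, e2, rfl⟩, ?_⟩
  rw [vecMulVec_mul_vecMulVec, trace_vecMulVec]
  simp [hij, hij.symm]

theorem exists_frame {n : ℕ} (hn : 3 ≤ n) {p : ℂ} (hp : p ≠ 1) : ∃ P1 P2 P Q : Mat n, Fr P1 P2 P Q ∧ trace (P1 * P) = p := by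
  obtain ⟨P1, P, h1, h2, h3⟩ := tr_pair hn p
  obtain ⟨P2, Q, h⟩ := frame_complete h1 h2 (by rw [h3]; exact hp)
  exact ⟨P1, P2, P, Q, h, h3⟩

theorem Fr.map {n : ℕ} {ψ : Mat n → Mat n} {μ : ℂ → ℂ} (C : Cm ψ μ) {P1 P2 P Q : Mat n} (F : Fr P1 P2 P Q) :
    Fr (ψ P1) (ψ P2) (ψ P) (ψ Q) :=
  ⟨C.H.R1.1 F.h1, C.H.R1.1 F.h2, C.H.R1.1 F.hp, C.H.R1.1 F.hq, (C.H.anti (C.H.good1 C.hn F.h2)).1 F.o1,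
    (C.H.anti (C.H.good1 C.hn F.hq)).1 F.o2, by 
      rw [← C.H.addR C.hn F.h1 F.h2 F.o1, F.s, C.H.addR C.hn F.hp F.hq F.o2]⟩

theorem Cm.odd {n : ℕ} {ψ : Mat n → Mat n} {μ : ℂ → ℂ} (C : Cm ψ μ) (l : ℂ) : μ (-l) = - μ l := by
  obtain ⟨P1, P2, P, Q, F, hp⟩ := exists_frame C.hn (p := 1/2) (by norm_num)
  have key : ∀ P Q, Fr P1 P2 P Q → trace (P1 * P) = 1/2 → (μ l + μ (-l)) * ((μ l - μ (-l)) * (2 * trace (ψ P1 * ψ P) - 1)) = μ l + μ (-l) := by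
    intro P Q F hp
    have h := (F.rel l (-l) 1).2 (by rw [hp]; constructor <;> ring)
    rw [C.H.hr, C.diag F.h1 F.h2 F.o1, C.diag F.hp F.hq F.o2, C.one, C.negone, (F.map C).rel] at h
    have := h.2
    rw [mul_one, mul_one] at this
    exact this
  have k1 := key P Q F hp
  have k2 := key Q P F.swap (by rw [F.tr1, hp]; norm_num)
  rw [(F.map C).tr1] at k2
  linear_combination (-1/2) * k1 + (-1/2) * k2

theorem Cm.fr {n : ℕ} {ψ : Mat n → Mat n} {μ : ℂ → ℂ} (C : Cm ψ μ) {P1 P2 P Q : Mat n} (F : Fr P1 P2 P Q) (a b β : ℂ)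
    (h : ((a + b) * β) ^ 2 + ((a - b) * β * (2 * trace (P1 * P) - 1)) ^ 2 = 2 * ((a - b) * β * (2 * trace (P1 * P) - 1)) ∧
      ((a + b) * β) * ((a - b) * β * (2 * trace (P1 * P) - 1)) = (a + b) * β) :
    ((μ a + μ b) * μ β) ^ 2 + ((μ a - μ b) * μ β * (2 * trace (ψ P1 * ψ P) - 1)) ^ 2 = 2 * ((μ a - μ b) * μ β * (2 * trace (ψ P1 * ψ P) - 1)) ∧
      ((μ a + μ b) * μ β) * ((μ a - μ b) * μ β * (2 * trace (ψ P1 * ψ P) - 1)) = (μ a + μ b) * μ β := by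
  have h := (F.rel a b β).2 h
  rwa [C.H.hr, C.diag F.h1 F.h2 F.o1, C.diag F.hp F.hq F.o2, C.odd, (F.map C).rel] at h

theorem Cm.step {n : ℕ} {ψ : Mat n → Mat n} {μ : ℂ → ℂ} (C : Cm ψ μ) {P1 P2 P Q : Mat n} (F : Fr P1 P2 P Q) {ν : ℂ}
    (h1 : ν ≠ 1) (h2 : ν ≠ -1) (hp : trace (P1 * P) = (1 - ν)⁻¹) :
    (μ (1 + ν) = 1 + μ ν ∨ μ (1 + ν) = -(1 + μ ν)) ∧ 
      (1 - μ ν) * (2 * trace (ψ P1 * ψ P) - 1) = μ (1 + ν) := by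
  have hd : 1 - ν ≠ 0 := sub_ne_zero.2 (Ne.symm h1)
  have hs : 1 + ν ≠ 0 := by
    intro h; apply h2; linear_combination h
  have hs' := C.ne hs
  have e1 : (1 + ν) * (1 + ν)⁻¹ = 1 := mul_inv_cancel₀ hs
  have e2 : (1 - ν) * (1 + ν)⁻¹ * (2 * (1 - ν)⁻¹ - 1) = 1 := by field_simp; ring
  obtain ⟨k1, k2⟩ := C.fr F 1 ν (1 + ν)⁻¹ (by rw [hp, e1, e2]; norm_num)
  rw [C.one, C.inv] at k1 k2
  have hν : 1 + μ ν ≠ 0 := by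
    intro h
    apply h2
    exact C.eq_negone (by linear_combination h)
  have w1 : (1 - μ ν) * (μ (1 + ν))⁻¹ * (2 * trace (ψ P1 * ψ P) - 1) = 1 := by
    exact mul_left_cancel₀ (mul_ne_zero hν (inv_ne_zero hs')) (by rw [k2, mul_one])
  rw [w1] at k1
  constructor
  · have : (1 + μ ν) * (1 + μ ν) = μ (1 + ν) * μ (1 + ν) := by
      field_simp at k1; linear_combination k1
    rcases mul_self_eq_mul_self_iff.1 this with h | h
    · left; exact h.symm
    · right; rw [h, neg_neg]
  · field_simp at w1; linear_combination w1

theorem Cm.pm {n : ℕ} {ψ : Mat n → Mat n} {μ : ℂ → ℂ} (C : Cm ψ μ) {ν : ℂ}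
    (h1 : ν ≠ 1) (h2 : ν ≠ -1) (h0 : ν ≠ 0) :
    (μ (1 + ν) = 1 + μ ν ∨ μ (1 + ν) = -(1 + μ ν)) := by
  obtain ⟨P1, P2, P, Q, F, hp⟩ := exists_frame C.hn (p := (1 - ν)⁻¹) (by
    intro h; apply h0; rw [inv_eq_one] at h; linear_combination -h)
  exact (C.step F h1 h2 hp).1

theorem Cm.two {n : ℕ} {ψ : Mat n → Mat n} {μ : ℂ → ℂ} (C : Cm ψ μ) : μ 2 = 2 := by
  have := C.pm (ν := -2) (by norm_num) (by norm_num) (by norm_num)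
  rw [show (1:ℂ) + -2 = -1 by norm_num, C.odd, C.one, C.odd] at this
  rcases this with h | h
  · linear_combination h
  · exact absurd (show μ 2 = 0 by linear_combination -h) (C.ne (by norm_num))

theorem Cm.succ {n : ℕ} {ψ : Mat n → Mat n} {μ : ℂ → ℂ} (C : Cm ψ μ) (ν : ℂ) : μ (1 + ν) = 1 + μ ν := by
  by_cases h0 : ν = 0
  · rw [h0, add_zero, C.zero, C.one, add_zero]
  by_cases h1 : ν = 1
  · rw [h1, C.one, show (1:ℂ) + 1 = 2 by norm_num, C.two]
  by_cases h2 : ν = -1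
  · rw [h2, C.odd, C.one, show (1:ℂ) + -1 = 0 by norm_num, C.zero]
  by_cases h3 : ν = -2
  · rw [h3, show (1:ℂ) + -2 = -1 by norm_num, C.odd, C.one, C.odd, C.two]; norm_num
  rcases C.pm h1 h2 h0 with h | h
  · exact h
  · have := C.pm (ν := -1 - ν) (by intro h; apply h3; linear_combination -h) (by intro h; apply h0; linear_combination -h)
      (by intro h; apply h2; linear_combination -h)
    rw [show 1 + (-1 - ν) = -ν by ring, show -1 - ν = -(1 + ν) by ring, C.odd, C.odd, h] at this
    rcases this with h' | h'
    · exact absurd (C.eq_negone (show μ ν = -1 by linear_combination (-1/2) * h')) h2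
    · exfalso
      have : (2:ℂ) = 0 := by linear_combination h'
      norm_num at this

theorem Cm.trF {n : ℕ} {ψ : Mat n → Mat n} {μ : ℂ → ℂ} (C : Cm ψ μ) {P1 P2 P Q : Mat n} (F : Fr P1 P2 P Q)
    (h0 : trace (P1 * P) ≠ 0) (h1 : trace (P1 * P) ≠ 1) : trace (ψ P1 * ψ P) = μ (trace (P1 * P)) := by
  by_cases hh : trace (P1 * P) = 1/2
  · rw [hh, one_div, C.inv, C.two]
    have key : ∀ P Q, Fr P1 P2 P Q → trace (P1 * P) = 1/2 → (2 * (2 * trace (ψ P1 * ψ P) - 1)) * (2 * (2 * trace (ψ P1 * ψ P) - 1)) = 2 * (2 * (2 * trace (ψ P1 * ψ P) - 1)) := by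
      intro P Q F hp
      have h := C.fr F 1 (-1) 1 (by rw [hp]; constructor <;> ring)
      have := h.1
      rw [C.odd, C.one] at this
      linear_combination this
    have k1 := key P Q F hh
    have k2 := key Q P F.swap (by rw [F.tr1, hh]; norm_num)
    rw [(F.map C).tr1] at k2
    linear_combination (-1/16) * k1 + (1/16) * k2
  · obtain ⟨ν, hν⟩ : ∃ ν, ν = 1 - (trace (P1 * P))⁻¹ := ⟨_, rfl⟩
    have hn1 : ν ≠ 1 := by
      intro h; rw [h] at hν
      exact inv_ne_zero h0 (by linear_combination hν)
    have hn2 : ν ≠ -1 := by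
      intro h; rw [h] at hν
      apply hh
      rw [← inv_inv (trace (P1 * P)), show (trace (P1 * P))⁻¹ = 2 by linear_combination hν]; norm_num
    have e : trace (P1 * P) = (1 - ν)⁻¹ := by rw [hν]; simp
    have h := (C.step F hn1 hn2 e).2
    rw [C.succ] at h
    have e3 : μ (1 - ν) = 1 - μ ν := by rw [sub_eq_add_neg, C.succ, C.odd]; ring
    have e4 : 1 - μ ν ≠ 0 := by
      rw [← e3]; apply C.ne; exact sub_ne_zero.2 (Ne.symm hn1)
    rw [e, C.inv, e3]
    field_simp
    linear_combination (1/2) * h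

theorem Cm.tr_one {n : ℕ} {ψ : Mat n → Mat n} {μ : ℂ → ℂ} (C : Cm ψ μ) {P1 P : Mat n} (h1 : R1 P1) (h2 : R1 P)
    (h : trace (P1 * P) = 1) : trace (ψ P1 * ψ P) = 1 := by
  by_contra hne
  obtain ⟨P2', Q', F⟩ := frame_complete (C.H.R1.1 h1) (C.H.R1.1 h2) hne
  obtain ⟨P2, -, rfl⟩ := C.H.pre F.h2.idem
  obtain ⟨Q, -, rfl⟩ := C.H.pre F.hq.idem
  have hP2 := C.H.R1.2 F.h2
  have hQ := C.H.R1.2 F.hq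
  have o1 := (C.H.anti (C.H.good1 C.hn hP2)).2 F.o1
  have o2 := (C.H.anti (C.H.good1 C.hn hQ)).2 F.o2
  have F0 : Fr P1 P2 P Q := ⟨h1, hP2, h2, hQ, o1, o2, C.H.inj (by 
    rw [C.H.addR C.hn h1 hP2 o1, C.H.addR C.hn h2 hQ o2, F.s])⟩
  have hl : Link P1 P := by
    have := F0.jord
    rw [h, sub_self, zero_smul, add_zero] at this
    exact this
  exact hne (link_tr (C.H.R1.1 h1) (C.H.R1.1 h2) ((C.H.link C.hn h1 h2).1 hl))

theorem Cm.tr {n : ℕ} {ψ : Mat n → Mat n} {μ : ℂ → ℂ} (C : Cm ψ μ) {P1 P : Mat n} (h1 : R1 P1) (h2 : R1 P) :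
    trace (ψ P1 * ψ P) = μ (trace (P1 * P)) := by
  by_cases h : trace (P1 * P) = 1
  · rw [h, C.one, C.tr_one h1 h2 h]
  obtain ⟨P2, Q, F⟩ := frame_complete h1 h2 h
  by_cases h0 : trace (P1 * P) = 0
  · have := C.tr_one F.h2 h2 (by rw [F.tr2, h0, sub_zero])
    rw [(F.map C).tr2] at this
    rw [h0, C.zero]; linear_combination -this
  · exact C.trF F h0 h


theorem Cm.minj {n : ℕ} {ψ : Mat n → Mat n} {μ : ℂ → ℂ} (C : Cm ψ μ) {l k : ℂ} (h : μ l = μ k) : l = k := by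
  by_cases hk : k = 0
  · rw [hk, C.zero] at h
    by_contra hl
    rw [hk] at hl
    exact C.ne hl h
  have := (C.mul l k⁻¹).2 (by right; rw [h, C.inv, mul_inv_cancel₀ (C.ne hk)])
  rcases this with h1 | h1
  · rcases mul_eq_zero.1 h1 with h2 | h2
    · rw [h2, C.zero] at h; exact absurd h.symm (C.ne hk)
    · exact absurd h2 (inv_ne_zero hk)
  · exact eq_of_mul_inv_eq_one h1

theorem Cm.gen {n : ℕ} {ψ : Mat n → Mat n} {μ : ℂ → ℂ} (C : Cm ψ μ) {a b : ℂ} (ha : a ≠ 0) (hb : b ≠ 0) 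
    (h1 : a ≠ b) (h2 : a ≠ -b) : (μ (a + b) = μ a + μ b ∧ μ (a / b) * μ b = μ a) ∨ 
      (μ (a + b) = -(μ a + μ b) ∧ μ (a / b) * μ a = μ b) := by
  have hd : a - b ≠ 0 := sub_ne_zero.2 h1
  have hs : a + b ≠ 0 := fun h => h2 (by linear_combination h)
  obtain ⟨P1, P2, P, Q, F, hp⟩ := exists_frame C.hn (p := a / (a - b)) (by
    intro h; rw [div_eq_one_iff_eq hd] at h; apply hb; linear_combination h)
  have hs' := C.ne hs
  have e1 : (a + b) * (a + b)⁻¹ = 1 := mul_inv_cancel₀ hs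
  have e2 : (a - b) * (a + b)⁻¹ * (2 * (a / (a - b)) - 1) = 1 := by field_simp; ring
  obtain ⟨k1, k2⟩ := C.fr F a b (a + b)⁻¹ (by rw [hp, e1, e2]; norm_num)
  rw [C.inv, C.tr F.h1 F.hp, hp] at k1 k2
  have hν : μ a + μ b ≠ 0 := by
    intro h
    exact h2 (C.minj (by rw [C.odd]; linear_combination h))
  have w1 := mul_left_cancel₀ (mul_ne_zero hν (inv_ne_zero hs')) (k2.trans (mul_one _).symm)
  rw [w1] at k1
  have hr0 : a / b ≠ 0 := div_ne_zero ha hb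
  have hr1 : a / b ≠ 1 := by rw [Ne, div_eq_one_iff_eq hb]; exact h1
  have ep : a / (a - b) = (1 + -(a / b)⁻¹)⁻¹ := by
    rw [show 1 + -(a / b)⁻¹ = (a - b) / a by field_simp; ring, inv_div]
  rw [ep, C.inv, C.succ, C.odd, C.inv] at w1
  have hR0 := C.ne hr0
  have hR1 : μ (a / b) - 1 ≠ 0 := fun h => hr1 (C.eq_one (by linear_combination h))
  generalize μ (a / b) = R at *
  have e3 : 2 * (1 + -R⁻¹)⁻¹ - 1 = (R + 1) / (R - 1) := by
    have : 1 + -R⁻¹ = (R - 1) / R := by field_simp; ring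
    rw [this]; field_simp; ring
  rw [e3] at w1
  have w2 : (μ a - μ b) * (R + 1) = μ (a + b) * (R - 1) := by field_simp at w1; linear_combination w1
  have : (μ a + μ b) * (μ a + μ b) = μ (a + b) * μ (a + b) := by
      field_simp at k1; linear_combination k1
  rcases mul_self_eq_mul_self_iff.1 this with h | h
  · left
    refine ⟨h.symm, ?_⟩
    rw [← h] at w2; linear_combination (-1/2) * w2
  · right
    have h' : μ (a + b) = - (μ a + μ b) := by rw [h, neg_neg]
    refine ⟨h', ?_⟩
    rw [h'] at w2; linear_combination (1/2) * w2

theorem Cm.hom {n : ℕ} {ψ : Mat n → Mat n} {μ : ℂ → ℂ} (C : Cm ψ μ) {a b : ℂ} (ha : a ≠ 0) (hb : b ≠ 0) 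
    (h1 : a ≠ b) (h2 : a ≠ -b) : μ (a + b) = μ a + μ b ∧ μ (a / b) * μ b = μ a := by
  have hx := C.ne ha
  have hy := C.ne hb
  have hxy : μ a ≠ μ b := fun h => h1 (C.minj h)
  have hxy' : μ a ≠ - μ b := fun h => h2 (C.minj (by rw [h, C.odd]))
  have hsq : μ a * μ a ≠ μ b * μ b := by
    intro h
    rcases mul_self_eq_mul_self_iff.1 h with h | h
    · exact hxy h
    · exact hxy' h
  rcases C.gen ha hb h1 h2 with h | ⟨h3, h4⟩
  · exact h
  exfalso
  have g := C.gen ha (neg_ne_zero.2 hb) h2 (by rwa [neg_neg])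
  rw [C.odd, div_neg, C.odd] at g
  have g1 : μ (a + -b) = -(μ a + -μ b) := by
    rcases g with g | g
    · exfalso
      apply hsq
      linear_combination μ b * h4 - μ a * g.2
    · exact g.1
  have d1 : (a + b) / b = 1 + a / b := by field_simp; ring
  have d2 : (a + -b) / b = -(1 + -(a / b)) := by field_simp; ring
  have f1 : a ≠ -(2 * b) → μ a ^ 2 + 3 * μ a * μ b + μ b ^ 2 = 0 := by
    intro hne
    have := C.gen (a := a + b) (b := b) (fun h => h2 (by linear_combination h)) hb 
      (fun h => ha (by linear_combination h)) (fun h => hne (by linear_combination h))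
    rw [d1, C.succ, h3] at this
    rcases this with ⟨-, g⟩ | ⟨-, g⟩
    · exfalso
      have : (μ a + μ b) * (μ a + μ b) = 0 := by linear_combination μ a * g - μ b * h4
      exact hxy' (by linear_combination mul_self_eq_zero.1 this)
    · linear_combination -μ a * g - (μ a + μ b) * h4
  have f2 : a ≠ 2 * b → μ a ^ 2 - 3 * μ a * μ b + μ b ^ 2 = 0 := by
    intro hne
    have := C.gen (a := a + -b) (b := b) (fun h => h1 (by linear_combination h)) hb 
      (fun h => hne (by linear_combination h)) (fun h => ha (by linear_combination h))
    rw [d2, C.odd, C.succ, C.odd, g1] at this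
    rcases this with ⟨-, g⟩ | ⟨-, g⟩
    · exfalso
      have : (μ a - μ b) * (μ a - μ b) = 0 := by linear_combination μ a * g - μ b * h4
      exact hxy (by linear_combination mul_self_eq_zero.1 this)
    · linear_combination μ a * g + (μ a - μ b) * h4
  by_cases c1 : a = 2 * b
  · have e : a / b = 2 := by rw [c1]; field_simp
    rw [e, C.two] at h4
    have := f1 (fun h => hb (by linear_combination (1/4) * (h - c1)))
    have : μ a ^ 2 * 11 = 0 := by linear_combination this + (3 * μ a + 2 * μ a + μ b) * h4
    simp at this; exact hx this
  by_cases c2 : a = -(2 * b)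
  · have e : a / b = -2 := by rw [c2]; field_simp
    rw [e, C.odd, C.two] at h4
    have := f2 c1
    have : μ a ^ 2 * 11 = 0 := by linear_combination this + (-3 * μ a - 2 * μ a + μ b) * h4
    simp at this; exact hx this
  have k1 := f1 c2
  have k2 := f2 c1
  have : μ a * μ b = 0 := by linear_combination (1/6) * k1 - (1/6) * k2
  exact mul_ne_zero hx hy this

theorem Cm.dbl {n : ℕ} {ψ : Mat n → Mat n} {μ : ℂ → ℂ} (C : Cm ψ μ) (b : ℂ) : μ (b + b) = μ b + μ b := by
  by_cases hb : b = 0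
  · rw [hb, add_zero, C.zero, add_zero]
  have h := (C.hom (a := b + b) (b := b) (fun h => hb (by linear_combination (1/2) * h)) hb (fun h => hb (by linear_combination h)) 
    (fun h => hb (by linear_combination (1/3) * h))).2
  rw [show (b + b) / b = 2 by field_simp; norm_num, C.two] at h
  rw [← h]; ring

theorem Cm.add {n : ℕ} {ψ : Mat n → Mat n} {μ : ℂ → ℂ} (C : Cm ψ μ) (a b : ℂ) : μ (a + b) = μ a + μ b := by
  by_cases ha : a = 0
  · rw [ha, zero_add, C.zero, zero_add]
  by_cases hb : b = 0
  · rw [hb, add_zero, C.zero, add_zero]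
  by_cases h1 : a = b
  · rw [h1, C.dbl]
  by_cases h2 : a = -b
  · rw [h2, C.odd, neg_add_cancel, C.zero, neg_add_cancel]
  exact (C.hom ha hb h1 h2).1

theorem Cm.mulm {n : ℕ} {ψ : Mat n → Mat n} {μ : ℂ → ℂ} (C : Cm ψ μ) (a b : ℂ) : μ (a * b) = μ a * μ b := by
  have key : ∀ a b : ℂ, b ≠ 0 → μ (a / b) * μ b = μ a := by
    intro a b hb
    by_cases ha : a = 0
    · rw [ha, zero_div, C.zero, zero_mul]
    by_cases h1 : a = b
    · rw [h1, div_self hb, C.one, one_mul]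
    by_cases h2 : a = -b
    · rw [h2, neg_div, div_self hb, C.odd, C.odd, C.one]; ring
    exact (C.hom ha hb h1 h2).2
  by_cases hb : b = 0
  · rw [hb, mul_zero, C.zero, mul_zero]
  have := key (a * b) b hb
  rw [mul_div_cancel_right₀ a hb] at this
  exact this.symm

theorem Cm.surj {n : ℕ} {ψ : Mat n → Mat n} {μ : ℂ → ℂ} (C : Cm ψ μ) (z : ℂ) : ∃ w, μ w = z := by
  obtain ⟨P', Q', hP', hQ', h⟩ := tr_pair C.hn z
  obtain ⟨P, -, rfl⟩ := C.H.pre hP'.idem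
  obtain ⟨Q, -, rfl⟩ := C.H.pre hQ'.idem
  exact ⟨_, by rw [← C.tr (C.H.R1.2 hP') (C.H.R1.2 hQ'), h]⟩

theorem Cm.equiv {n : ℕ} {ψ : Mat n → Mat n} {μ : ℂ → ℂ} (C : Cm ψ μ) : ∃ σ : ℂ ≃+* ℂ, ∀ z, σ z = μ z := by
  let f : ℂ →+* ℂ := 
    { toFun := μ, map_one' := C.one, map_zero' := C.zero, map_add' := C.add, map_mul' := C.mulm }
  exact ⟨RingEquiv.ofBijective f ⟨fun a b h => C.minj h, fun z => C.surj z⟩, fun z => rfl⟩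


theorem Nm.comp {n : ℕ} {ψ : Mat n → Mat n} (H : Nm ψ) (g : Mat n ≃ Mat n) (hg : ∀ A B, rel A B ↔ rel (g A) (g B))
    (h1 : g 1 = 1) (h2 : g (-1) = -1) : Nm (fun A => g (ψ A)) := by
  refine ⟨fun A B => (H.hr A B).trans (hg _ _), fun P hP => ?_, fun P hP => ?_, ?_, ?_⟩
  · have : rel 1 (g.symm P) := by rw [hg, h1, g.apply_symm_apply, rel_one_left, hP]
    obtain ⟨A, hA⟩ := H.hi _ (rel_one_left.1 this)
    exact ⟨A, by simp [hA]⟩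
  · have : rel (-1) (g.symm (-P)) := by rw [hg, h2, g.apply_symm_apply, rel_negone_left]; simp [hP]
    have h3 := rel_negone_left.1 this
    obtain ⟨A, hA⟩ := H.ha (-(g.symm (-P))) (by rw [neg_mul_neg, h3])
    exact ⟨A, by simp [hA]⟩
  · show g (ψ 1) = 1
    rw [H.one, h1]
  · show g (ψ (-1)) = -1
    rw [H.negone, h2]

theorem rel_ringEquiv {n : ℕ} (g : Mat n ≃+* Mat n) (A B : Mat n) : rel A B ↔ rel (g A) (g B) := by
  unfold rel
  rw [← g.injective.eq_iff, two_smul, two_smul]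
  simp only [map_mul, map_add]

theorem Cm.tw {n : ℕ} {ψ : Mat n → Mat n} {μ : ℂ → ℂ} (C : Cm ψ μ) (σ : ℂ ≃+* ℂ) (hσ : ∀ z, σ z = μ z) :
    Cm (fun A => (ψ A).map σ.symm) id := by
  refine ⟨?_, C.hn, ?_⟩
  · exact C.H.comp (σ.symm.mapMatrix (m := Fin n)).toEquiv (rel_ringEquiv _)
      (map_one (σ.symm.mapMatrix (m := Fin n))) (by
        show σ.symm.mapMatrix (m := Fin n) (-1) = -1
        rw [map_neg, map_one])
  · intro P hP l
    rw [C.mu P hP, ← hσ]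
    ext i j
    simp

def cj {n : ℕ} (T U : Mat n) (h : U * T = 1) : Mat n ≃ Mat n where
  toFun A := U * A * T
  invFun A := T * A * U
  left_inv A := by
    have h' : T * U = 1 := mul_eq_one_comm.1 h
    show T * (U * A * T) * U = A
    calc T * (U * A * T) * U = (T * U) * A * (T * U) := by simp only [Matrix.mul_assoc]
      _ = A := by rw [h', Matrix.one_mul, Matrix.mul_one]
  right_inv A := by
    show U * (T * A * U) * T = A
    calc U * (T * A * U) * T = (U * T) * A * (U * T) := by simp only [Matrix.mul_assoc]
      _ = A := by rw [h, Matrix.one_mul, Matrix.mul_one]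

theorem Nm.conj {n : ℕ} {ψ : Mat n → Mat n} (H : Nm ψ) {T U : Mat n} (h : U * T = 1) : Nm (fun A => U * ψ A * T) := by
  have h' : T * U = 1 := mul_eq_one_comm.1 h
  refine H.comp (cj T U h) (fun A B => (rel_corner' h').symm) ?_ ?_
  · show U * 1 * T = 1
    rw [Matrix.mul_one, h]
  · show U * (-1) * T = -1
    simp [h]

theorem Cm.conj {n : ℕ} {ψ : Mat n → Mat n} {μ : ℂ → ℂ} (C : Cm ψ μ) {T U : Mat n} (h : U * T = 1) : 
    Cm (fun A => U * ψ A * T) μ := by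
  refine ⟨C.H.conj h, C.hn, fun P hP l => ?_⟩
  rw [C.mu P hP, Matrix.mul_smul, Matrix.smul_mul]

theorem vmv_zero {n : ℕ} {s : ℂ} {u v : Fin n → ℂ} (hu : u ≠ 0) (hv : v ≠ 0) (hh : s • vecMulVec u v = 0) : s = 0 := by
  obtain ⟨i, hi⟩ := Function.ne_iff.1 hu
  obtain ⟨j, hj⟩ := Function.ne_iff.1 hv
  have := congrFun (congrFun hh i) j
  rw [Matrix.smul_apply, vecMulVec_apply] at this
  exact (smul_eq_zero.1 this).resolve_right (mul_ne_zero hi hj)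

def eu {n : ℕ} (i j : Fin n) : Mat n := vecMulVec (Pi.single i 1) (Pi.single j 1)

theorem eu_R1 {n : ℕ} (i : Fin n) : R1 (eu i i) := ⟨_, _, by simp, rfl⟩

theorem eu_orth {n : ℕ} {i j : Fin n} (h : i ≠ j) : Orth (eu i i) (eu j j) := by
  constructor <;> simp [eu, vecMulVec_mul_vecMulVec, h, h.symm]

theorem eu_tr {n : ℕ} (i j : Fin n) (M : Mat n) : trace (eu i j * M) = M j i := by
  rw [eu, vecMulVec_mul, trace_vecMulVec]
  simp

theorem eu_sand {n : ℕ} (i j : Fin n) (M : Mat n) : eu i i * M * eu j j = M i j • eu i j := by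
  rw [eu, eu, eu, vecMulVec_mul, vecMulVec_mul_vecMulVec, vmv_smul]
  simp

theorem Cm.norml {n : ℕ} {ψ : Mat n → Mat n} {μ : ℂ → ℂ} (C : Cm ψ μ) : ∃ T U : Mat n, U * T = 1 ∧ 
    ∀ i, U * ψ (eu i i) * T = eu i i := by
  have h := fun i => C.H.R1.1 (eu_R1 (n := n) i)
  choose x f hf he using h
  have hU : (Matrix.of f) * (Matrix.of fun a i => x i a) = (1 : Mat n) := by
    ext i j
    have e : ((Matrix.of f) * (Matrix.of fun a i => x i a) : Mat n) i j = f i ⬝ᵥ x j := by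
      simp [Matrix.mul_apply, dotProduct]
    rw [e]
    by_cases hij : i = j
    · rw [hij, hf, Matrix.one_apply_eq]
    · rw [Matrix.one_apply_ne hij]
      have ho := ((C.H.anti (C.H.good1 C.hn (eu_R1 j))).1 (eu_orth hij)).1
      rw [he, he, vecMulVec_mul_vecMulVec, vmv_smul] at ho
      refine vmv_zero ?_ ?_ ho
      · intro h0; have := hf i; rw [h0] at this; simp at this
      · intro h0; have := hf j; rw [h0] at this; simp at this
  refine ⟨_, _, hU, fun i => ?_⟩
  rw [he, vmv_conj, eu]
  congr 1
  · ext a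
    have := congrFun (congrFun hU a) i
    rw [Matrix.mul_apply] at this
    simp only [Matrix.of_apply] at this
    simp only [mulVec, dotProduct, Matrix.of_apply, this, Matrix.one_apply, Pi.single_apply]
  · ext a
    have := congrFun (congrFun hU i) a
    rw [Matrix.mul_apply] at this
    simp only [Matrix.of_apply] at this
    simp only [vecMul, dotProduct, Matrix.of_apply, this, Matrix.one_apply, Pi.single_apply, eq_comm]

theorem R1.minor {n : ℕ} {M : Mat n} (h : R1 M) (i j k l : Fin n) : M i j * M k l = M i l * M k j := by
  obtain ⟨x, f, -, rfl⟩ := h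
  simp only [vecMulVec_apply]; ring

def fu {n : ℕ} (i j : Fin n) : Mat n := eu i i + eu i j

theorem fu_R1 {n : ℕ} {i j : Fin n} (h : i ≠ j) : R1 (fu i j) := 
  ⟨Pi.single i 1, Pi.single i 1 + Pi.single j 1, by simp [h, h.symm], by rw [fu, vecMulVec_add]; rfl⟩

theorem fu_app {n : ℕ} {i j : Fin n} (h : i ≠ j) : fu i j i j = 1 ∧ fu i j j i = 0 ∧ fu i j i i = 1 ∧ fu i j j j = 0 := by
  simp [fu, eu, vecMulVec_apply, h, h.symm]

structure Cs {n : ℕ} (χ : Mat n → Mat n) : Prop where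
  C : Cm χ id
  e : ∀ i, χ (eu i i) = eu i i

theorem Cs.dg {n : ℕ} {χ : Mat n → Mat n} (K : Cs χ) {P : Mat n} (hP : R1 P) (i : Fin n) : χ P i i = P i i := by
  have := K.C.tr (eu_R1 i) hP
  rw [K.e, eu_tr, eu_tr] at this
  exact this

theorem Cs.key {n : ℕ} {χ : Mat n → Mat n} (K : Cs χ) {i j : Fin n} (h : i ≠ j) : 
    ∃ q r : ℂ, q * r = 0 ∧ ∀ P, R1 P → q * χ P j i + r * χ P i j = P j i := by
  have hF := fu_R1 h
  obtain ⟨a1, a2, a3, a4⟩ := fu_app h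
  have hS := K.C.H.goodadd K.C.hn (eu_R1 i) (eu_R1 j) (eu_orth h)
  have hle : le' (χ (fu i j)) (eu i i + eu j j) := by
    rw [← K.e i, ← K.e j, ← K.C.H.addR K.C.hn (eu_R1 i) (eu_R1 j) (eu_orth h), ← K.C.H.corner hS]
    constructor <;> simp [fu, eu, Matrix.add_mul, Matrix.mul_add, vecMulVec_mul_vecMulVec, h, h.symm]
  have hG1 := K.dg hF i
  have hG2 := K.dg hF j
  have hR := K.C.H.R1.1 hF
  have hm := hR.minor i j j i
  have htr := fun P (hP : R1 P) => K.C.tr hF hP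
  generalize χ (fu i j) = G at *
  have hG : G = eu i i + G i j • eu i j + G j i • eu j i := by
    have : G = (eu i i + eu j j) * G * (eu i i + eu j j) := by rw [hle.2, hle.1]
    rw [Matrix.add_mul, Matrix.mul_add, Matrix.add_mul, Matrix.add_mul, eu_sand, eu_sand, eu_sand, eu_sand, hG1, hG2, 
      a3, a4] at this
    nth_rw 1 [this]
    module
  refine ⟨G i j, G j i, by rw [hm, hG2, a4, mul_zero], fun P hP => ?_⟩
  have := htr P hP
  rw [hG, fu] at this
  simp only [Matrix.add_mul, Matrix.smul_mul, trace_add, trace_smul, eu_tr, K.dg hP, id, smul_eq_mul] at this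
  linear_combination this

def St {n : ℕ} (χ : Mat n → Mat n) (i j : Fin n) : Prop := ∃ c : ℂ, c ≠ 0 ∧ ∀ P, R1 P → χ P i j = c * P i j
def Tw {n : ℕ} (χ : Mat n → Mat n) (i j : Fin n) : Prop := ∃ c : ℂ, c ≠ 0 ∧ ∀ P, R1 P → χ P i j = c * P j i

theorem Cs.A {n : ℕ} {χ : Mat n → Mat n} (K : Cs χ) {i j : Fin n} (h : i ≠ j) : St χ j i ∨ Tw χ i j := by
  obtain ⟨q, r, h0, hk⟩ := K.key h
  have h1 := hk _ (fu_R1 h.symm)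
  rw [(fu_app h.symm).1] at h1
  rcases mul_eq_zero.1 h0 with hq | hr
  · right
    have hr : r ≠ 0 := by rintro rfl; rw [hq] at h1; simp at h1
    refine ⟨r⁻¹, inv_ne_zero hr, fun P hP => ?_⟩
    have := hk P hP
    rw [← this, hq]; field_simp; ring
  · left
    have hq : q ≠ 0 := by rintro rfl; rw [hr] at h1; simp at h1
    refine ⟨q⁻¹, inv_ne_zero hq, fun P hP => ?_⟩
    have := hk P hP
    rw [← this, hr]; field_simp; ring

theorem ST_not {n : ℕ} {χ : Mat n → Mat n} {i j : Fin n} (h : i ≠ j) (h1 : St χ i j) (h2 : Tw χ i j) : False := by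
  obtain ⟨c, hc, k1⟩ := h1
  obtain ⟨d, hd, k2⟩ := h2
  have := (k1 _ (fu_R1 h)).symm.trans (k2 _ (fu_R1 h))
  rw [(fu_app h).1, (fu_app h).2.1, mul_zero, mul_one] at this
  exact hc this

theorem Cs.B {n : ℕ} {χ : Mat n → Mat n} (K : Cs χ) {i j : Fin n} (h : i ≠ j) : St χ i j ∨ Tw χ i j := by
  rcases K.A h with h1 | h1
  · rcases K.A h.symm with h2 | h2
    · left; exact h2
    · exact (ST_not h.symm h1 h2).elim
  · right; exact h1

theorem Cs.S {n : ℕ} {χ : Mat n → Mat n} (K : Cs χ) {i j : Fin n} (h : i ≠ j) (h1 : St χ i j) : St χ j i := by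
  rcases K.A h with h2 | h2
  · exact h2
  · exact (ST_not h h1 h2).elim

theorem Cs.D {n : ℕ} {χ : Mat n → Mat n} (K : Cs χ) {i j k : Fin n} (h1 : i ≠ j) (h2 : i ≠ k) (h3 : j ≠ k) 
    (h : St χ i j) : St χ i k := by
  apply K.S h2.symm
  rcases K.B h2.symm with h4 | h4
  · exact h4
  exfalso
  have hR : R1 (eu i i + eu i j + eu i k) := 
    ⟨Pi.single i 1, Pi.single i 1 + Pi.single j 1 + Pi.single k 1, by simp [h1, h1.symm, h2, h2.symm], by 
      rw [vecMulVec_add, vecMulVec_add]; rfl⟩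
  have hm := (K.C.H.R1.1 hR).minor i j k i
  rw [K.dg hR i] at hm
  have hz : χ (eu i i + eu i j + eu i k) k j = 0 := by
    rcases K.B h3.symm with ⟨c, hc, h5⟩ | ⟨c, hc, h5⟩ <;> rw [h5 _ hR] <;> 
      simp [eu, vecMulVec_apply, h1, h1.symm, h2, h2.symm, h3, h3.symm]
  obtain ⟨c, hc, h⟩ := h
  obtain ⟨d, hd, h4⟩ := h4
  rw [hz, h _ hR, h4 _ hR] at hm
  simp [eu, vecMulVec_apply, h1, h1.symm, h2, h2.symm, h3, h3.symm, hc, hd] at hm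

theorem Cs.all {n : ℕ} {χ : Mat n → Mat n} (K : Cs χ) : (∀ i j, St χ i j) ∨ (∀ i j, Tw χ i j) := by
  by_cases h : ∃ i j, i ≠ j ∧ St χ i j
  · left
    obtain ⟨a, b, hab, h⟩ := h
    have h1 : ∀ {i j k}, i ≠ j → i ≠ k → St χ i j → St χ i k := by
      intro i j k h1 h2 h3
      by_cases hjk : j = k
      · rw [← hjk]; exact h3
      · exact K.D h1 h2 hjk h3
    intro i j
    by_cases hij : i = j
    · rw [hij]; exact ⟨1, one_ne_zero, fun P hP => by rw [K.dg hP, one_mul]⟩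
    by_cases hai : i = a
    · rw [hai] at hij ⊢
      exact h1 hab hij h
    · exact h1 hai hij (K.S (Ne.symm hai) (h1 hab (Ne.symm hai) h))
  · right
    intro i j
    by_cases hij : i = j
    · rw [hij]; exact ⟨1, one_ne_zero, fun P hP => by rw [K.dg hP, one_mul]⟩
    rcases K.B hij with h1 | h1
    · exact absurd ⟨i, j, hij, h1⟩ h
    · exact h1

theorem ones_R1 {n : ℕ} (hn : 3 ≤ n) : R1 (vecMulVec (fun _ => 1) (fun _ => (n:ℂ)⁻¹) : Mat n) := by
  refine ⟨_, _, ?_, rfl⟩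
  have : (n:ℂ) ≠ 0 := by norm_cast; omega
  simp [dotProduct, this]

theorem Cs.coc {n : ℕ} {χ : Mat n → Mat n} (K : Cs χ) {c : Fin n → Fin n → ℂ} (hc : ∀ i j, c i j ≠ 0)
    (h : ∀ i j, χ (vecMulVec (fun _ => 1) (fun _ => (n:ℂ)⁻¹)) i j = c i j * (n:ℂ)⁻¹) : 
    ∃ d : Fin n → ℂ, (∀ i, d i ≠ 0) ∧ ∀ i j, c i j = d i * (d j)⁻¹ := by
  have hn := K.C.hn
  have h0 : (n:ℂ) ≠ 0 := by norm_cast; omega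
  have hR := ones_R1 hn
  have hm := (K.C.H.R1.1 hR).minor
  simp only [h] at hm
  have hdg : ∀ i, c i i = 1 := by
    intro i
    have := K.dg hR i
    rw [h, vecMulVec_apply, one_mul] at this
    exact mul_right_cancel₀ (inv_ne_zero h0) (this.trans (one_mul _).symm)
  have hm' : ∀ i j k l, c i j * c k l = c i l * c k j := by
    intro i j k l
    have := hm i j k l
    apply mul_right_cancel₀ (mul_ne_zero (inv_ne_zero h0) (inv_ne_zero h0))
    linear_combination this
  let z : Fin n := ⟨0, by omega⟩
  refine ⟨fun i => c i z, fun i => hc i z, fun i j => ?_⟩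
  rw [eq_mul_inv_iff_mul_eq₀ (hc j z), hm', hdg, mul_one]

theorem Cs.fin {n : ℕ} {χ : Mat n → Mat n} (K : Cs χ) : ∃ W V : Mat n, W * V = 1 ∧ 
    ((∀ P, R1 P → χ P = W * P * V) ∨ (∀ P, R1 P → χ P = W * Pᵀ * V)) := by
  have hR := ones_R1 K.C.hn
  rcases K.all with h | h <;> choose c hc h using h
  · obtain ⟨d, hd, hcd⟩ := K.coc hc (fun i j => by rw [h i j _ hR, vecMulVec_apply, one_mul])
    refine ⟨diagonal d, diagonal fun i => (d i)⁻¹, by simp [diagonal_mul_diagonal, hd], Or.inl fun P hP => ?_⟩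
    ext i j
    rw [h i j P hP, mul_diagonal, diagonal_mul, hcd]; ring
  · obtain ⟨d, hd, hcd⟩ := K.coc hc (fun i j => by rw [h i j _ hR, vecMulVec_apply, one_mul])
    refine ⟨diagonal d, diagonal fun i => (d i)⁻¹, by simp [diagonal_mul_diagonal, hd], Or.inr fun P hP => ?_⟩
    ext i j
    rw [h i j P hP, mul_diagonal, diagonal_mul, hcd, transpose_apply]; ring

theorem Cm.struct {n : ℕ} {χ : Mat n → Mat n} (C : Cm χ id) : ∃ W V : Mat n, W * V = 1 ∧ 
    ((∀ P, R1 P → χ P = W * P * V) ∨ (∀ P, R1 P → χ P = W * Pᵀ * V)) := by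
  obtain ⟨T, U, hUT, he⟩ := C.norml
  have hTU : T * U = 1 := mul_eq_one_comm.1 hUT
  have K : Cs (fun A => U * χ A * T) := ⟨C.conj hUT, he⟩
  obtain ⟨W, V, hWV, h⟩ := K.fin
  refine ⟨T * W, V * U, ?_, ?_⟩
  · calc T * W * (V * U) = T * (W * V) * U := by simp only [Matrix.mul_assoc]
      _ = 1 := by rw [hWV, Matrix.mul_one, hTU]
  · have aux : ∀ X Y : Mat n, U * X * T = W * Y * V → X = T * W * Y * (V * U) := by
      intro X Y hXY
      calc X = (T * U) * X * (T * U) := by rw [hTU, Matrix.one_mul, Matrix.mul_one]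
        _ = T * (U * X * T) * U := by simp only [Matrix.mul_assoc]
        _ = _ := by rw [hXY]; simp only [Matrix.mul_assoc]
    rcases h with h | h
    · left; exact fun P hP => aux _ _ (h P hP)
    · right; exact fun P hP => aux _ _ (h P hP)

theorem fix_all {n : ℕ} {Θ : Mat n → Mat n} (hr : ∀ A B, rel A B ↔ rel (Θ A) (Θ B))
    (hf : ∀ P, R1 P → ∀ l : ℂ, Θ (l • P) = l • P) (A : Mat n) : Θ A = A := by
  refine TT_all n {A | Θ A = A} ?_ ?_ A
  · intro x f h l
    exact hf _ ⟨x, f, h, rfl⟩ l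
  · intro A hA
    apply hA
    intro B hB
    rw [hr, show Θ B = B from hB]

theorem Cm.full {n : ℕ} {χ : Mat n → Mat n} (C : Cm χ id) : ∃ W V : Mat n, W * V = 1 ∧ 
    ((∀ A, χ A = W * A * V) ∨ (∀ A, χ A = W * Aᵀ * V)) := by
  obtain ⟨W, V, hWV, h⟩ := C.struct
  have hVW : V * W = 1 := mul_eq_one_comm.1 hWV
  have aux : ∀ X : Mat n, W * (V * X * W) * V = X := by
    intro X
    calc W * (V * X * W) * V = (W * V) * X * (W * V) := by simp only [Matrix.mul_assoc]
      _ = X := by rw [hWV, Matrix.one_mul, Matrix.mul_one]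
  have aux2 : ∀ X : Mat n, V * (W * X * V) * W = X := by
    intro X
    calc V * (W * X * V) * W = (V * W) * X * (V * W) := by simp only [Matrix.mul_assoc]
      _ = X := by rw [hVW, Matrix.one_mul, Matrix.mul_one]
  refine ⟨W, V, hWV, ?_⟩
  rcases h with h | h
  · left
    intro A
    have := fix_all (Θ := fun A => V * χ A * W) (fun A B => by rw [rel_corner' hWV, ← C.H.hr])
      (fun P hP l => by rw [C.mu P hP, h P hP, id, Matrix.mul_smul, Matrix.smul_mul, aux2]) A
    rw [← aux (χ A), this]
  · right
    intro A
    have := fix_all (Θ := fun A => (V * χ A * W)ᵀ) (fun A B => by rw [rel_transpose, rel_corner' hWV, ← C.H.hr])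
      (fun P hP l => by rw [C.mu P hP, h P hP, id, Matrix.mul_smul, Matrix.smul_mul, aux2, transpose_smul, transpose_transpose]) A
    have t2 : V * χ A * W = Aᵀ := by rw [← transpose_transpose (V * χ A * W), this]
    rw [← aux (χ A), t2]

theorem Nm.full {n : ℕ} (hn : 3 ≤ n) {ψ : Mat n → Mat n} (H : Nm ψ) : ∃ (σ : ℂ ≃+* ℂ) (W V : Mat n), W * V = 1 ∧ 
    ((∀ A, ψ A = W * A.map σ * V) ∨ (∀ A, ψ A = W * (A.map σ)ᵀ * V)) := by
  obtain ⟨μ, C⟩ := H.cm hn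
  obtain ⟨σ, hσ⟩ := C.equiv
  obtain ⟨W, V, hWV, h⟩ := (C.tw σ hσ).full
  have key : ∀ X Y : Mat n, X.map σ.symm = W * Y * V → X = W.map σ * Y.map σ * V.map σ := by
    intro X Y h
    have := congrArg (fun Z : Mat n => Z.map σ) h
    simp only [Matrix.map_mul] at this
    rw [← this]
    ext i j; simp
  refine ⟨σ, W.map σ, V.map σ, ?_, ?_⟩
  · rw [← Matrix.map_mul, hWV]; simp
  · rcases h with h | h
    · left; exact fun A => key _ _ (h A)
    · right; exact fun A => key _ _ (h A)


theorem idem_rel {n : ℕ} {α c : ℂ} (h : α * c ^ 2 = 1 / 2) (A B : Mat n) :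
    IsIdempotentElem (α • ((c • A) * (c • B) + (c • B) * (c • A))) ↔ rel A B := by
  have e : α • ((c • A) * (c • B) + (c • B) * (c • A)) = (1 / 2 : ℂ) • (A * B + B * A) := by
    rw [← h, smul_mul_smul_comm, smul_mul_smul_comm]; module
  rw [e]
  unfold IsIdempotentElem rel
  rw [smul_mul_smul_comm]
  generalize (A * B + B * A) * (A * B + B * A) = X
  generalize A * B + B * A = Y
  constructor
  · intro h
    linear_combination (norm := module) (4:ℂ) • h
  · intro h
    rw [h]; module

theorem stmt_3 {n : ℕ} (hn : 3 ≤ n)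
    (α : ℂ) (hα : α ≠ 0) (c : ℂ) (hc : c ^ 2 = (2 * α)⁻¹)
    (φ : Matrix (Fin n) (Fin n) ℂ → Matrix (Fin n) (Fin n) ℂ)
    (hrange : ∀ P : Matrix (Fin n) (Fin n) ℂ,
      ((P * P = P ∧ P ≠ 0) ∨ (P * P = -P ∧ P ≠ 0)) → ∃ A, φ A = c • P)
    (hpres : ∀ A B : Matrix (Fin n) (Fin n) ℂ,
      IsIdempotentElem (α • (A * B + B * A)) ↔
        IsIdempotentElem (α • (φ A * φ B + φ B * φ A))) :
    ∃ (σ : ℂ ≃+* ℂ) (T : Matrix (Fin n) (Fin n) ℂ) (cα : ℂ),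
      IsUnit T ∧ cα ^ 2 = σ α / α ∧
      ((∀ M : Matrix (Fin n) (Fin n) ℂ, φ M = cα • (T * M.map ⇑σ * T⁻¹)) ∨
       (∀ M : Matrix (Fin n) (Fin n) ℂ, φ M = cα • (T * (M.map ⇑σ)ᵀ * T⁻¹))) := by
  have hc0 : c ≠ 0 := by
    rintro rfl
    rw [zero_pow (by norm_num)] at hc
    exact inv_ne_zero (mul_ne_zero two_ne_zero hα) hc.symm
  have hac : α * c ^ 2 = 1 / 2 := by rw [hc]; field_simp
  obtain ⟨ψ, hψ⟩ : ∃ ψ : Mat n → Mat n, ∀ A, φ (c • A) = c • ψ A :=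
    ⟨fun A => c⁻¹ • φ (c • A), fun A => by rw [smul_smul, mul_inv_cancel₀ hc0, one_smul]⟩
  have hpre : ∀ P A : Mat n, φ A = c • P → ψ (c⁻¹ • A) = P := by
    intro P A h
    have := hψ (c⁻¹ • A)
    rw [smul_smul, mul_inv_cancel₀ hc0, one_smul, h] at this
    exact (smul_right_injective _ hc0 this).symm
  have hN := mk_Nm (ψ := ψ) (fun A B => by
      rw [← idem_rel hac, hpres, hψ, hψ, idem_rel hac])
    (fun P hP h0 => by
      obtain ⟨A, hA⟩ := hrange P (Or.inl ⟨hP, h0⟩)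
      exact ⟨_, hpre _ _ hA⟩)
    (fun P hP h0 => by
      obtain ⟨A, hA⟩ := hrange (-P) (Or.inr ⟨by rw [neg_mul_neg, neg_neg, hP], neg_ne_zero.2 h0⟩)
      exact ⟨_, hpre _ _ hA⟩) (by omega)
  obtain ⟨ε, hε, hN⟩ : ∃ ε : ℂ, ε * ε = 1 ∧ Nm (fun A => ε • ψ A) := by
    rcases hN with h | h
    · exact ⟨1, by norm_num, by simpa using h⟩
    · exact ⟨-1, by norm_num, by simpa using h⟩
  obtain ⟨σ, W, V, hWV, h⟩ := hN.full hn
  have hσc : σ c ≠ 0 := by simpa using hc0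
  have hσα : σ α ≠ 0 := by simpa using hα
  have hφ : ∀ M : Mat n, φ M = (c * ε) • (ε • ψ (c⁻¹ • M)) := by
    intro M
    have := hψ (c⁻¹ • M)
    rw [smul_smul, mul_inv_cancel₀ hc0, one_smul] at this
    rw [this, smul_smul, mul_assoc, hε, mul_one]
  have hmap : ∀ M : Mat n, (c⁻¹ • M).map σ = (σ c)⁻¹ • M.map σ := by
    intro M; ext i j; simp
  refine ⟨σ, W, c * ε * (σ c)⁻¹, IsUnit.of_mul_eq_one V hWV, ?_, ?_⟩
  · have h2 : σ c ^ 2 = (2 * σ α)⁻¹ := by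
      rw [← map_pow, hc, map_inv₀, map_mul, map_ofNat]
    rw [mul_pow, mul_pow, inv_pow, h2, hc, pow_two ε, hε]
    field_simp
  · rw [Matrix.inv_eq_right_inv hWV]
    rcases h with h | h
    · left
      intro M
      rw [hφ, h, hmap, Matrix.mul_smul, Matrix.smul_mul, smul_smul]
    · right
      intro M
      rw [hφ, h, hmap, transpose_smul, Matrix.mul_smul, Matrix.smul_mul, smul_smul]
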